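/- Let G = ⟨S|R⟩ be a C'(1/6) group whose Cayley graph Cay(G,S) does not satisfy the geodesic MLTG property. Then G satisfies the increasing partial small-cancellation condition (IPSC). -/

import Mathlib

open Metric Set Filter

namespace MorseLTG

/-- A Morse gauge: a non-decreasing continuous function `[1, ∞) → [0, ∞)`. -/
def IsMorseGauge (M : ℝ → ℝ) : Prop :=
  MonotoneOn M (Set.Ici 1) ∧ ContinuousOn M (Set.Ici 1) ∧ ∀ t : ℝ, 1 ≤ t → 0 ≤ M t

section Space

variable {X : Type*} [MetricSpace X]

/-- `γ` is a `Q`-quasi-geodesic on the set `I ⊆ ℝ`. -/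
def QGeoOn (Q : ℝ) (I : Set ℝ) (γ : ℝ → X) : Prop :=
  ContinuousOn γ I ∧ ∀ s ∈ I, ∀ t ∈ I,
    |t - s| / Q - Q ≤ dist (γ s) (γ t) ∧ dist (γ s) (γ t) ≤ Q * |t - s| + Q

/-- `γ` is `M`-Morse on `I`: every `Q`-quasi-geodesic with endpoints on `γ|_I`
stays in the closed `M Q`-neighbourhood of the corresponding subsegment of `γ`. -/
def MorseOn (M : ℝ → ℝ) (I : Set ℝ) (γ : ℝ → X) : Prop :=
  ∀ Q : ℝ, 1 ≤ Q → ∀ s ∈ I, ∀ t ∈ I, s ≤ t →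
    ∀ (lam : ℝ → X) (a b : ℝ), a ≤ b → QGeoOn Q (Set.Icc a b) lam →
      lam a = γ s → lam b = γ t →
      ∀ u ∈ Set.Icc a b, ∃ v ∈ Set.Icc s t, dist (lam u) (γ v) ≤ M Q

/-- `γ` is a geodesic on `I` (an isometric embedding). -/
def GeodesicOn (I : Set ℝ) (γ : ℝ → X) : Prop :=
  ∀ s ∈ I, ∀ t ∈ I, dist (γ s) (γ t) = |t - s|

/-- A geodesic ray based at `x₀`. -/
def GeodesicRayFrom (x₀ : X) (γ : ℝ → X) : Prop :=
  γ 0 = x₀ ∧ GeodesicOn (Set.Ici 0) γ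

/-- A Morse geodesic ray (based anywhere). -/
def IsMorseGeodesicRay (γ : ℝ → X) : Prop :=
  GeodesicOn (Set.Ici 0) γ ∧ ∃ M : ℝ → ℝ, IsMorseGauge M ∧ MorseOn M (Set.Ici 0) γ

/-- `p` is `L`-locally an `M`-Morse `Q`-quasi-geodesic on `I`. -/
def LocMorseQGeoOn (Q : ℝ) (M : ℝ → ℝ) (L : ℝ) (I : Set ℝ) (p : ℝ → X) : Prop :=
  ∀ s ∈ I, ∀ t ∈ I, s ≤ t → t - s ≤ L →
    QGeoOn Q (Set.Icc s t) p ∧ MorseOn M (Set.Icc s t) p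

/-- `p` is `L`-locally `M`-Morse on `I`. -/
def LocMorseOn (M : ℝ → ℝ) (L : ℝ) (I : Set ℝ) (p : ℝ → X) : Prop :=
  ∀ s ∈ I, ∀ t ∈ I, s ≤ t → t - s ≤ L → MorseOn M (Set.Icc s t) p

/-- The Morse local-to-global property for a geodesic metric space. -/
def MLTG (X : Type*) [MetricSpace X] : Prop :=
  ∀ Q : ℝ, 1 ≤ Q → ∀ M : ℝ → ℝ, IsMorseGauge M →
    ∃ (L Q' : ℝ) (M' : ℝ → ℝ), 0 < L ∧ 1 ≤ Q' ∧ IsMorseGauge M' ∧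
      ∀ I : Set ℝ, I.OrdConnected → ∀ p : ℝ → X,
        LocMorseQGeoOn Q M L I p → QGeoOn Q' I p ∧ MorseOn M' I p

/-- `X` is a geodesic metric space. -/
def GeodesicSpace (X : Type*) [MetricSpace X] : Prop :=
  ∀ x y : X, ∃ γ : ℝ → X, γ 0 = x ∧ γ (dist x y) = y ∧
    GeodesicOn (Set.Icc 0 (dist x y)) γ

/-- Gromov hyperbolicity via thin geodesic triangles. -/
def GromovHyperbolic (X : Type*) [MetricSpace X] : Prop :=
  ∃ δ : ℝ, 0 ≤ δ ∧
    ∀ (γ₁ γ₂ γ₃ : ℝ → X) (a₁ b₁ a₂ b₂ a₃ b₃ : ℝ),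
      GeodesicOn (Set.Icc a₁ b₁) γ₁ → GeodesicOn (Set.Icc a₂ b₂) γ₂ →
        GeodesicOn (Set.Icc a₃ b₃) γ₃ →
      γ₁ b₁ = γ₂ a₂ → γ₂ b₂ = γ₃ a₃ → γ₃ b₃ = γ₁ a₁ →
      ∀ s ∈ Set.Icc a₁ b₁,
        ∃ p ∈ γ₂ '' Set.Icc a₂ b₂ ∪ γ₃ '' Set.Icc a₃ b₃, dist (γ₁ s) p ≤ δ

/-- The set of closest-point projections of `x` to `A`. -/
def projSet (A : Set X) (x : X) : Set X :=
  {y ∈ A | ∀ z ∈ A, dist x y ≤ dist x z}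

/-- A subset `A` is `C`-contracting. -/
def ContractingSet (C : ℝ) (A : Set X) : Prop :=
  ∀ x : X, Metric.diam (⋃ y ∈ Metric.ball x (Metric.infDist x A), projSet A y) ≤ C

/-- `γ` is a `C`-contracting geodesic on `I`. -/
def ContractingOn (C : ℝ) (I : Set ℝ) (γ : ℝ → X) : Prop :=
  GeodesicOn I γ ∧ ContractingSet C (γ '' I)

/-- The Morse boundary of `X` (with basepoint `x₀`) is σ-compact. -/
def SigmaCompactMorseBoundary (x₀ : X) : Prop :=
  ∃ Ms : ℕ → ℝ → ℝ, (∀ n, IsMorseGauge (Ms n)) ∧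
    ∀ γ : ℝ → X, GeodesicRayFrom x₀ γ → ∀ M : ℝ → ℝ, IsMorseGauge M →
      MorseOn M (Set.Ici 0) γ → ∃ n, MorseOn (Ms n) (Set.Ici 0) γ

/-- `Ms` is a strong exhaustion of the Morse boundary of `X` based at `x₀`. -/
def IsStrongExhaustion (x₀ : X) (Ms : ℕ → ℝ → ℝ) : Prop :=
  (∀ n, IsMorseGauge (Ms n)) ∧
  (∀ γ : ℝ → X, GeodesicRayFrom x₀ γ → ∀ M : ℝ → ℝ, IsMorseGauge M →
    MorseOn M (Set.Ici 0) γ → ∃ n, MorseOn (Ms n) (Set.Ici 0) γ) ∧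
  (∀ M : ℝ → ℝ, IsMorseGauge M → ∃ n, ∀ γ : ℝ → X, GeodesicRayFrom x₀ γ →
    MorseOn M (Set.Ici 0) γ → MorseOn (Ms n) (Set.Ici 0) γ)

/-- The Morse boundary of `X` (with basepoint `x₀`) is strongly σ-compact. -/
def StronglySigmaCompactMorseBoundary (x₀ : X) : Prop :=
  ∃ Ms : ℕ → ℝ → ℝ, IsStrongExhaustion x₀ Ms

end Space

section Action

variable {G : Type*} [Group G] {X : Type*} [MetricSpace X]

/-- `φ` is an action of `G` on `X` by isometries. -/
def IsIsometricAction (φ : G → X → X) : Prop :=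
  (∀ x : X, φ 1 x = x) ∧ (∀ g h : G, ∀ x : X, φ (g * h) x = φ g (φ h x)) ∧
    ∀ g : G, Isometry (φ g)

/-- `φ` is a geometric (proper and cocompact, isometric) action of `G` on `X`. -/
def IsGeometricAction (φ : G → X → X) : Prop :=
  IsIsometricAction φ ∧
  (∀ (x : X) (r : ℝ), {g : G | dist x (φ g x) ≤ r}.Finite) ∧
  (∃ (x₀ : X) (r : ℝ), ∀ y : X, ∃ g : G, dist y (φ g x₀) ≤ r)

end Action

/-- `G` has contraction: it acts geometrically on some geodesic metric space
containing a strongly contracting geodesic ray. -/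
def HasContraction (G : Type*) [Group G] : Prop :=
  ∃ (X : Type) (m : MetricSpace X), ∃ φ : G → X → X,
    letI := m
    IsGeometricAction φ ∧ GeodesicSpace X ∧
      ∃ (γ : ℝ → X) (C : ℝ), 0 ≤ C ∧ GeodesicOn (Set.Ici 0) γ ∧
        ContractingSet C (γ '' Set.Ici 0)

section Horo

variable {X : Type*} [MetricSpace X]

/-- The horofunction associated to a geodesic ray `γ` based at `x₀`
(for geodesic rays, the infimum below equals the limit of
`t ↦ d(z, γ t) - d(x₀, γ t)` as `t → ∞`, since this function is non-increasing
and bounded below). -/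
noncomputable def horofn (x₀ : X) (γ : ℝ → X) (z : X) : ℝ :=
  sInf ((fun t => dist z (γ t) - dist x₀ (γ t)) '' Set.Ici 0)

/-- The horofunction map `y ↦ ρ_y = d(·, y) - d(x₀, y)`. -/
noncomputable def horomap (x₀ y : X) : ContinuousMap X ℝ :=
  ⟨fun z => dist z y - dist x₀ y, by fun_prop⟩

end Horo

section HoroAction

variable {G : Type*} [Group G] {X : Type*} [MetricSpace X]

/-- The `G`-action on the horofunction compactification:
`(g · f)(z) = f (g⁻¹ z) - f (g⁻¹ x₀)`. -/
noncomputable def horoAction (φ : G → X → X) (hc : ∀ g : G, Continuous (φ g)) (x₀ : X)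
    (g : G) (f : ContinuousMap X ℝ) : ContinuousMap X ℝ :=
  ⟨fun z => f (φ g⁻¹ z) - f (φ g⁻¹ x₀), (f.continuous.comp (hc g⁻¹)).sub continuous_const⟩

end HoroAction

section Words

variable {S : Type*}

/-- A word over the symmetrised alphabet `S ∪ S⁻¹`. -/
abbrev Word (S : Type*) := List (S × Bool)

/-- The formal inverse of a word. -/
def wordInv (w : Word S) : Word S := (w.map fun a => (a.1, !a.2)).reverse

/-- A word is reduced if it has no adjacent cancelling pair. -/
def ReducedWord (w : Word S) : Prop := w.Chain' fun a b => a.1 = b.1 → a.2 = b.2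

/-- A word is cyclically reduced if all its cyclic shifts are reduced. -/
def CyclicallyReduced (w : Word S) : Prop := ∀ k : ℕ, ReducedWord (w.rotate k)

/-- The closure of `R ∪ R⁻¹` under cyclic shifts. -/
def symmClosure (R : Set (Word S)) : Set (Word S) :=
  {w | ∃ r ∈ R, ∃ k : ℕ, w = r.rotate k ∨ w = (wordInv r).rotate k}

/-- A piece: a (non-trivial) common prefix of two distinct elements of `R̄`. -/
def IsPiece (R : Set (Word S)) (p : Word S) : Prop :=
  p ≠ [] ∧ ∃ r₁ ∈ symmClosure R, ∃ r₂ ∈ symmClosure R, r₁ ≠ r₂ ∧ p <+: r₁ ∧ p <+: r₂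

/-- The `C'(lam)` small-cancellation condition. -/
def SmallCancellation (R : Set (Word S)) (lam : ℝ) : Prop :=
  (∀ r ∈ R, CyclicallyReduced r) ∧
  ∀ r ∈ symmClosure R, ∀ p : Word S, IsPiece R p → p <:+: r →
    (p.length : ℝ) < lam * r.length

/-- A viable function. -/
def Viable (f : ℕ → ℝ) : Prop :=
  Monotone f ∧ (∀ n, 6 ≤ f n) ∧ Filter.Tendsto f Filter.atTop Filter.atTop

/-- The pair `(x, R)` satisfies the `C'(1/f)` small-cancellation condition. -/
def PairSmallCancellation (f : ℕ → ℝ) (x : Word S) (R : Set (Word S)) : Prop :=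
  ∀ r ∈ symmClosure R, ∀ p : Word S, p ≠ [] → p <:+: x → p <:+: r →
    (p.length : ℝ) < (r.length : ℝ) / f r.length

/-- The increasing partial small-cancellation condition. -/
def IPSC (R : Set (Word S)) : Prop :=
  ∀ ns : ℕ → ℕ, (∀ i, 0 < ns i) →
    ∃ f : ℕ → ℝ, Viable f ∧
      ∀ K : ℕ, ∃ i : ℕ, K ≤ i ∧ ∃ r ∈ symmClosure R, ∃ x y : Word S,
        r = x ++ y ∧ (ns i : ℝ) ≤ r.length ∧ (r.length : ℝ) / i ≤ x.length ∧
        PairSmallCancellation f x R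

end Words

section Cayley

variable {G : Type*} [Group G] {S : Type*}

/-- The element of `G` spelled by a word over `S ∪ S⁻¹`. -/
def evalWord (σ : S → G) (w : Word S) : G :=
  (w.map fun a => if a.2 then σ a.1 else (σ a.1)⁻¹).prod

/-- The word metric on `G` with respect to the generating map `σ`. -/
noncomputable def wordDist (σ : S → G) (g h : G) : ℕ :=
  sInf {n : ℕ | ∃ w : Word S, w.length = n ∧ g * evalWord σ w = h}

/-- A (discrete) edge path in the Cayley graph: consecutive points are adjacent. -/
def DIsPath (σ : S → G) (I : Set ℤ) (p : ℤ → G) : Prop :=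
  ∀ n : ℤ, n ∈ I → n + 1 ∈ I → wordDist σ (p n) (p (n + 1)) ≤ 1

/-- A discrete `Q`-quasi-geodesic in the Cayley graph. -/
def DQGeoOn (σ : S → G) (Q : ℝ) (I : Set ℤ) (p : ℤ → G) : Prop :=
  DIsPath σ I p ∧ ∀ m ∈ I, ∀ n ∈ I,
    |(n : ℝ) - (m : ℝ)| / Q - Q ≤ (wordDist σ (p m) (p n) : ℝ) ∧
      (wordDist σ (p m) (p n) : ℝ) ≤ Q * |(n : ℝ) - (m : ℝ)| + Q

/-- A discrete geodesic in the Cayley graph. -/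
def DGeodesicOn (σ : S → G) (I : Set ℤ) (p : ℤ → G) : Prop :=
  ∀ m ∈ I, ∀ n ∈ I, (wordDist σ (p m) (p n) : ℤ) = |n - m|

/-- `p` is `M`-Morse on `I` in the Cayley graph. -/
def DMorseOn (σ : S → G) (M : ℝ → ℝ) (I : Set ℤ) (p : ℤ → G) : Prop :=
  ∀ Q : ℝ, 1 ≤ Q → ∀ s ∈ I, ∀ t ∈ I, s ≤ t →
    ∀ (q : ℤ → G) (a b : ℤ), a ≤ b → DQGeoOn σ Q (Set.Icc a b) q →
      q a = p s → q b = p t →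
      ∀ n ∈ Set.Icc a b, ∃ m ∈ Set.Icc s t, (wordDist σ (q n) (p m) : ℝ) ≤ M Q

/-- A geodesic ray in the Cayley graph based at the identity. -/
def DGeodesicRay (σ : S → G) (p : ℤ → G) : Prop :=
  p 0 = 1 ∧ DGeodesicOn σ (Set.Ici 0) p

/-- `p` is `L`-locally an `M`-Morse `Q`-quasi-geodesic. -/
def DLocMorseQGeoOn (σ : S → G) (Q : ℝ) (M : ℝ → ℝ) (L : ℝ) (I : Set ℤ) (p : ℤ → G) : Prop :=
  ∀ s ∈ I, ∀ t ∈ I, s ≤ t → ((t - s : ℤ) : ℝ) ≤ L →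
    DQGeoOn σ Q (Set.Icc s t) p ∧ DMorseOn σ M (Set.Icc s t) p

/-- `p` is `L`-locally `M`-Morse. -/
def DLocMorseOn (σ : S → G) (M : ℝ → ℝ) (L : ℝ) (I : Set ℤ) (p : ℤ → G) : Prop :=
  ∀ s ∈ I, ∀ t ∈ I, s ≤ t → ((t - s : ℤ) : ℝ) ≤ L → DMorseOn σ M (Set.Icc s t) p

/-- The Morse local-to-global property for the Cayley graph of `(G, σ)`. -/
def CayMLTG (σ : S → G) : Prop :=
  ∀ Q : ℝ, 1 ≤ Q → ∀ M : ℝ → ℝ, IsMorseGauge M →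
    ∃ (L Q' : ℝ) (M' : ℝ → ℝ), 0 < L ∧ 1 ≤ Q' ∧ IsMorseGauge M' ∧
      ∀ I : Set ℤ, I.OrdConnected → ∀ p : ℤ → G,
        DLocMorseQGeoOn σ Q M L I p → DQGeoOn σ Q' I p ∧ DMorseOn σ M' I p

/-- The geodesic Morse local-to-global property for the Cayley graph. -/
def CayGeodesicMLTG (σ : S → G) : Prop :=
  ∀ M : ℝ → ℝ, IsMorseGauge M →
    ∃ (L : ℝ) (M' : ℝ → ℝ), 0 < L ∧ IsMorseGauge M' ∧
      ∀ I : Set ℤ, I.OrdConnected → ∀ p : ℤ → G, DGeodesicOn σ I p →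
        DLocMorseOn σ M L I p → DMorseOn σ M' I p

/-- σ-compactness of the Morse boundary of the Cayley graph. -/
def CaySigmaCompact (σ : S → G) : Prop :=
  ∃ Ms : ℕ → ℝ → ℝ, (∀ n, IsMorseGauge (Ms n)) ∧
    ∀ p : ℤ → G, DGeodesicRay σ p → ∀ M : ℝ → ℝ, IsMorseGauge M →
      DMorseOn σ M (Set.Ici 0) p → ∃ n, DMorseOn σ (Ms n) (Set.Ici 0) p

/-- Strong σ-compactness of the Morse boundary of the Cayley graph. -/
def CayStronglySigmaCompact (σ : S → G) : Prop :=
  ∃ Ms : ℕ → ℝ → ℝ, (∀ n, IsMorseGauge (Ms n)) ∧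
    (∀ p : ℤ → G, DGeodesicRay σ p → ∀ M : ℝ → ℝ, IsMorseGauge M →
      DMorseOn σ M (Set.Ici 0) p → ∃ n, DMorseOn σ (Ms n) (Set.Ici 0) p) ∧
    (∀ M : ℝ → ℝ, IsMorseGauge M → ∃ n, ∀ p : ℤ → G, DGeodesicRay σ p →
      DMorseOn σ M (Set.Ici 0) p → DMorseOn σ (Ms n) (Set.Ici 0) p)

/-- The edge path starting at `g` labelled by the word `w`. -/
def pathOfWord (σ : S → G) (g : G) (w : Word S) : ℤ → G :=
  fun n => g * evalWord σ (w.take n.toNat)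

end Cayley

/-- The canonical generating map of a presented group `⟨S | R⟩`. -/
def presGen {S : Type*} (R : Set (Word S)) : S → PresentedGroup (FreeGroup.mk '' R) :=
  fun s => PresentedGroup.of s

end MorseLTG

open Metric Set Filter
namespace MorseLTG
section P1
local notation "oo" => (by omega)
variable {S : Type*}
def linv (a : S × Bool) : S × Bool := (a.1, !a.2)
@[simp] lemma linv_linv (a : S × Bool) : linv (linv a) = a := by simp [linv]
lemma linv_ne (a : S × Bool) : linv a ≠ a := by
  rcases a with ⟨a, b⟩; cases b <;> simp [linv]
@[simp] lemma wordInv_nil : wordInv ([] : Word S) = [] := rfl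
lemma wordInv_eq (w : Word S) : wordInv w = (w.map linv).reverse := rfl
@[simp] lemma wordInv_cons (a : S × Bool) (w : Word S) :
    wordInv (a :: w) = wordInv w ++ [linv a] := by simp [wordInv, linv]
@[simp] lemma wordInv_append (u v : Word S) : wordInv (u ++ v) = wordInv v ++ wordInv u := by
  simp [wordInv]
@[simp] lemma wordInv_wordInv (w : Word S) : wordInv (wordInv w) = w := by
  induction w with
  | nil => rfl
  | cons a w ih => simp [ih]
@[simp] lemma wordInv_length (w : Word S) : (wordInv w).length = w.length := by simp [wordInv]
lemma wordInv_inj {u v : Word S} (h : wordInv u = wordInv v) : u = v := by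
  rw [← wordInv_wordInv u, h, wordInv_wordInv]
lemma sc_rot {R : Set (Word S)} {w : Word S} (h : w ∈ symmClosure R) (k : ℕ) :
    w.rotate k ∈ symmClosure R := by
  obtain ⟨r, hr, j, h | h⟩ := h
  · exact ⟨r, hr, j + k, Or.inl (by simp_all)⟩
  · exact ⟨r, hr, j + k, Or.inr (by simp_all)⟩
lemma sc_comm {R : Set (Word S)} {u v : Word S} (h : u ++ v ∈ symmClosure R) :
    v ++ u ∈ symmClosure R := by
  have := sc_rot h u.length
  simp_all
lemma wordInv_rot (w : Word S) (k : ℕ) : ∃ j, wordInv (w.rotate k) = (wordInv w).rotate j := by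
  have h : (wordInv w) ~r (wordInv (w.rotate k)) := by
    unfold wordInv
    exact ((List.IsRotated.forall w k).symm.map _).reverse
  obtain ⟨j, hj⟩ := h
  grind
lemma sc_inv {R : Set (Word S)} {w : Word S} (h : w ∈ symmClosure R) :
    wordInv w ∈ symmClosure R := by
  obtain ⟨r, hr, j, h | h⟩ := h
  · obtain ⟨i, hi⟩ := wordInv_rot r j
    exact ⟨r, hr, i, Or.inr (by grind)⟩
  · obtain ⟨i, hi⟩ := wordInv_rot (wordInv r) j
    exact ⟨r, hr, i, Or.inl (by simp_all)⟩
lemma sc_mono {R R' : Set (Word S)} (h : R ⊆ R') : symmClosure R ⊆ symmClosure R' := by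
  rintro w ⟨r, hr, k, hk⟩
  exact ⟨r, h hr, k, hk⟩
lemma sc_len {R : Set (Word S)} {w : Word S} (h : w ∈ symmClosure R) :
    ∃ r ∈ R, r.length = w.length := by
  obtain ⟨r, hr, k, h | h⟩ := h <;> exact ⟨r, hr, by simp [h]⟩
lemma reducedWord_inv {w : Word S} (h : ReducedWord w) : ReducedWord (wordInv w) := by
  unfold ReducedWord wordInv at *
  show List.IsChain _ _
  rw [List.isChain_reverse, List.isChain_map]
  refine List.IsChain.imp ?_ h
  grind
lemma sc_red {R : Set (Word S)} (hR : ∀ r ∈ R, CyclicallyReduced r) {w : Word S}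
    (h : w ∈ symmClosure R) : CyclicallyReduced w := by
  obtain ⟨r, hr, j, h | h⟩ := h
  · intro k; rw [h, List.rotate_rotate]; exact hR r hr _
  · intro k
    rw [h, List.rotate_rotate]
    obtain ⟨i, hi⟩ := wordInv_rot (wordInv r) (j + k)
    rw [wordInv_wordInv] at hi
    rw [← wordInv_wordInv (List.rotate _ _), hi]
    exact reducedWord_inv (hR r hr i)
lemma red_pair {u v : Word S} {a : S × Bool} (h : ReducedWord (u ++ a :: linv a :: v)) : False := by
  unfold ReducedWord at h
  have := (List.isChain_append.1 h).2.1
  rw [List.isChain_cons_cons] at this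
  have h2 := this.1 rfl
  simp [linv] at h2
inductive DG (R : Set (Word S)) : ℕ → Word S → Prop
  | nil : DG R 0 []
  | face {n : ℕ} {x : S × Bool} {t w : Word S} : x :: t ∈ symmClosure R →
      DG R n (wordInv t ++ w) → DG R (n + 1) (x :: w)
  | bridge {n m : ℕ} {x : S × Bool} {C D : Word S} : DG R n C → DG R m D →
      DG R (n + m) (x :: (C ++ linv x :: D))
namespace DG
variable {R : Set (Word S)}
lemma concat {n m : ℕ} {a b : Word S} (ha : DG R n a) (hb : DG R m b) : DG R (n + m) (a ++ b) := by
  induction ha with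
  | nil => simpa using hb
  | face h _ ih =>
    rw [Nat.add_right_comm]
    refine DG.face h ?_
    simpa using ih
  | bridge h1 _ _ ih =>
    rw [Nat.add_assoc]
    simpa using DG.bridge h1 ih
lemma insert {n m : ℕ} {C : Word S} (hC : DG R m C) {W : Word S} (hW : DG R n W) :
    ∀ w1 w2, W = w1 ++ w2 → DG R (n + m) (w1 ++ C ++ w2) := by
  induction hW with
  | nil =>
    simp_all
  | @face n x t w h h' ih =>
    intro w1 w2 hw
    rcases w1 with _ | ⟨z, w1⟩
    · simp at hw; subst hw
      rw [Nat.add_comm]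
      simpa using concat hC (DG.face h h')
    · simp at hw
      obtain ⟨rfl, rfl⟩ := hw
      rw [Nat.add_right_comm]
      refine DG.face h ?_
      simpa using ih (wordInv t ++ w1) w2 (by simp)
  | @bridge n1 n2 x C1 C2 h1 h2 ih1 ih2 =>
    intro w1 w2 hw
    rcases w1 with _ | ⟨z, w1⟩
    · simp at hw; subst hw
      rw [Nat.add_comm]
      simpa using concat hC (DG.bridge h1 h2)
    · simp at hw
      obtain ⟨rfl, hw⟩ := hw
      rcases List.append_eq_append_iff.1 hw with ⟨a, rfl, h⟩ | ⟨a, rfl, rfl⟩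
      · rcases a with _ | ⟨y, a⟩
        · simp at h; subst h
          have := ih1 C1 [] (by simp)
          rw [Nat.add_right_comm]
          simpa using DG.bridge (x := x) this h2
        · simp at h
          obtain ⟨rfl, rfl⟩ := h
          have := ih2 a w2 rfl
          rw [Nat.add_assoc]
          simpa using DG.bridge (x := x) h1 this
      · have := ih1 w1 a rfl
        rw [Nat.add_right_comm]
        simpa using DG.bridge (x := x) this h2
lemma rotOf {n : ℕ} (h : ∀ x w, DG R n (x :: w) → DG R n (w ++ [x])) :
    ∀ a b, DG R n (a ++ b) → DG R n (b ++ a) := by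
  intro a
  induction a with
  | nil => intro b; simp
  | cons x a ih =>
    grind
lemma rotSA (N : ℕ) : (∀ m ≤ N, ∀ x w, DG R m (x :: w) → DG R m (w ++ [x])) ∧
    (∀ m ≤ N, ∀ u x t v, x :: t ∈ symmClosure R → DG R m (u ++ wordInv t ++ v) →
      DG R (m + 1) (u ++ x :: v)) := by
  induction N using Nat.strong_induction_on with
  | _ N IH =>
  have hrot : ∀ m ≤ N, ∀ x w, DG R m (x :: w) → DG R m (w ++ [x]) := by
    intro m hm x w h
    cases h with
    | @face n _ t _ ht h =>
      have hn : n < N := by omega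
      have := rotOf ((IH n hn).1 n le_rfl) _ _ h
      exact (IH n hn).2 n le_rfl w x t [] ht (by grind)
    | @bridge n1 n2 _ C1 C2 h1 h2 =>
      have := concat h1 (DG.bridge (x := linv x) h2 DG.nil)
      simpa using this
  refine ⟨hrot, ?_⟩
  have key : ∀ l : ℕ, ∀ u : Word S, u.length ≤ l → ∀ m ≤ N, ∀ x t v, x :: t ∈ symmClosure R →
      DG R m (u ++ wordInv t ++ v) → DG R (m + 1) (u ++ x :: v) := by
    intro l
    induction l with
    | zero =>
      intro u hu m hm x t v ht h
      have : u = [] := by grind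
      subst this
      exact DG.face ht (by grind)
    | succ l ihl =>
      intro u hu m hm x t v ht h
      rcases u with _ | ⟨z, u⟩
      · grind
      simp at hu
      generalize hW : (z :: u ++ wordInv t ++ v) = W at h
      cases h with
      | nil => simp at hW
      | @face n z' t' w hz h =>
        simp at hW
        obtain ⟨rfl, rfl⟩ := hW
        have := (IH n oo).2 n le_rfl (wordInv t' ++ u) x t v ht (by grind)
        exact DG.face hz (by simpa using this)
      | @bridge n1 n2 z' C1 C2 h1 h2 =>
        simp at hW
        obtain ⟨rfl, hW⟩ := hW
        rcases List.append_eq_append_iff.1 hW with ⟨a, rfl, hW2⟩ | ⟨a, rfl, hW2⟩ <;> clear hW <;>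
          rename' hW2 => hW
        · -- C1 = u ++ a, wordInv t ++ v = a ++ z̄ :: C2
          rcases List.append_eq_append_iff.1 hW with ⟨b, rfl, hb⟩ | ⟨b, hb, hb2⟩
          · -- z̄ in v
            have := ihl u hu n1 oo x t b ht (by grind)
            subst hb
            rw [Nat.add_right_comm]
            simpa using DG.bridge (x := z) this h2
          · rcases b with _ | ⟨y, b⟩
            · simp at hb hb2
              subst hb
              have := ihl u hu n1 oo x t [] ht (by grind)
              subst hb2
              rw [Nat.add_right_comm]
              simpa using DG.bridge (x := z) this h2
            · simp at hb2
              obtain ⟨rfl, rfl⟩ := hb2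
              have e : t = wordInv b ++ z :: wordInv a := by
                apply wordInv_inj; simp [hb]
              have hr : z :: (wordInv a ++ x :: wordInv b) ∈ symmClosure R := by
                have := sc_comm (u := x :: wordInv b) (v := z :: wordInv a) (by simpa [e] using ht)
                grind
              have h3 := rotOf (hrot n1 oo) _ _ h1
              have h4 := DG.bridge (x := linv x) h3 DG.nil
              have h5 := insert h4 h2 b v rfl
              have h6 := DG.face hr (w := u ++ x :: v) (n := n2 + (n1 + 0)) (by simpa using h5)
              grind
        · -- u = C1 ++ a
          rcases a with _ | ⟨y, a⟩
          · -- z̄ first letter of inv t ++ v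
            simp at hW
            rcases hb : wordInv t with _ | ⟨y, b⟩
            · rw [hb] at hW
              simp at hW
              subst hW
              have := ihl C1 (by simpa using hu) n1 oo x t [] ht (by grind)
              rw [Nat.add_right_comm]
              simpa using DG.bridge (x := z) this h2
            · rw [hb] at hW
              simp at hW
              obtain ⟨rfl, rfl⟩ := hW
              have e : t = wordInv b ++ z :: [] := by
                apply wordInv_inj; simp [hb]
              have hr : z :: (x :: wordInv b) ∈ symmClosure R := by
                have := sc_comm (u := x :: wordInv b) (v := z :: []) (by simpa [e] using ht)
                grind
              have h4 := DG.bridge (x := linv x) h1 DG.nil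
              have h5 := insert h4 h2 b v rfl
              have h6 := DG.face hr (w := C1 ++ x :: v) (n := n2 + (n1 + 0)) (by simpa using h5)
              grind
          · simp at hW
            obtain ⟨rfl, rfl⟩ := hW
            have := ihl a (by simp at hu; omega) n2 oo x t v ht (by grind)
            rw [Nat.add_assoc]
            simpa using DG.bridge (x := z) h1 this
  intro m hm u x t v
  exact key u.length u le_rfl m hm x t v
lemma rot {n : ℕ} {a b : Word S} (h : DG R n (a ++ b)) : DG R n (b ++ a) :=
  rotOf ((rotSA n).1 n le_rfl) a b h
lemma swap {m : ℕ} {u : Word S} {x : S × Bool} {t v : Word S} (ht : x :: t ∈ symmClosure R)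
    (h : DG R m (u ++ wordInv t ++ v)) : DG R (m + 1) (u ++ x :: v) :=
  (rotSA m).2 m le_rfl u x t v ht h
lemma glueAux (N : ℕ) : ∀ M : ℕ, ∀ k j (U B V : Word S), k + j ≤ N →
    U.length + 2 * B.length + V.length ≤ M → DG R k (U ++ B) → DG R j (wordInv B ++ V) →
    ∃ m ≤ k + j, DG R m (U ++ V) := by
  induction N using Nat.strong_induction_on with
  | _ N IHN =>
  intro M
  induction M using Nat.strong_induction_on with
  | _ M IH =>
  have step : ∀ k j z (U B V : Word S), k + j ≤ N →
    (z :: U).length + 2 * B.length + V.length ≤ M → DG R k (z :: U ++ B) →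
      DG R j (wordInv B ++ V) →
    ∃ m ≤ k + j, DG R m (z :: U ++ V) := by
    intro k j z U B V hN hM h1 h2
    generalize hW : (z :: U ++ B) = W at h1
    simp at hM
    cases h1 with
    | nil => simp at hW
    | @face n z' t w hz h =>
      simp at hW
      obtain ⟨rfl, rfl⟩ := hW
      obtain ⟨m, hm, h3⟩ := IHN (n + j) oo _ n j (wordInv t ++ U) B V le_rfl le_rfl
        (by grind) h2
      exact ⟨m + 1, by omega, by simpa using DG.face hz (by grind)⟩
    | @bridge n1 n2 z' C1 C2 h1 h3 =>
      simp at hW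
      obtain ⟨rfl, hW⟩ := hW
      have main : ∀ B1 B2, B = B1 ++ linv z :: B2 → DG R n1 (U ++ B1) → DG R n2 B2 →
          ∃ m ≤ n1 + n2 + j, DG R m (z :: U ++ V) := by
        rintro B1 B2 rfl h4 h5
        simp at hM
        obtain ⟨m1, hm1, h6⟩ := IH (2 * B2.length + (z :: (wordInv B1 ++ V)).length)
          (by simp; omega) n2 j [] B2 (z :: (wordInv B1 ++ V)) oo (by simp)
          (by grind) (by simpa using h2)
        have h7 := rot (a := [z]) (b := wordInv B1 ++ V) (by simpa using h6)
        obtain ⟨m2, hm2, h8⟩ := IH (U.length + 2 * B1.length + (V ++ [z]).length)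
          (by simp; omega) n1 m1 U B1 (V ++ [z]) oo (by simp)
          h4 (by grind)
        exact ⟨m2, by omega, by simpa using rot (a := U ++ V) (b := [z]) (by grind)⟩
      rcases List.append_eq_append_iff.1 hW with ⟨a, rfl, hW2⟩ | ⟨a, rfl, hW2⟩ <;> clear hW <;>
        rename' hW2 => hW
      · grind
      · rcases a with _ | ⟨y, a⟩
        · grind
        · simp at hW
          obtain ⟨rfl, rfl⟩ := hW
          simp at hM
          obtain ⟨m, hm, h6⟩ := IH (a.length + 2 * B.length + V.length) oo n2 j a B V
            oo le_rfl h3 h2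
          exact ⟨n1 + m, by omega, by simpa using DG.bridge (x := z) h1 h6⟩
  intro k j U B V hN hM h1 h2
  rcases U with _ | ⟨z, U⟩
  · rcases V with _ | ⟨z, V⟩
    · exact ⟨0, by omega, DG.nil⟩
    · obtain ⟨m, hm, h3⟩ := step j k z V (wordInv B) [] oo (by simp at *; omega)
        (rot h2) (by simpa using h1)
      grind
  grind
lemma glue {k j : ℕ} {U B V : Word S} (h1 : DG R k (U ++ B)) (h2 : DG R j (wordInv B ++ V)) :
    ∃ m ≤ k + j, DG R m (U ++ V) :=
  glueAux (k + j) _ k j U B V le_rfl le_rfl h1 h2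
lemma pair (x : S × Bool) : DG R 0 [x, linv x] := by
  simpa using DG.bridge (x := x) DG.nil DG.nil
lemma del {n : ℕ} {U V : Word S} {x : S × Bool} (h : DG R n (U ++ x :: linv x :: V)) :
    ∃ m ≤ n, DG R m (U ++ V) := by
  have h1 := rot (a := U ++ [x, linv x]) (b := V) (by simpa using h)
  obtain ⟨m, hm, h2⟩ := glue (U := V ++ U) (B := [x, linv x]) (V := []) (by simpa using h1)
    (j := 0) (by simpa using pair x)
  exact ⟨m, by omega, rot (by grind)⟩
lemma ins {n : ℕ} {U V : Word S} (x : S × Bool) (h : DG R n (U ++ V)) :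
    DG R n (U ++ x :: linv x :: V) := by
  simpa using insert (pair x) h U V rfl
lemma cancelR (l : Word S) : ∀ {n : ℕ} {U V : Word S}, DG R n (U ++ l ++ wordInv l ++ V) →
    ∃ m ≤ n, DG R m (U ++ V) := by
  induction l with
  | nil => intro n U V h; exact ⟨n, le_rfl, by simpa using h⟩
  | cons x l ih =>
    intro n U V h
    obtain ⟨m, hm, h1⟩ := ih (U := U ++ [x]) (V := linv x :: V) (n := n) (by simpa using h)
    obtain ⟨m', hm', h2⟩ := del (U := U) (V := V) (x := x) (n := m) (by simpa using h1)
    grind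
lemma cancelL (l : Word S) {n : ℕ} {U V : Word S} (h : DG R n (U ++ wordInv l ++ l ++ V)) :
    ∃ m ≤ n, DG R m (U ++ V) := by
  apply cancelR (wordInv l); simpa using h
lemma triv (l : Word S) : DG R 0 (l ++ wordInv l) := by
  induction l with
  | nil => exact DG.nil
  | cons x l ih => simpa using DG.bridge (x := x) ih DG.nil
lemma relator {r : Word S} (h : r ∈ symmClosure R) : ∃ n, DG R n r := by
  rcases r with _ | ⟨x, t⟩
  · exact ⟨0, DG.nil⟩
  · exact ⟨1, DG.face h (by simpa using triv (wordInv t))⟩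
lemma freeInv {a b : Word S} (h : FreeGroup.mk a = FreeGroup.mk b) {n : ℕ} (ha : DG R n a) :
    ∃ m ≤ n, DG R m b := by
  obtain ⟨c, hac, hbc⟩ := FreeGroup.Red.exact.1 h
  have h1 : ∀ {a c : Word S}, FreeGroup.Red a c → ∀ {n}, DG R n a → ∃ m ≤ n, DG R m c := by
    intro a c h
    induction h with
    | refl => intro n h; exact ⟨n, le_rfl, h⟩
    | tail _ hs ih =>
      intro n h
      obtain ⟨m, hm, h1⟩ := ih h
      cases hs with
      | not =>
        obtain ⟨m', hm', h2⟩ := del h1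
        grind
  have h2 : ∀ {a c : Word S}, FreeGroup.Red a c → ∀ {n}, DG R n c → DG R n a := by
    intro a c h
    induction h with
    | refl => intro n h; exact h
    | tail _ hs ih =>
      intro n h
      apply ih
      cases hs with
      | not => exact ins _ h
  grind
end DG
lemma mk_wordInv (w : Word S) : FreeGroup.mk (wordInv w) = (FreeGroup.mk w)⁻¹ := by
  rw [FreeGroup.inv_mk]; rfl
section
variable {G : Type*} [Group G] (σ : S → G)
@[simp] lemma evalWord_nil : evalWord σ [] = 1 := rfl
lemma evalWord_cons (a : S × Bool) (w : Word S) :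
    evalWord σ (a :: w) = evalWord σ [a] * evalWord σ w := by simp [evalWord]
@[simp] lemma evalWord_append (u v : Word S) :
    evalWord σ (u ++ v) = evalWord σ u * evalWord σ v := by simp [evalWord]
@[simp] lemma evalWord_linv (a : S × Bool) : evalWord σ [linv a] = (evalWord σ [a])⁻¹ := by
  rcases a with ⟨a, b⟩; cases b <;> simp [evalWord, linv]
@[simp] lemma evalWord_inv (w : Word S) : evalWord σ (wordInv w) = (evalWord σ w)⁻¹ := by
  induction w with
  | nil => simp
  | cons a w ih => rw [wordInv_cons, evalWord_append, ih, evalWord_cons σ a w, evalWord_linv]; group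
lemma evalWord_lift (w : Word S) : evalWord σ w = FreeGroup.lift σ (FreeGroup.mk w) := by
  rw [FreeGroup.lift_mk, evalWord]
  grind
end
lemma evalPres (R : Set (Word S)) (w : Word S) :
    evalWord (presGen R) w = PresentedGroup.mk (FreeGroup.mk '' R) (FreeGroup.mk w) := by
  rw [evalWord_lift]
  have : FreeGroup.lift (presGen R) = PresentedGroup.mk (FreeGroup.mk '' R) := by
    ext s; simp [presGen, PresentedGroup.of]
  grind
lemma eval_sc {R : Set (Word S)} {w : Word S} (h : w ∈ symmClosure R) :
    evalWord (presGen R) w = 1 := by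
  have h0 : ∀ r ∈ R, evalWord (presGen R) r = 1 := by
    intro r hr
    rw [evalPres]
    exact PresentedGroup.one_of_mem ⟨r, hr, rfl⟩
  have h1 : ∀ r k, evalWord (presGen R) r = 1 → evalWord (presGen R) (r.rotate k) = 1 := by
    intro r k hr
    obtain ⟨m, hm, e⟩ : ∃ m ≤ r.length, r.rotate k = r.rotate m := by
      rcases Nat.eq_zero_or_pos r.length with h | h
      · exact ⟨0, by omega, by simp [List.length_eq_zero_iff.1 h]⟩
      · exact ⟨k % r.length, (Nat.mod_lt _ h).le, (List.rotate_mod r k).symm⟩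
    rw [e, List.rotate_eq_drop_append_take hm, evalWord_append]
    rw [← List.take_append_drop m r, evalWord_append] at hr
    exact mul_eq_one_comm.1 hr
  obtain ⟨r, hr, k, rfl | rfl⟩ := h
  · exact h1 _ _ (h0 r hr)
  · exact h1 _ _ (by simp [h0 r hr])
lemma DG.null {R : Set (Word S)} {n : ℕ} {w : Word S} (h : DG R n w) :
    evalWord (presGen R) w = 1 := by
  induction h with
  | nil => rfl
  | @face n x t w ht _ ih =>
    have := eval_sc ht
    rw [evalWord_cons] at this ⊢
    rw [evalWord_append, evalWord_inv] at ih
    rw [inv_mul_eq_one.1 ih] at this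
    omega
  | @bridge n m x C D _ _ h1 h2 =>
    rw [evalWord_cons _ x, evalWord_append, evalWord_cons _ (linv x) D, h1, h2, evalWord_linv]; group
lemma null_DG {R : Set (Word S)} {w : Word S} (h : evalWord (presGen R) w = 1) :
    ∃ n, DG R n w := by
  rw [evalPres] at h
  have hm : FreeGroup.mk w ∈ Subgroup.normalClosure (FreeGroup.mk '' R) := by
    exact (QuotientGroup.eq_one_iff _).1 h
  have key : ∀ g ∈ Subgroup.normalClosure (FreeGroup.mk '' R),
      ∃ w n, FreeGroup.mk w = g ∧ DG R n w := by
    intro g hg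
    unfold Subgroup.normalClosure at hg
    induction hg using Subgroup.closure_induction'' with
    | mem x hx =>
      rw [Group.mem_conjugatesOfSet_iff] at hx
      obtain ⟨_, ⟨r, hr, rfl⟩, hc⟩ := hx
      obtain ⟨c, rfl⟩ := isConj_iff.1 hc
      obtain ⟨c, rfl⟩ := Quot.exists_rep c
      obtain ⟨n, hn⟩ := DG.relator (R := R) (r := r) ⟨r, hr, 0, Or.inl (by simp)⟩
      refine ⟨c ++ r ++ wordInv c, _, ?_, DG.insert hn (DG.triv c) c (wordInv c) rfl⟩
      rw [← FreeGroup.mul_mk, ← FreeGroup.mul_mk, mk_wordInv]; rfl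
    | inv_mem x hx =>
      rw [Group.mem_conjugatesOfSet_iff] at hx
      obtain ⟨_, ⟨r, hr, rfl⟩, hc⟩ := hx
      obtain ⟨c, rfl⟩ := isConj_iff.1 hc
      obtain ⟨c, rfl⟩ := Quot.exists_rep c
      obtain ⟨n, hn⟩ := DG.relator (R := R) (r := wordInv r) ⟨r, hr, 0, Or.inr (by simp)⟩
      refine ⟨c ++ wordInv r ++ wordInv c, _, ?_, DG.insert hn (DG.triv c) c (wordInv c) rfl⟩
      rw [← FreeGroup.mul_mk, ← FreeGroup.mul_mk, mk_wordInv, mk_wordInv]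
      simp_all
    | one => exact ⟨[], 0, rfl, DG.nil⟩
    | mul x y _ _ hx hy =>
      obtain ⟨a, n, rfl, ha⟩ := hx
      obtain ⟨b, m, rfl, hb⟩ := hy
      exact ⟨a ++ b, _, FreeGroup.mul_mk.symm, ha.concat hb⟩
  obtain ⟨v, n, hv, hn⟩ := key _ hm
  obtain ⟨m, _, h2⟩ := DG.freeInv hv hn
  grind
end P1
end MorseLTG
open Metric Set Filter
namespace MorseLTG
section P2
variable {S : Type*}
lemma app3 {α : Type*} {l r u v : List α} {c y : α} (h : l ++ c :: r = u ++ y :: v) :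
    (∃ k, l = u ++ y :: k ∧ v = k ++ c :: r) ∨ (u = l ∧ y = c ∧ v = r) ∨
    (∃ k, u = l ++ c :: k ∧ r = k ++ y :: v) := by
  rcases List.append_eq_append_iff.1 h with ⟨a, rfl, h2⟩ | ⟨a, rfl, h2⟩
  · rcases a with _ | ⟨z, a⟩
    · simp at h2; exact Or.inr (Or.inl ⟨by simp, h2.1.symm, h2.2.symm⟩)
    · simp at h2; exact Or.inr (Or.inr ⟨a, by simp [h2.1], h2.2⟩)
  · rcases a with _ | ⟨z, a⟩
    · simp at h2; exact Or.inr (Or.inl ⟨by simp, h2.1, h2.2⟩)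
    · simp at h2; exact Or.inl ⟨a, by simp [h2.1], h2.2⟩
lemma map_split {α β : Type*} {f : α → β} {l : List α} {u v : List β} {y : β}
    (h : l.map f = u ++ y :: v) :
    ∃ a d b, l = a ++ d :: b ∧ a.map f = u ∧ f d = y ∧ b.map f = v := by
  obtain ⟨a, b', rfl, rfl, h2⟩ := List.map_eq_append_iff.1 h
  obtain ⟨d, b, rfl, rfl, rfl⟩ := List.map_eq_cons_iff.1 h2
  grind
lemma selfInv_nil (n : ℕ) : ∀ B : Word S, B.length ≤ n → ReducedWord B → B = wordInv B → B = [] := by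
  induction n using Nat.strong_induction_on with
  | _ n IH =>
  intro B hn hB h
  rcases B with _ | ⟨a, B⟩
  · rfl
  exfalso
  rcases List.eq_nil_or_concat' B with rfl | ⟨M, b, rfl⟩
  · simp at h; exact linv_ne a h.symm
  · simp at h
    obtain ⟨h1, h2⟩ := h
    obtain ⟨h4, h5⟩ := h2
    have hM : M = [] := by
      refine IH M.length (by simp at hn; omega) M le_rfl ?_ h4
      have := hB
      unfold ReducedWord at *
      exact List.IsChain.left_of_append (List.IsChain.tail this)
    subst hM
    subst h5
    exact red_pair (u := []) (v := []) hB
lemma perm_of_count {α : Type*} {l1 l2 : List α}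
    (h : ∀ [DecidableEq α] (a : α), l1.count a = l2.count a) : l1.Perm l2 := by
  let _ := Classical.decEq α
  grind
def EPath {V D : Type} (src : D → V) (rev : D → D) : List D → V → V → Prop
  | [], a, b => a = b
  | d :: l, a, b => src d = a ∧ EPath src rev l (src (rev d)) b
section
variable {V D : Type} {src : D → V} {rev : D → D}
lemma EPath.append {l1 l2 : List D} {a c : V} :
    EPath src rev (l1 ++ l2) a c ↔ ∃ b, EPath src rev l1 a b ∧ EPath src rev l2 b c := by
  induction l1 generalizing a with
  | nil => simp [EPath]
  | cons d l ih => simp [EPath, ih, and_assoc]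
lemma EPath.reverse (hr : ∀ d, rev (rev d) = d) {l : List D} {a c : V} (h : EPath src rev l a c) :
    EPath src rev (l.map rev).reverse c a := by
  induction l generalizing a with
  | nil => exact h.symm
  | cons d l ih =>
    obtain ⟨h1, h2⟩ := h
    simp only [List.map_cons, List.reverse_cons]
    rw [EPath.append]
    exact ⟨_, ih h2, by simp [EPath, hr, h1]⟩
lemma EPath.map {V' D' : Type} {src' : D' → V'} {rev' : D' → D'} (i : D → D') (j : V → V')
    (h1 : ∀ d, src' (i d) = j (src d)) (h2 : ∀ d, rev' (i d) = i (rev d)) {l : List D} {a c : V}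
    (h : EPath src rev l a c) : EPath src' rev' (l.map i) (j a) (j c) := by
  induction l generalizing a with
  | nil => exact congrArg j h
  | cons d l ih =>
    refine ⟨by rw [h1, h.1], ?_⟩
    have := ih h.2
    grind
lemma EPath.pos {G : Type*} [Group G] {σ : S → G} {pos : V → G} {lab : D → S × Bool}
    (hp : ∀ d, pos (src (rev d)) = pos (src d) * evalWord σ [lab d]) {l : List D} {a c : V}
    (h : EPath src rev l a c) : pos c = pos a * evalWord σ (l.map lab) := by
  induction l generalizing a with
  | nil => simp [show a = c from h]
  | cons d l ih =>
    rw [ih h.2, hp, h.1, List.map_cons, evalWord_cons _ (lab d) (l.map lab), mul_assoc]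
lemma lab_inv {lab : D → S × Bool} (h : ∀ d, lab (rev d) = linv (lab d)) (l : List D) :
    ((l.map rev).reverse).map lab = wordInv (l.map lab) := by
  rw [wordInv_eq]; simp [Function.comp_def, h]
end
structure Km (R : Set (Word S)) (n : ℕ) (w : Word S) where
  V : Type
  D : Type
  fV : Fintype V
  fD : Fintype D
  rev : D → D
  rev_rev : ∀ d, rev (rev d) = d
  rev_ne : ∀ d, rev d ≠ d
  src : D → V
  lab : D → S × Bool
  lab_rev : ∀ d, lab (rev d) = linv (lab d)
  pos : V → PresentedGroup (FreeGroup.mk '' R)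
  hpos : ∀ d, pos (src (rev d)) = pos (src d) * evalWord (presGen R) [lab d]
  base : V
  outer : List D
  faces : List (List D)
  hw : outer.map lab = w
  hn : faces.length = n
  hf : ∀ f ∈ faces, f.map lab ∈ symmClosure R ∧ f ≠ []
  nd : (faces.flatten ++ outer.map rev).Nodup
  all : ∀ d, d ∈ faces.flatten ++ outer.map rev
  pouter : EPath src rev outer base base
  pfaces : ∀ f ∈ faces, ∃ v, EPath src rev f v v
  euler : 2 * Fintype.card V + 2 * n = Fintype.card D + 2
  hdeg : ∀ v, v = base ∨ ∃ d, src d = v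
  split : ∀ o1 d o2 o3, outer = o1 ++ d :: (o2 ++ rev d :: o3) →
    ∃ a b, a + b = n ∧ DG R a (o2.map lab) ∧ DG R b ((o1 ++ o3).map lab)
  drop : ∀ o1 d o2 f1 f2, outer = o1 ++ d :: o2 → f1 ++ d :: f2 ∈ faces →
    ∃ m, m + 1 = n ∧ DG R m (o1.map lab ++ wordInv ((f2 ++ f1).map lab) ++ o2.map lab)
  red : ∀ f1 f2 g1 g2 d, f1 ++ d :: f2 ∈ faces → g1 ++ rev d :: g2 ∈ faces →
    (f2 ++ f1).map lab = wordInv ((g2 ++ g1).map lab) → ∃ m < n, DG R m w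
variable {R : Set (Word S)}
lemma Km.nil : Nonempty (Km R 0 []) := by
  exact ⟨{
    V := Unit
    D := Empty
    fV := inferInstance
    fD := inferInstance
    rev := id
    rev_rev := fun d => d.elim
    rev_ne := fun d => d.elim
    src := fun _ => ()
    lab := fun d => d.elim
    lab_rev := fun d => d.elim
    pos := fun _ => 1
    hpos := fun d => d.elim
    base := ()
    outer := []
    faces := []
    hw := rfl
    hn := rfl
    hf := by simp
    nd := by simp
    all := fun d => d.elim
    pouter := rfl
    pfaces := by simp
    euler := by simp
    hdeg := by simp
    split := by simp
    drop := by simp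
    red := by simp }⟩
lemma self_mirror (hR : ∀ r ∈ R, CyclicallyReduced r) {A B C : Word S} {y : S × Bool}
    (hm : A ++ y :: (B ++ linv y :: C) ∈ symmClosure R)
    (h : B ++ linv y :: C ++ A = wordInv (C ++ (A ++ y :: B))) : False := by
  have h1 : B ++ linv y :: (C ++ A) = wordInv B ++ linv y :: wordInv (C ++ A) := by simpa using h
  have hB := (List.append_inj h1 (by simp)).1
  have hred := sc_red hR hm 0
  simp at hred
  have h2 : ReducedWord B := by
    unfold ReducedWord at hred ⊢
    have h3 := List.IsChain.right_of_append hred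
    exact List.IsChain.left_of_append (List.IsChain.tail h3)
  have := selfInv_nil _ B le_rfl h2 hB
  subst this
  exact red_pair (u := A) (v := C) (by simpa using hred)
lemma Km.face (hR : ∀ r ∈ R, CyclicallyReduced r) {n : ℕ} {x : S × Bool} {t w : Word S}
    (ht : x :: t ∈ symmClosure R) (hD : DG R n (wordInv t ++ w))
    (K : Km R n (wordInv t ++ w)) : Nonempty (Km R (n + 1) (x :: w)) := by
  obtain ⟨V, D, fV, fD, rev, rev_rev, rev_ne, src, lab, lab_rev, pos, hpos, base, outer, faces,
    hw, hn, hf, nd, all, pouter, pfaces, euler, hdeg, split, drop, red⟩ := K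
  obtain ⟨O1, O2, rfl, hO1, hO2⟩ := List.map_eq_append_iff.1 hw
  obtain ⟨m, hm1, hm2⟩ := EPath.append.1 pouter
  have hposm : pos m = pos base * evalWord (presGen R) [x] := by
    rw [hm1.pos hpos, hO1, evalWord_inv]
    have := eval_sc ht
    rw [evalWord_cons] at this
    rw [eq_inv_of_mul_eq_one_left this]
  let src' : D ⊕ Bool → V := Sum.elim src (fun b => if b then base else m)
  let rev' : D ⊕ Bool → D ⊕ Bool := Sum.map rev not
  let lab' : D ⊕ Bool → S × Bool := Sum.elim lab (fun b => if b then x else linv x)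
  let O1' := (O1.map rev).reverse
  have hO1' : O1'.map lab = t := by
    rw [lab_inv lab_rev, hO1, wordInv_wordInv]
  have hO1b : (O1'.map rev).reverse = O1 := by
    simp [O1', Function.comp_def, rev_rev]
  have labinl : ∀ l : List D, (l.map Sum.inl).map lab' = l.map lab := by
    intro l; simp [lab']
  let g0 : List (D ⊕ Bool) := Sum.inr true :: O1'.map Sum.inl
  have hg0lab : g0.map lab' = x :: t := by
    simp only [g0, List.map_cons, labinl, hO1']; simp [lab']
  have labx : lab' (Sum.inr true) = x := by simp [lab']
  have hg0inl : ∀ f1 d f2, g0 = f1 ++ Sum.inl d :: f2 → ∃ F1 F2, f1 = Sum.inr true :: F1.map Sum.inl ∧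
      f2 = F2.map Sum.inl ∧ O1' = F1 ++ d :: F2 := by
    intro f1 d f2 h
    rcases f1 with _ | ⟨z, f1⟩
    · simp [g0] at h
    · simp only [g0, List.cons_append, List.cons.injEq] at h
      obtain ⟨rfl, h⟩ := h
      obtain ⟨a, d', b, e, rfl, hd, rfl⟩ := map_split h
      simp at hd; subst hd
      exact ⟨a, b, rfl, rfl, e⟩
  have hO1split : ∀ F1 d F2, O1' = F1 ++ d :: F2 →
      O1 = (F2.map rev).reverse ++ rev d :: (F1.map rev).reverse := by
    intro F1 d F2 h
    rw [← hO1b, h]; simp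
  have redNO : ∀ f1 f2 g1 g2 d, f1 ++ d :: f2 = g0 →
      g1 ++ rev' d :: g2 ∈ faces.map (List.map Sum.inl) →
      (f2 ++ f1).map lab' = wordInv ((g2 ++ g1).map lab') → ∃ m < n + 1, DG R m (x :: w) := by
    intro f1 f2 g1 g2 d h1 h2 h3
    obtain ⟨G, hG, h4⟩ := List.mem_map.1 h2
    obtain ⟨G1, d1, G2, rfl, rfl, hd, rfl⟩ := map_split h4
    rcases d with d | b
    swap
    · simp [rev'] at hd
    simp [rev'] at hd
    subst hd
    obtain ⟨F1, F2, rfl, rfl, e⟩ := hg0inl _ _ _ h1.symm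
    have e1 := hO1split _ _ _ e
    obtain ⟨k, hk, h5⟩ := drop ((F2.map rev).reverse) (rev d) ((F1.map rev).reverse ++ O2) G1 G2
      (by rw [e1]; simp) hG
    rw [← List.map_append, labinl] at h3
    rw [← h3, lab_inv lab_rev] at h5
    simp only [List.map_append, List.map_cons, labinl, lab_inv lab_rev, hO2, labx] at h5
    obtain ⟨k2, hk2, h6⟩ := DG.cancelL (U := []) (F2.map lab)
      (V := x :: F1.map lab ++ wordInv (F1.map lab) ++ w) (n := k) (by simpa using h5)
    obtain ⟨k3, hk3, h7⟩ := DG.cancelR (U := [x]) (F1.map lab) (V := w) (n := k2) (by simpa using h6)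
    exact ⟨k3, by omega, by simpa using h7⟩
  refine ⟨{ V := V, D := D ⊕ Bool, fV := fV, fD := inferInstance, rev := rev', src := src',
            lab := lab', pos := pos, base := base, outer := Sum.inr true :: O2.map Sum.inl,
            faces := g0 :: faces.map (List.map Sum.inl),
            rev_rev := ?rev_rev,
            rev_ne := ?rev_ne,
            lab_rev := ?lab_rev,
            hpos := ?hpos,
            hw := ?hw,
            hn := ?hn,
            hf := ?hf,
            nd := ?nd,
            all := ?all,
            pouter := ?pouter,
            pfaces := ?pfaces,
            euler := ?euler,
            hdeg := ?hdeg,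
            split := ?split,
            drop := ?drop,
            red := ?red }⟩
  case rev_rev => rintro (d | b) <;> simp [rev', rev_rev]
  case rev_ne => rintro (d | b) <;> simp [rev', rev_ne]
  case lab_rev =>
    rintro (d | b)
    · simp [rev', lab', lab_rev]
    · cases b <;> simp [rev', lab']
  case hpos =>
    rintro (d | b)
    · simpa [rev', lab', src'] using hpos d
    · cases b
      · simp [rev', lab', src', hposm]
      · simp [rev', lab', src', hposm]
  case hw => simp only [List.map_cons, labx, labinl, hO2]
  case hn => simp [hn]
  case hf =>
    intro f hf'
    rcases List.mem_cons.1 hf' with rfl | hf'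
    · exact ⟨by rw [hg0lab]; exact ht, by simp [g0]⟩
    · obtain ⟨F, hF, rfl⟩ := List.mem_map.1 hf'
      rw [labinl]
      exact ⟨(hf F hF).1, by simpa using (hf F hF).2⟩
  case nd =>
    have hp : List.Perm ((g0 :: faces.map (List.map Sum.inl)).flatten ++
        (Sum.inr true :: O2.map Sum.inl).map rev')
        (Sum.inr true :: Sum.inr false :: (faces.flatten ++ (O1 ++ O2).map rev).map Sum.inl) := by
      refine perm_of_count ?_
      intro _ a
      simp [g0, O1', List.map_flatten, List.count_cons, rev', Function.comp_def]
      omega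
    rw [hp.nodup_iff]
    simp only [List.nodup_cons]
    refine ⟨by simp, by simp, ?_⟩
    exact List.Nodup.map Sum.inl_injective nd
  case all =>
    rintro (d | b)
    · have := all d
      simp [g0, O1', rev'] at this ⊢
      rcases this with h | h | h
      · exact Or.inr (Or.inl h)
      · exact Or.inl h
      · exact Or.inr (Or.inr h)
    · cases b <;> simp [g0, rev']
  case pouter =>
    refine ⟨by simp [src'], ?_⟩
    exact EPath.map (src' := src') (rev' := rev') Sum.inl id (by simp [src']) (by simp [rev']) hm2
  case pfaces =>
    intro f hf'
    rcases List.mem_cons.1 hf' with rfl | hf'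
    · refine ⟨base, by simp [src'], ?_⟩
      exact EPath.map (src' := src') (rev' := rev') Sum.inl id (by simp [src']) (by simp [rev'])
        (hm1.reverse rev_rev)
    · obtain ⟨F, hF, rfl⟩ := List.mem_map.1 hf'
      obtain ⟨v, hv⟩ := pfaces F hF
      exact ⟨v, EPath.map (src' := src') (rev' := rev') Sum.inl id (by simp [src']) (by simp [rev']) hv⟩
  case euler => rw [Fintype.card_sum]; simp; omega
  case hdeg =>
    intro v
    rcases hdeg v with h | ⟨d, h⟩
    · exact Or.inl h
    · exact Or.inr ⟨Sum.inl d, h⟩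
  case split =>
    intro o1 d o2 o3 h
    rcases o1 with _ | ⟨z, o1⟩
    · simp only [List.nil_append, List.cons.injEq] at h
      obtain ⟨rfl, h⟩ := h
      obtain ⟨_, _, _, _, _, h3, _⟩ := map_split h
      simp [rev'] at h3
    · simp only [List.cons_append, List.cons.injEq] at h
      obtain ⟨rfl, h⟩ := h
      obtain ⟨P, d, Q, e, rfl, rfl, h3⟩ := map_split h
      obtain ⟨Q, d2, T, rfl, rfl, h4, rfl⟩ := map_split h3
      simp [rev'] at h4
      subst h4
      obtain ⟨a, b, hab, h5, h6⟩ := split (O1 ++ P) d Q T (by simp [e])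
      refine ⟨a, b + 1, by omega, by rw [labinl]; exact h5, ?_⟩
      have := DG.face ht (w := P.map lab ++ T.map lab) (n := b) (by simpa [hO1] using h6)
      simpa [lab'] using this
  case drop =>
    intro o1 d o2 f1 f2 h hf'
    rcases o1 with _ | ⟨z, o1⟩
    · simp only [List.nil_append, List.cons.injEq] at h
      obtain ⟨rfl, rfl⟩ := h
      rcases List.mem_cons.1 hf' with hf' | hf'
      swap
      · obtain ⟨F, hF, h2⟩ := List.mem_map.1 hf'
        obtain ⟨_, _, _, _, _, h3, _⟩ := map_split h2
        simp at h3
      · rcases f1 with _ | ⟨z, f1⟩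
        · simp [g0] at hf'
          subst hf'
          refine ⟨n, rfl, ?_⟩
          rw [labinl, List.append_nil, labinl, hO1', hO2]
          simpa using hD
        · simp only [g0, List.cons_append, List.cons.injEq] at hf'
          obtain ⟨_, _, _, _, _, h3, _⟩ := map_split hf'.2.symm
          simp at h3
    · simp only [List.cons_append, List.cons.injEq] at h
      obtain ⟨rfl, h⟩ := h
      obtain ⟨P, d, Q, rfl, rfl, rfl, rfl⟩ := map_split h
      rcases List.mem_cons.1 hf' with hf' | hf'
      · obtain ⟨F1, F2, rfl, rfl, e⟩ := hg0inl _ _ _ hf'.symm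
        have e1 := hO1split _ _ _ e
        obtain ⟨a, b, hab, h5, h6⟩ := split ((F2.map rev).reverse) (rev d)
          ((F1.map rev).reverse ++ P) Q (by rw [e1, rev_rev]; simp)
        simp only [List.map_append, lab_inv lab_rev] at h5 h6
        refine ⟨n, rfl, ?_⟩
        have := DG.bridge (x := x) (DG.rot h5) h6
        rw [hab] at this
        simp only [List.map_append, List.map_cons, labinl, labx]
        simpa using this
      · obtain ⟨F, hF, h2⟩ := List.mem_map.1 hf'
        obtain ⟨F1, d2, F2, rfl, rfl, h3, rfl⟩ := map_split h2
        simp at h3; subst h3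
        obtain ⟨k, hk, h5⟩ := drop (O1 ++ P) d2 Q F1 F2 (by simp) hF
        refine ⟨k + 1, by omega, ?_⟩
        have := DG.face ht (w := P.map lab ++ wordInv ((F2 ++ F1).map lab) ++ Q.map lab) (n := k)
          (by simpa [hO1] using h5)
        simp only [List.map_append, List.map_cons, labinl, labx]
        simpa using this
  case red =>
    intro f1 f2 g1 g2 d h1 h2 h3
    rcases List.mem_cons.1 h1 with h1 | h1 <;> rcases List.mem_cons.1 h2 with h2 | h2
    · exfalso
      have hl : ∀ d, lab' (rev' d) = linv (lab' d) := by
        rintro (d | b)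
        · simp [rev', lab', lab_rev]
        · cases b <;> simp [rev', lab']
      have hr : ∀ d, rev' (rev' d) = d := by rintro (d | b) <;> simp [rev', rev_rev]
      rcases app3 (h1.trans h2.symm) with ⟨k, rfl, rfl⟩ | ⟨rfl, h4, rfl⟩ | ⟨k, rfl, rfl⟩
      · refine self_mirror hR (A := g1.map lab') (B := k.map lab') (y := lab' (rev' d))
          (C := f2.map lab') ?_ ?_
        · rw [← hl, hr]; rw [← hg0lab, ← h2] at ht; simpa using ht
        · have := congrArg wordInv h3
          rw [wordInv_wordInv] at this
          rw [← hl, hr]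
          simpa using this.symm
      · rcases d with d | b
        · simp [rev', rev_ne] at h4
        · simp [rev'] at h4
      · refine self_mirror hR (A := f1.map lab') (B := k.map lab') (y := lab' d)
          (C := g2.map lab') ?_ ?_
        · rw [← hl]; rw [← hg0lab, ← h1] at ht; simpa using ht
        · rw [← hl]
          simpa using h3
    · exact redNO f1 f2 g1 g2 d h1 h2 h3
    · refine redNO g1 g2 f1 f2 (rev' d) h2 ?_ ?_
      · have hr : rev' (rev' d) = d := by rcases d with d | b <;> simp [rev', rev_rev]
        rwa [hr]
      · rw [h3, wordInv_wordInv]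
    · obtain ⟨F, hF, h4⟩ := List.mem_map.1 h1
      obtain ⟨F1, d1, F2, rfl, rfl, rfl, rfl⟩ := map_split h4
      obtain ⟨G, hG, h5⟩ := List.mem_map.1 h2
      obtain ⟨G1, d2, G2, rfl, rfl, h6, rfl⟩ := map_split h5
      simp [rev'] at h6; subst h6
      rw [← List.map_append, ← List.map_append, labinl, labinl] at h3
      obtain ⟨k, hk, h7⟩ := red F1 F2 G1 G2 d1 hF hG h3
      exact ⟨k + 1, by omega, DG.face ht h7⟩
end P2
end MorseLTG
open Metric Set Filter
namespace MorseLTG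
section P2b
variable {S : Type*} {R : Set (Word S)}
lemma Km.bridge {n m : ℕ} {x : S × Bool} {C E : Word S} (hC : DG R n C) (hE : DG R m E)
    (K1 : Km R n C) (K2 : Km R m E) : Nonempty (Km R (n + m) (x :: (C ++ linv x :: E))) := by
  let D' := (K1.D ⊕ K2.D) ⊕ Bool
  have f1 := K1.fD
  have f2 := K2.fD
  have f3 := K1.fV
  have f4 := K2.fV
  let i1 : K1.D → D' := fun d => Sum.inl (Sum.inl d)
  let i2 : K2.D → D' := fun d => Sum.inl (Sum.inr d)
  have hi1 : Function.Injective i1 := Sum.inl_injective.comp Sum.inl_injective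
  have hi2 : Function.Injective i2 := Sum.inl_injective.comp Sum.inr_injective
  let src' : D' → K1.V ⊕ K2.V := Sum.elim (Sum.map K1.src K2.src)
    (fun b => if b then Sum.inr K2.base else Sum.inl K1.base)
  let rev' : D' → D' := Sum.map (Sum.map K1.rev K2.rev) not
  let lab' : D' → S × Bool := Sum.elim (Sum.elim K1.lab K2.lab) (fun b => if b then x else linv x)
  let c := K2.pos K2.base * evalWord (presGen R) [x] * (K1.pos K1.base)⁻¹
  have lab1 : ∀ l : List K1.D, (l.map i1).map lab' = l.map K1.lab := by
    intro l; simp [lab', i1]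
  have lab2 : ∀ l : List K2.D, (l.map i2).map lab' = l.map K2.lab := by
    intro l; simp [lab', i2]
  have r1 : ∀ d, rev' (i1 d) = i1 (K1.rev d) := fun d => rfl
  have r2 : ∀ d, rev' (i2 d) = i2 (K2.rev d) := fun d => rfl
  have labx : lab' (Sum.inr true) = x := by simp [lab']
  have labx' : lab' (Sum.inr false) = linv x := by simp [lab']
  have n12 : ∀ d e, i1 d ≠ i2 e := by grind
  have n21 : ∀ d e, i2 d ≠ i1 e := by grind
  have n1 : ∀ d b, i1 d ≠ Sum.inr b := by grind
  have n2 : ∀ d b, i2 d ≠ Sum.inr b := by grind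
  have hcl : ∀ o1 d o2, (Sum.inr true :: (K1.outer.map i1 ++ Sum.inr false :: K2.outer.map i2) : List D')
      = o1 ++ d :: o2 →
      (o1 = [] ∧ d = Sum.inr true ∧ o2 = K1.outer.map i1 ++ Sum.inr false :: K2.outer.map i2) ∨
      (d = Sum.inr false ∧ o1 = Sum.inr true :: K1.outer.map i1 ∧ o2 = K2.outer.map i2) ∨
      (∃ P e Q, K1.outer = P ++ e :: Q ∧ o1 = Sum.inr true :: P.map i1 ∧ d = i1 e ∧
        o2 = Q.map i1 ++ Sum.inr false :: K2.outer.map i2) ∨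
      (∃ P e Q, K2.outer = P ++ e :: Q ∧
        o1 = Sum.inr true :: (K1.outer.map i1 ++ Sum.inr false :: P.map i2) ∧ d = i2 e ∧
        o2 = Q.map i2) := by
    intro o1 d o2 h
    rcases o1 with _ | ⟨z, o1⟩
    · grind
    · simp only [List.cons_append, List.cons.injEq] at h
      obtain ⟨rfl, h⟩ := h
      rcases app3 h with ⟨k, h1, h2⟩ | ⟨rfl, rfl, rfl⟩ | ⟨k, rfl, h2⟩
      · obtain ⟨P, e, Q, h3, rfl, rfl, rfl⟩ := map_split h1
        grind
      · grind
      · obtain ⟨P, e, Q, h3, rfl, rfl, rfl⟩ := map_split h2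
        grind
  have hfc : ∀ f1 d f2, f1 ++ d :: f2 ∈ K1.faces.map (List.map i1) ++ K2.faces.map (List.map i2) →
      (∃ F1 e F2, F1 ++ e :: F2 ∈ K1.faces ∧ f1 = F1.map i1 ∧ d = i1 e ∧ f2 = F2.map i1) ∨
      (∃ F1 e F2, F1 ++ e :: F2 ∈ K2.faces ∧ f1 = F1.map i2 ∧ d = i2 e ∧ f2 = F2.map i2) := by
    intro f1 d f2 h
    rcases List.mem_append.1 h with h | h
    · obtain ⟨F, hF, h4⟩ := List.mem_map.1 h
      obtain ⟨P, e, Q, rfl, rfl, rfl, rfl⟩ := map_split h4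
      grind
    · obtain ⟨F, hF, h4⟩ := List.mem_map.1 h
      obtain ⟨P, e, Q, rfl, rfl, rfl, rfl⟩ := map_split h4
      grind
  have ep1 : ∀ {l a b}, EPath K1.src K1.rev l a b → EPath src' rev' (l.map i1) (Sum.inl a) (Sum.inl b) :=
    fun h => EPath.map (src' := src') (rev' := rev') i1 Sum.inl (by simp [src', i1]) r1 h
  have ep2 : ∀ {l a b}, EPath K2.src K2.rev l a b → EPath src' rev' (l.map i2) (Sum.inr a) (Sum.inr b) :=
    fun h => EPath.map (src' := src') (rev' := rev') i2 Sum.inr (by simp [src', i2]) r2 h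
  refine ⟨{ V := K1.V ⊕ K2.V, D := D', fV := inferInstance, fD := inferInstance, rev := rev', src := src',
            lab := lab', pos := Sum.elim (fun v => c * K1.pos v) K2.pos, base := Sum.inr K2.base,
            outer := Sum.inr true :: (K1.outer.map i1 ++ Sum.inr false :: K2.outer.map i2),
            faces := K1.faces.map (List.map i1) ++ K2.faces.map (List.map i2),
            rev_rev := ?rev_rev,
            rev_ne := ?rev_ne,
            lab_rev := ?lab_rev,
            hpos := ?hpos,
            hw := ?hw,
            hn := ?hn,
            hf := ?hf,
            nd := ?nd,
            all := ?all,
            pouter := ?pouter,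
            pfaces := ?pfaces,
            euler := ?euler,
            hdeg := ?hdeg,
            split := ?split,
            drop := ?drop,
            red := ?red }⟩
  case rev_rev => rintro ((d | d) | b) <;> simp [rev', K1.rev_rev, K2.rev_rev]
  case rev_ne =>
    rintro ((d | d) | b) h
    · exact K1.rev_ne d (hi1 h)
    · exact K2.rev_ne d (hi2 h)
    grind
  case lab_rev =>
    rintro ((d | d) | b)
    · simp [rev', lab', K1.lab_rev]
    · simp [rev', lab', K2.lab_rev]
    · cases b <;> simp [rev', lab']
  case hpos =>
    rintro ((d | d) | b)
    · simp [rev', lab', src', K1.hpos, mul_assoc]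
    · simpa [rev', lab', src'] using K2.hpos d
    · cases b
      · simp [rev', lab', src', c]
      · simp [rev', lab', src', c]
  case hw =>
    simp only [List.map_cons, List.map_append, lab1, lab2, labx, labx', K1.hw, K2.hw]
  case hn => simp [K1.hn, K2.hn]
  case hf =>
    intro f hf'
    rcases List.mem_append.1 hf' with hf' | hf'
    · obtain ⟨F, hF, rfl⟩ := List.mem_map.1 hf'
      rw [lab1]
      exact ⟨(K1.hf F hF).1, by simpa using (K1.hf F hF).2⟩
    · obtain ⟨F, hF, rfl⟩ := List.mem_map.1 hf'
      rw [lab2]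
      exact ⟨(K2.hf F hF).1, by simpa using (K2.hf F hF).2⟩
  case nd =>
    have hp : List.Perm ((K1.faces.map (List.map i1) ++ K2.faces.map (List.map i2)).flatten ++
        (Sum.inr true :: (K1.outer.map i1 ++ Sum.inr false :: K2.outer.map i2)).map rev')
        (Sum.inr true :: Sum.inr false :: ((K1.faces.flatten ++ K1.outer.map K1.rev).map i1
          ++ (K2.faces.flatten ++ K2.outer.map K2.rev).map i2)) := by
      refine perm_of_count ?_
      intro _ a
      have e1 : rev' ∘ i1 = i1 ∘ K1.rev := rfl
      have e2 : rev' ∘ i2 = i2 ∘ K2.rev := rfl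
      have e3 : rev' (Sum.inr true) = Sum.inr false := rfl
      have e4 : rev' (Sum.inr false) = Sum.inr true := rfl
      simp [List.map_flatten, List.count_cons, e1, e2, e3, e4]
      omega
    rw [hp.nodup_iff]
    simp only [List.nodup_cons]
    refine ⟨?_, ?_, ?_⟩
    · intro h
      simp only [List.mem_cons, List.mem_append, List.mem_map] at h
      rcases h with h | ⟨_, _, h⟩ | ⟨_, _, h⟩ <;> cases h
    · intro h
      simp only [List.mem_append, List.mem_map] at h
      rcases h with ⟨_, _, h⟩ | ⟨_, _, h⟩ <;> cases h
    refine List.Nodup.append (List.Nodup.map hi1 K1.nd) (List.Nodup.map hi2 K2.nd) ?_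
    intro a h1 h2
    obtain ⟨b, _, rfl⟩ := List.mem_map.1 h1
    obtain ⟨b', _, h3⟩ := List.mem_map.1 h2
    grind
  case all =>
    have e1 : rev' ∘ i1 = i1 ∘ K1.rev := rfl
    have e2 : rev' ∘ i2 = i2 ∘ K2.rev := rfl
    have e3 : rev' (Sum.inr true) = Sum.inr false := rfl
    have e4 : rev' (Sum.inr false) = Sum.inr true := rfl
    rintro ((d | d) | b)
    · have := List.mem_map_of_mem (f := i1) (K1.all d)
      change i1 d ∈ _
      simp only [List.map_append, List.flatten_append, List.map_cons, List.map_map, e1, e2, e3, e4,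
        List.map_flatten, List.mem_append, List.mem_cons] at this ⊢
      tauto
    · have := List.mem_map_of_mem (f := i2) (K2.all d)
      change i2 d ∈ _
      simp only [List.map_append, List.flatten_append, List.map_cons, List.map_map, e1, e2, e3, e4,
        List.map_flatten, List.mem_append, List.mem_cons] at this ⊢
      tauto
    · cases b <;> simp [rev']
  case pouter =>
    refine ⟨by simp [src'], ?_⟩
    rw [EPath.append]
    refine ⟨Sum.inl K1.base, ep1 K1.pouter, by simp [src'], ep2 K2.pouter⟩
  case pfaces =>
    intro f hf'
    rcases List.mem_append.1 hf' with hf' | hf'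
    · obtain ⟨F, hF, rfl⟩ := List.mem_map.1 hf'
      obtain ⟨v, hv⟩ := K1.pfaces F hF
      grind
    · obtain ⟨F, hF, rfl⟩ := List.mem_map.1 hf'
      obtain ⟨v, hv⟩ := K2.pfaces F hF
      grind
  case euler =>
    have h1 := K1.euler
    have h2 := K2.euler
    rw [show Fintype.card D' = (Fintype.card K1.D + Fintype.card K2.D) + 2 by
      rw [Fintype.card_sum, Fintype.card_sum]; simp, Fintype.card_sum]
    have e1 : ∀ i : Fintype K1.D, @Fintype.card _ i = @Fintype.card _ f1 := fun i => by congr!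
    have e2 : ∀ i : Fintype K2.D, @Fintype.card _ i = @Fintype.card _ f2 := fun i => by congr!
    have e3 : ∀ i : Fintype K1.V, @Fintype.card _ i = @Fintype.card _ f3 := fun i => by congr!
    have e4 : ∀ i : Fintype K2.V, @Fintype.card _ i = @Fintype.card _ f4 := fun i => by congr!
    grind
  case hdeg =>
    rintro (v | v)
    · rcases K1.hdeg v with rfl | ⟨d, rfl⟩
      · exact Or.inr ⟨Sum.inr false, by simp [src']⟩
      · exact Or.inr ⟨i1 d, by simp [src', i1]⟩
    · rcases K2.hdeg v with rfl | ⟨d, rfl⟩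
      · grind
      · exact Or.inr ⟨i2 d, by simp [src', i2]⟩
  case split =>
    intro o1 d o2 o3 h
    have hh := hcl (o1 ++ d :: o2) (rev' d) o3 (by rw [h]; simp)
    rcases hcl _ _ _ h with ⟨rfl, rfl, h1⟩ | ⟨rfl, rfl, h1⟩ | ⟨P, e, Q, h1, rfl, rfl, h3⟩ |
      ⟨P, e, Q, h1, rfl, rfl, h3⟩
    · rcases hh with ⟨h4, h5, h6⟩ | ⟨h4, h5, h6⟩ | ⟨P', e', Q', h4, h5, h6, h7⟩ | ⟨P', e', Q', h4, h5, h6, h7⟩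
      · grind
      · simp at h5
        subst h5; subst h6
        exact ⟨n, m, rfl, by rw [lab1, K1.hw]; exact hC, by
          rw [List.nil_append, lab2, K2.hw]; exact hE⟩
      · exact absurd h6.symm (n1 _ _)
      · exact absurd h6.symm (n2 _ _)
    · obtain ⟨_, _, _, _, _, h4, _⟩ := map_split h1.symm
      exact absurd h4 (n2 _ _)
    · rcases hh with ⟨h4, h5, h6⟩ | ⟨h4, h5, h6⟩ | ⟨P', e', Q', h4, h5, h6, h7⟩ | ⟨P', e', Q', h4, h5, h6, h7⟩
      · grind
      · grind
      · have h8 : e' = K1.rev e := (hi1 (by grind)).symm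
        subst h8
        simp only [List.cons_append, List.cons.injEq, true_and] at h5
        obtain ⟨P2, e2, Q2, rfl, h9, h10, rfl⟩ := map_split h5.symm
        have h11 := hi1 h10
        have h12 : P2 = P := List.map_injective_iff.2 hi1 h9
        subst h11; subst h12; subst h7
        obtain ⟨a, b, hab, h5, h6⟩ := K1.split P2 e2 Q2 Q' (by rw [h4]; simp)
        refine ⟨a, b + m, by omega, by grind, ?_⟩
        have := DG.bridge (x := x) h6 hE
        simp only [List.map_append, List.map_cons, lab1, lab2, labx, labx', K2.hw] at this ⊢
        simpa using this
      grind
    · rcases hh with ⟨h4, h5, h6⟩ | ⟨h4, h5, h6⟩ | ⟨P', e', Q', h4, h5, h6, h7⟩ | ⟨P', e', Q', h4, h5, h6, h7⟩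
      · grind
      · grind
      · grind
      · have h8 : e' = K2.rev e := (hi2 (by grind)).symm
        subst h8
        simp only [List.cons_append, List.append_assoc, List.cons.injEq, true_and,
          List.append_cancel_left_eq] at h5
        obtain ⟨P2, e2, Q2, rfl, h9, h10, rfl⟩ := map_split h5.symm
        have h11 := hi2 h10
        have h12 : P2 = P := List.map_injective_iff.2 hi2 h9
        subst h11; subst h12; subst h7
        obtain ⟨a, b, hab, h5, h6⟩ := K2.split P2 e2 Q2 Q' (by rw [h4]; simp)
        refine ⟨a, n + b, by omega, by grind, ?_⟩
        have := DG.bridge (x := x) hC h6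
        simp only [List.map_append, List.map_cons, lab1, lab2, labx, labx', K1.hw] at this ⊢
        simpa using this
  case drop =>
    intro o1 d o2 f1 f2 h hf'
    rcases hfc _ _ _ hf' with ⟨F1, e, F2, hF, rfl, rfl, rfl⟩ | ⟨F1, e, F2, hF, rfl, rfl, rfl⟩ <;>
    rcases hcl _ _ _ h with ⟨rfl, h0, h1⟩ | ⟨h0, rfl, h1⟩ | ⟨P, e', Q, h1, rfl, h0, h3⟩ |
      ⟨P, e', Q, h1, rfl, h0, h3⟩
    · grind
    · grind
    · have h0 := hi1 h0
      subst h0; subst h3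
      obtain ⟨k, hk, h5⟩ := K1.drop P e Q F1 F2 h1 hF
      refine ⟨k + m, by omega, ?_⟩
      have := DG.bridge (x := x) h5 hE
      simp only [List.map_append, List.map_cons, lab1, lab2, labx, labx', K2.hw] at this ⊢
      simpa using this
    · grind
    · exact absurd h0 (n2 _ _)
    · exact absurd h0 (n2 _ _)
    · exact absurd h0 (n21 _ _)
    · have h0 := hi2 h0
      subst h0; subst h3
      obtain ⟨k, hk, h5⟩ := K2.drop P e Q F1 F2 h1 hF
      refine ⟨n + k, by omega, ?_⟩
      have := DG.bridge (x := x) hC h5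
      simp only [List.map_append, List.map_cons, lab1, lab2, labx, labx', K1.hw] at this ⊢
      simpa using this
  case red =>
    intro f1 f2 g1 g2 d h1 h2 h3
    rcases hfc _ _ _ h1 with ⟨F1, e, F2, hF, rfl, rfl, rfl⟩ | ⟨F1, e, F2, hF, rfl, rfl, rfl⟩ <;>
    rcases hfc _ _ _ h2 with ⟨G1, e', G2, hG, rfl, h0, rfl⟩ | ⟨G1, e', G2, hG, rfl, h0, rfl⟩
    · have h0 : e' = K1.rev e := (hi1 (by grind)).symm
      subst h0
      rw [← List.map_append, ← List.map_append, lab1, lab1] at h3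
      obtain ⟨k, hk, h7⟩ := K1.red F1 F2 G1 G2 e hF hG h3
      exact ⟨k + m, by omega, DG.bridge h7 hE⟩
    · grind
    · exact absurd h0 (n21 _ _)
    · have h0 : e' = K2.rev e := (hi2 (by rw [← r2, h0])).symm
      subst h0
      rw [← List.map_append, ← List.map_append, lab2, lab2] at h3
      obtain ⟨k, hk, h7⟩ := K2.red F1 F2 G1 G2 e hF hG h3
      exact ⟨n + k, by omega, DG.bridge hC h7⟩
theorem DG.toKm (hR : ∀ r ∈ R, CyclicallyReduced r) {n : ℕ} {w : Word S} (h : DG R n w) :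
    Nonempty (Km R n w) := by
  induction h with
  | nil => exact Km.nil
  | face ht hD ih => exact ih.elim fun K => Km.face hR ht hD K
  | bridge h1 h2 ih1 ih2 => exact ih1.elim fun K1 => ih2.elim fun K2 => Km.bridge h1 h2 K1 K2
end P2b
end MorseLTG
open Metric Set Filter
namespace MorseLTG
section P3
local notation "oo" => (by omega)
variable {S : Type*} {R : Set (Word S)}
structure Pl (R : Set (Word S)) (n : ℕ) (w : Word S) where
  V : Type
  D : Type
  fV : Fintype V
  fD : Fintype D
  rev : D → D
  rev_rev : ∀ d, rev (rev d) = d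
  rev_ne : ∀ d, rev d ≠ d
  src : D → V
  lab : D → S × Bool
  lab_rev : ∀ d, lab (rev d) = linv (lab d)
  pos : V → PresentedGroup (FreeGroup.mk '' R)
  hpos : ∀ d, pos (src (rev d)) = pos (src d) * evalWord (presGen R) [lab d]
  nxt : Equiv.Perm D
  fc : D → ℕ
  fc_le : ∀ d, fc d ≤ n
  fc_nxt : ∀ d, fc (nxt d) = fc d
  src_nxt : ∀ d, src (nxt d) = src (rev d)
  len : ℕ → ℕ
  hlen : ∀ d, 0 < len (fc d)
  per : ∀ d, nxt^[len (fc d)] d = d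
  orb : ∀ d d', fc d = fc d' → ∃ k < len (fc d), nxt^[k] d = d'
  inj : ∀ d, ∀ i < len (fc d), ∀ j < len (fc d), nxt^[i] d = nxt^[j] d → i = j
  surj : ∀ f, 1 ≤ f → f ≤ n → ∃ d, fc d = f
  wd_mem : ∀ d, fc d ≠ 0 → ((List.range (len (fc d))).map fun k => lab (nxt^[k] d)) ∈ symmClosure R
  out : ℕ → D
  out_per : ∀ i, out (i + w.length) = out i
  out_fc : ∀ i, fc (rev (out i)) = 0
  out_nxt : ∀ i, nxt (rev (out (i + 1))) = rev (out i)
  out_surj : ∀ d, fc (rev d) = 0 → ∃ i < w.length, out i = d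
  out_inj : ∀ i < w.length, ∀ j < w.length, out i = out j → i = j
  out_lab : ∀ i (h : i < w.length), lab (out i) = w[i]
  out_src : ∀ i, src (out (i + 1)) = src (rev (out i))
  euler : 2 * Fintype.card V + 2 * n = Fintype.card D + 2
  hdeg : ∀ v, ∃ d, src d = v
  drop : ∀ i < w.length, fc (out i) ≠ 0 → ∃ k, k + 1 = n ∧ DG R k (w.take i ++
    wordInv (((List.range (len (fc (out i)))).map fun k => lab (nxt^[k] (out i))).tail) ++ w.drop (i + 1))
  red : ∀ d, fc d ≠ 0 → fc (rev d) ≠ 0 → ((List.range (len (fc d))).map fun k => lab (nxt^[k] d)).tail ≠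
    wordInv (((List.range (len (fc (rev d)))).map fun k => lab (nxt^[k] (rev d))).tail)
lemma EPath.next {V D : Type} {src : D → V} {rev : D → D} {l : List D} {a b : V}
    (h : EPath src rev l a b) :
    ∀ i (hi : i + 1 < l.length), src (l[i + 1]) = src (rev (l[i])) := by
  induction l generalizing a with
  | nil => intro i hi; simp at hi
  | cons d l ih =>
    intro i hi
    rcases i with _ | i
    · rcases l with _ | ⟨e, l⟩
      · grind
      · exact h.2.1
    · exact ih h.2 i (by grind)
lemma EPath.cyc {V D : Type} {src : D → V} {rev : D → D} {l : List D} {a : V}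
    (h : EPath src rev l a a) (i : ℕ) (hi : i < l.length) :
    src (l[(i + 1) % l.length]'(Nat.mod_lt _ oo)) = src (rev (l[i])) := by
  by_cases h1 : i + 1 < l.length
  · have := h.next i h1
    simp only [Nat.mod_eq_of_lt h1]
    exact this
  · have h2 : i + 1 = l.length := by omega
    have h3 : (i + 1) % l.length = 0 := by rw [h2]; exact Nat.mod_self _
    simp only [h3]
    obtain ⟨l', d, rfl⟩ : ∃ l' d, l = l' ++ [d] := by
      rcases List.eq_nil_or_concat' l with rfl | ⟨l', d, h⟩
      · simp at hi
      · exact ⟨l', d, h⟩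
    obtain ⟨b, h4, h5, h6⟩ := EPath.append.1 h
    have e1 : (l' ++ [d])[i] = d := by
      rw [List.getElem_append_right (by simp at h2; omega)]; simp
    rw [e1]
    have h6 : src (rev d) = a := h6
    rw [h6]
    rcases l' with _ | ⟨e, l'⟩
    · exact h5.trans h4.symm
    · exact h.1
lemma rot_range {α β : Type*} (L : List α) (f : α → β) (i : ℕ) (hi : i < L.length) :
    (List.range L.length).map (fun k => f (L[(i + k) % L.length]'(Nat.mod_lt _ oo))) =
      (L.rotate i).map f := by
  apply List.ext_getElem
  · simp
  · intro j h1 h2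
    simp [List.getElem_rotate, add_comm]
lemma rot_tail {α : Type*} (L : List α) (i : ℕ) (hi : i < L.length) :
    (L.rotate i) = L[i] :: (L.drop (i + 1) ++ L.take i) := by
  rw [List.rotate_eq_drop_append_take hi.le, List.drop_eq_getElem_cons hi]; rfl
theorem Km.toPl {n : ℕ} {w : Word S} (K : Km R n w) (hw : w ≠ [])
    (hmin : ∀ m < n, ¬ DG R m w) : Nonempty (Pl R n w) := by
  obtain ⟨V, D, fV, fD, rev, rev_rev, rev_ne, src, lab, lab_rev, pos, hpos, base, outer, faces,
    hw', hn, hf, nd, all, pouter, pfaces, euler, hdeg, split, drop, red⟩ := K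
  have hm : outer.length = w.length := by rw [← hw']; simp
  have hm0 : 0 < w.length := List.length_pos_of_ne_nil hw
  have hd0 : ∃ d, src d = base := by
    rcases outer with _ | ⟨d, o⟩
    · simp at hm; omega
    · exact ⟨d, pouter.1⟩
  set Li := (outer.map rev).reverse with hLi
  set LL := Li :: faces with hLL
  have hLLn : LL.length = n + 1 := by simp [hLL, hn]
  have hflat : LL.flatten.Perm (faces.flatten ++ outer.map rev) := by
    simp only [hLL, List.flatten_cons, hLi]
    exact (List.perm_append_comm).trans (List.Perm.append_left _ (List.reverse_perm _))
  have ndL : LL.flatten.Nodup := (hflat.nodup_iff).2 nd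
  have allL : ∀ d, d ∈ LL.flatten := fun d => (hflat.mem_iff).2 (all d)
  rw [List.nodup_flatten] at ndL
  obtain ⟨nd1, nd2⟩ := ndL
  have hne : ∀ l ∈ LL, 0 < l.length := by
    intro l hl
    rcases List.mem_cons.1 hl with rfl | hl
    · simp [hLi]; omega
    · exact List.length_pos_of_ne_nil (hf l hl).2
  have hcl : ∀ l ∈ LL, ∃ v, EPath src rev l v v := by
    intro l hl
    rcases List.mem_cons.1 hl with rfl | hl
    · exact ⟨base, pouter.reverse rev_rev⟩
    · exact pfaces l hl
  have ex : ∀ d, ∃ j : ℕ, ∃ hj : j < LL.length, ∃ i : ℕ, ∃ hi : i < LL[j].length, LL[j][i] = d := by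
    intro d
    obtain ⟨l, hl, hd⟩ := List.mem_flatten.1 (allL d)
    obtain ⟨j, hj, rfl⟩ := List.getElem_of_mem hl
    obtain ⟨i, hi, h⟩ := List.getElem_of_mem hd
    exact ⟨j, hj, i, hi, h⟩
  have un : ∀ j (hj : j < LL.length) j' (hj' : j' < LL.length) d, d ∈ LL[j] → d ∈ LL[j'] → j = j' := by
    intro j hj j' hj' d h1 h2
    rcases lt_trichotomy j j' with h | h | h
    · exact absurd h2 ((List.pairwise_iff_getElem.1 nd2 j j' hj hj' h) h1)
    · exact h
    · exact absurd h1 ((List.pairwise_iff_getElem.1 nd2 j' j hj' hj h) h2)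
  choose fc hfc ix hix hget using ex
  have uq : ∀ j (hj : j < LL.length) i (hi : i < LL[j].length), fc (LL[j][i]) = j ∧
      ix (LL[j][i]) = i := by
    intro j hj i hi
    have h1 := hget (LL[j][i])
    have h2 : fc (LL[j][i]) = j := un _ (hfc _) _ hj _ (by
      have := List.getElem_mem (hix (LL[j][i])); rwa [h1] at this) (List.getElem_mem hi)
    refine ⟨h2, ?_⟩
    have h3 := nd1 _ (List.getElem_mem hj)
    have h4 := hix (LL[j][i])
    simp only [h2] at h1 h4
    exact (List.Nodup.getElem_inj_iff h3 (hi := h4) (hj := hi)).1 h1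
  have hpos' : ∀ d, 0 < (LL[fc d]'(hfc d)).length := fun d => hne _ (List.getElem_mem _)
  let nx : D → D := fun d => (LL[fc d]'(hfc d))[(ix d + 1) % (LL[fc d]'(hfc d)).length]'(Nat.mod_lt _ (hpos' d))
  have nx_get : ∀ j (hj : j < LL.length) i (hi : i < LL[j].length),
      nx (LL[j][i]) = LL[j][(i + 1) % LL[j].length]'(Nat.mod_lt _ oo) := by
    intro j hj i hi
    obtain ⟨h1, h2⟩ := uq j hj i hi
    simp only [nx, h1, h2]
  have nx_iter : ∀ k j (hj : j < LL.length) i (hi : i < LL[j].length),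
      nx^[k] (LL[j][i]) = LL[j][(i + k) % LL[j].length]'(Nat.mod_lt _ oo) := by
    intro k
    induction k with
    | zero => intro j hj i hi; simp [Nat.mod_eq_of_lt hi]
    | succ k ih =>
      intro j hj i hi
      rw [Function.iterate_succ_apply', ih, nx_get]
      congr 1
      rw [Nat.mod_add_mod, add_assoc]
  have hper : ∀ d, nx^[(LL[fc d]'(hfc d)).length] d = d := by
    intro d
    conv_lhs => rw [← hget d]
    simp only [hget d]
    have := nx_iter (LL[fc d]'(hfc d)).length (fc d) (hfc d) (ix d) (hix d)
    rw [hget d] at this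
    rw [this]
    simp only [Nat.add_mod_right, Nat.mod_eq_of_lt (hix d)]
    exact hget d
  have nx_inj : Function.Injective nx := by
    have : Function.Surjective nx := by
      intro d
      obtain ⟨k, hk⟩ : ∃ k, (LL[fc d]'(hfc d)).length = k + 1 := ⟨_, (Nat.succ_pred_eq_of_pos (hpos' d)).symm⟩
      have := hper d
      rw [hk, Function.iterate_succ_apply'] at this
      exact ⟨_, this⟩
    exact Finite.injective_iff_surjective.2 this
  let nxt : Equiv.Perm D := Equiv.ofBijective nx (Finite.injective_iff_bijective.1 nx_inj)
  have hnxt : (nxt : D → D) = nx := rfl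
  let len : ℕ → ℕ := fun j => if h : j < LL.length then LL[j].length else 0
  have hlen : ∀ d, len (fc d) = (LL[fc d]'(hfc d)).length := by
    intro d; simp only [len, hfc, dif_pos]
  have fcall : ∀ P : D → Prop, (∀ j (hj : j < LL.length) i (hi : i < LL[j].length), P (LL[j][i])) → ∀ d, P d := by
    intro P h d
    have := h (fc d) (hfc d) (ix d) (hix d)
    rwa [hget d] at this
  have wdeq : ∀ j (hj : j < LL.length) i (hi : i < LL[j].length),
      ((List.range (len (fc (LL[j][i])))).map fun k => lab (nxt^[k] (LL[j][i]))) =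
        (LL[j].rotate i).map lab := by
    intro j hj i hi
    rw [← rot_range _ _ _ hi, hlen]
    simp only [(uq j hj i hi).1]
    apply List.map_congr_left
    intro k _
    rw [hnxt, nx_iter]
  have wdtail : ∀ j (hj : j < LL.length) i (hi : i < LL[j].length),
      ((List.range (len (fc (LL[j][i])))).map fun k => lab (nxt^[k] (LL[j][i]))).tail =
        (LL[j].drop (i + 1) ++ LL[j].take i).map lab := by
    intro j hj i hi
    rw [wdeq, rot_tail _ _ hi]; rfl
  have Ldec : ∀ (L : List D) i (hi : i < L.length), L.take i ++ L[i] :: L.drop (i + 1) = L := by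
    intro L i hi
    rw [← List.drop_eq_getElem_cons hi, List.take_append_drop]
  have hLLf : ∀ j (hj : j < LL.length), j ≠ 0 → LL[j] ∈ faces := by
    intro j hj h0
    rcases j with _ | j
    · exact absurd rfl h0
    · simp [hLL]
  have hm' : ∀ i, i % w.length < outer.length := fun i => by rw [hm]; exact Nat.mod_lt _ hm0
  let out : ℕ → D := fun i => outer[i % w.length]'(hm' i)
  have LL0 : ∀ i (hi : i < outer.length), ∃ h : outer.length - 1 - i < (LL[0]'oo).length,
      rev (outer[i]) = (LL[0]'oo)[outer.length - 1 - i] := by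
    intro i hi
    have h : outer.length - 1 - i < (LL[0]'oo).length := by
      simp [hLL, hLi]; omega
    refine ⟨h, ?_⟩
    simp only [hLL, hLi, List.getElem_cons_zero, List.getElem_reverse, List.length_map, List.getElem_map]
    congr 2
    omega
  have hfc0 : ∀ i (hi : i < outer.length), fc (rev (outer[i])) = 0 := by
    intro i hi
    obtain ⟨h, h2⟩ := LL0 i hi
    rw [h2]; exact (uq _ _ _ _).1
  refine ⟨{ V := V, D := D, fV := fV, fD := fD, rev := rev, rev_rev := rev_rev, rev_ne := rev_ne,
            src := src, lab := lab, lab_rev := lab_rev, pos := pos, hpos := hpos,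
            nxt := nxt, fc := fc, fc_le := fun d => by have := hfc d; omega, 
            fc_nxt := ?_, src_nxt := ?_, len := len, hlen := fun d => by rw [hlen]; exact hpos' d,
            per := fun d => by rw [hlen]; exact hper d, 
            orb := ?_, inj := ?_, surj := ?_, wd_mem := ?_, out := out, 
            out_per := fun i => by simp [out], out_fc := fun i => hfc0 _ _, 
            out_nxt := ?_, out_surj := ?_, out_inj := ?_, out_lab := ?_, out_src := ?_,
            euler := euler, hdeg := ?_, drop := ?_, red := ?_}⟩
  · refine fcall _ ?_
    intro j hj i hi
    rw [hnxt, nx_get, (uq _ _ _ _).1, (uq _ _ _ _).1]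
  · refine fcall _ ?_
    intro j hj i hi
    rw [hnxt, nx_get]
    obtain ⟨v, hv⟩ := hcl _ (List.getElem_mem hj)
    exact hv.cyc i hi
  · refine fcall _ ?_
    intro j hj i hi d' h
    have h0 := (uq j hj i hi).1
    have h1 : ∃ i', ∃ hi' : i' < LL[j].length, LL[j][i'] = d' := by
      have h2 := hget d'
      have h3 := hix d'
      simp only [← h, h0] at h2 h3
      exact ⟨_, h3, h2⟩
    obtain ⟨i', hi', rfl⟩ := h1
    rw [hlen]
    simp only [h0]
    refine ⟨(i' + LL[j].length - i) % LL[j].length, Nat.mod_lt _ oo, ?_⟩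
    rw [hnxt, nx_iter]
    congr 1
    rw [Nat.add_mod_mod, show i + (i' + LL[j].length - i) = i' + LL[j].length by omega]
    simp [Nat.mod_eq_of_lt hi']
  · refine fcall _ ?_
    intro j hj i hi a ha b hb h
    rw [hlen] at ha hb
    simp only [(uq j hj i hi).1] at ha hb
    rw [hnxt, nx_iter, nx_iter, List.Nodup.getElem_inj_iff (nd1 _ (List.getElem_mem hj))] at h
    have h5 : a ≡ b [MOD LL[j].length] := Nat.ModEq.add_left_cancel' i h
    exact Nat.ModEq.eq_of_lt_of_lt h5 ha hb
  · intro f h1 h2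
    have hj : f < LL.length := by omega
    have := hne _ (List.getElem_mem hj)
    exact ⟨LL[f][0], (uq _ _ _ _).1⟩
  · refine fcall _ ?_
    intro j hj i hi h0
    rw [(uq _ _ _ _).1] at h0
    rw [wdeq, List.map_rotate]
    exact sc_rot (hf _ (hLLf j hj h0)).1 i
  · intro i
    obtain ⟨h, h2⟩ := LL0 _ (hm' (i + 1))
    obtain ⟨h', h2'⟩ := LL0 _ (hm' i)
    simp only [out]
    rw [hnxt, h2, nx_get, h2']
    congr 1
    have hl : (LL[0]'oo).length = w.length := by simp [hLL, hLi, hm]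
    simp only [hl, hm] at h h' ⊢
    have a1 := Nat.mod_lt i hm0
    by_cases hc : i % w.length + 1 < w.length
    · have : (i + 1) % w.length = i % w.length + 1 := by
        rw [Nat.add_mod, Nat.mod_eq_of_lt (a := 1) oo, Nat.mod_eq_of_lt hc]
      rw [this, Nat.mod_eq_of_lt oo]
      omega
    · have hc : i % w.length + 1 = w.length := by omega
      have : (i + 1) % w.length = 0 := by
        rw [← Nat.mod_add_mod, hc, Nat.mod_self]
      rw [this, show w.length - 1 - 0 + 1 = w.length by omega, Nat.mod_self]
      omega
  · intro d h
    have h2 := hget (rev d)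
    have h3 := hix (rev d)
    simp only [h] at h2 h3
    have hmem := List.getElem_mem h3
    rw [h2] at hmem
    simp only [hLL, hLi, List.getElem_cons_zero, List.mem_reverse, List.mem_map] at hmem
    obtain ⟨e, he, hee⟩ := hmem
    have : e = d := by rw [← rev_rev e, hee, rev_rev]
    subst this
    obtain ⟨i, hi, rfl⟩ := List.getElem_of_mem he
    refine ⟨i, by omega, ?_⟩
    simp only [out, Nat.mod_eq_of_lt (show i < w.length by omega)]
  · intro i hi j hj h
    simp only [out, Nat.mod_eq_of_lt hi, Nat.mod_eq_of_lt hj] at h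
    have h6 := congrArg rev h
    obtain ⟨h, h2⟩ := LL0 i oo
    obtain ⟨h', h2'⟩ := LL0 j oo
    rw [h2, h2', List.Nodup.getElem_inj_iff (nd1 _ (List.getElem_mem _))] at h6
    omega
  · intro i hi
    simp only [out, Nat.mod_eq_of_lt hi]
    simp [← hw']
  · intro i
    simp only [out]
    have := pouter.cyc (i % w.length) (hm' i)
    simp only [hm, Nat.mod_add_mod] at this
    exact this
  · intro v
    rcases hdeg v with rfl | h
    · exact hd0
    · exact h
  · intro i hi h0
    have hi' : i < outer.length := by omega
    have e1 : out i = outer[i] := by simp only [out, Nat.mod_eq_of_lt hi]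
    rw [e1] at h0 ⊢
    have hj := hfc (outer[i])
    have hx := hix (outer[i])
    have hg := hget (outer[i])
    have h5 := wdtail _ hj _ hx
    rw [hg] at h5
    rw [h5]
    obtain ⟨k, hk, h6⟩ := drop (outer.take i) (outer[i]) (outer.drop (i + 1))
      ((LL[fc outer[i]]'hj).take (ix outer[i])) ((LL[fc outer[i]]'hj).drop (ix outer[i] + 1))
      (Ldec _ _ hi').symm (by
        have := Ldec _ _ hx
        rw [hg] at this
        rw [this]
        exact hLLf _ _ h0)
    refine ⟨k, hk, ?_⟩
    rw [← hw', ← List.map_take, ← List.map_drop]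
    exact h6
  · intro d h0 h0' h
    have h5 := wdtail _ (hfc d) _ (hix d)
    have h6 := wdtail _ (hfc (rev d)) _ (hix (rev d))
    rw [hget] at h5 h6
    rw [h5, h6] at h
    have h7 := Ldec _ _ (hix d)
    have h8 := Ldec _ _ (hix (rev d))
    rw [hget] at h7 h8
    obtain ⟨k, hk, h9⟩ := red _ _ _ _ d (by rw [h7]; exact hLLf _ _ h0) (by rw [h8]; exact hLLf _ _ h0') h
    exact hmin k hk h9
end P3
end MorseLTG
open Metric Set Filter
namespace MorseLTG
noncomputable section P4
open scoped Classical
variable {S : Type*} {R : Set (Word S)} {n : ℕ} {w : Word S}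
attribute [instance] Pl.fV Pl.fD
namespace Pl
variable (P : Pl R n w)
def prv (d : P.D) : P.D := P.nxt.symm d
def sg (d : P.D) : P.D := P.rev (P.prv d)
def st (d : P.D) : Prop := P.sg (P.sg d) ≠ d
def deg (v : P.V) : ℕ := (Finset.univ.filter fun d => P.src d = v).card
def wd (d : P.D) : Word S := (List.range (P.len (P.fc d))).map fun k => P.lab (P.nxt^[k] d)
def eN (f : ℕ) : ℕ := (Finset.univ.filter fun d => P.fc d = f ∧ P.fc (P.rev d) = 0 ∧ P.st d).card
def iN (f : ℕ) : ℕ := (Finset.univ.filter fun d => P.fc d = f ∧ P.fc (P.rev d) ≠ 0 ∧ P.st d).card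
def hN (f : ℕ) : ℕ := (Finset.univ.filter fun d => P.fc d = f ∧ P.st d ∧ 4 ≤ P.deg (P.src d)).card
def spurs : ℕ := (Finset.univ.filter fun d => P.fc d = 0 ∧ P.deg (P.src d) = 1).card
variable {P}
@[simp] lemma nxt_prv (d : P.D) : P.nxt (P.prv d) = d := by simp [prv]
@[simp] lemma prv_nxt (d : P.D) : P.prv (P.nxt d) = d := by simp [prv]
lemma rev_inj {a b : P.D} (h : P.rev a = P.rev b) : a = b := by
  rw [← P.rev_rev a, h, P.rev_rev]
lemma fc_prv (d : P.D) : P.fc (P.prv d) = P.fc d := by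
  conv_rhs => rw [← nxt_prv d, P.fc_nxt]
lemma fc_iter (d : P.D) (k : ℕ) : P.fc (P.nxt^[k] d) = P.fc d := by
  induction k with
  | zero => rfl
  | succ k ih => rw [Function.iterate_succ_apply', P.fc_nxt, ih]
lemma src_sg (d : P.D) : P.src (P.sg d) = P.src d := by
  rw [sg, ← P.src_nxt, nxt_prv]
lemma sg_inj {a b : P.D} (h : P.sg a = P.sg b) : a = b := by
  have := rev_inj h
  exact P.nxt.symm.injective this
lemma not_st {d : P.D} (h : ¬ P.st d) : P.nxt (P.rev d) = P.rev (P.prv d) := by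
  have h : P.sg (P.sg d) = d := not_not.1 h
  have h2 : P.prv (P.sg d) = P.rev d := by
    rw [← P.rev_rev (P.prv (P.sg d))]
    exact congrArg _ h
  rw [← h2, nxt_prv]; rfl
lemma st_of {d : P.D} (h : P.nxt (P.rev d) ≠ P.rev (P.prv d)) : P.st d := by
  by_contra h2
  exact h (not_st h2)
lemma not_st_of {d : P.D} (h : P.nxt (P.rev d) = P.rev (P.prv d)) : ¬ P.st d := by
  intro h2
  apply h2
  rw [sg, sg, ← h, prv_nxt, P.rev_rev]
lemma three_le_deg {d : P.D} (h : P.st d) : 3 ≤ P.deg (P.src d) := by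
  have h1 : P.sg d ≠ d := by intro h1; apply h; rw [h1, h1]
  have h2 : P.sg (P.sg d) ≠ P.sg d := fun h2 => h1 (sg_inj h2)
  have : ({d, P.sg d, P.sg (P.sg d)} : Finset P.D) ⊆ Finset.univ.filter fun e => P.src e = P.src d := by
    intro x hx
    simp only [Finset.mem_insert, Finset.mem_singleton] at hx
    rcases hx with rfl | rfl | rfl <;> simp [src_sg]
  have h3 := Finset.card_le_card this
  rw [Finset.card_insert_of_notMem, Finset.card_pair (Ne.symm h2)] at h3
  · exact h3
  · simp only [Finset.mem_insert, Finset.mem_singleton, not_or]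
    exact ⟨Ne.symm h1, Ne.symm h⟩
lemma sg3 {d : P.D} (h : P.st d) (hd : P.deg (P.src d) = 3) : P.sg (P.sg (P.sg d)) = d := by
  have h1 : P.sg d ≠ d := by intro h1; apply h; rw [h1, h1]
  have h2 : P.sg (P.sg d) ≠ P.sg d := fun h2 => h1 (sg_inj h2)
  have hs : ({d, P.sg d, P.sg (P.sg d)} : Finset P.D) ⊆ Finset.univ.filter fun e => P.src e = P.src d := by
    intro x hx
    simp only [Finset.mem_insert, Finset.mem_singleton] at hx
    rcases hx with rfl | rfl | rfl <;> simp [src_sg]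
  have heq := Finset.eq_of_subset_of_card_le hs (by
    rw [Finset.card_insert_of_notMem, Finset.card_pair (Ne.symm h2)]
    · exact hd.le
    · simp only [Finset.mem_insert, Finset.mem_singleton, not_or]
      exact ⟨Ne.symm h1, Ne.symm h⟩)
  have : P.sg (P.sg (P.sg d)) ∈ ({d, P.sg d, P.sg (P.sg d)} : Finset P.D) := by
    rw [heq]; simp [src_sg]
  simp only [Finset.mem_insert, Finset.mem_singleton] at this
  rcases this with h4 | h4 | h4
  · omega
  · exact absurd (sg_inj h4) h
  · exact absurd (sg_inj h4) h2
lemma st_sg {d : P.D} (h : P.st d) (hd : P.deg (P.src d) = 3) : P.st (P.sg d) := by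
  intro h2
  rw [sg3 h hd] at h2
  apply h
  grind
lemma len_ne_one_of {d : P.D} : P.rev d = P.nxt d → 1 < P.len (P.fc d) := by
  intro h
  by_contra hl
  have h1 := P.hlen d
  have h2 : P.len (P.fc d) = 1 := by omega
  have := P.per d
  rw [h2] at this
  simp at this
  rw [this] at h
  exact P.rev_ne d h
lemma wd_len (d : P.D) : (P.wd d).length = P.len (P.fc d) := by simp [wd]
lemma wd_get (d : P.D) (k : ℕ) (hk : k < (P.wd d).length) : (P.wd d)[k] = P.lab (P.nxt^[k] d) := by
  simp [wd]
lemma wd_mem' (d : P.D) (h : P.fc d ≠ 0) : P.wd d ∈ symmClosure R := P.wd_mem d h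
lemma no_back (hR : ∀ r ∈ R, CyclicallyReduced r) {d : P.D} (h : P.fc d ≠ 0) : P.rev d ≠ P.nxt d := by
  intro h1
  have h2 := len_ne_one_of h1
  have h3 := sc_red hR (wd_mem' d h) 0
  rw [List.rotate_zero] at h3
  have h4 := wd_len d
  rcases hw : P.wd d with _ | ⟨a, _ | ⟨b, l⟩⟩
  · grind
  · grind
  · have ha : a = P.lab d := by
      have := wd_get d 0 (by omega)
      simp_all
    have hb : b = linv a := by
      have := wd_get d 1 (by omega)
      rw [ha, ← P.lab_rev, h1]
      simp_all
    rw [hw, hb] at h3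
    exact red_pair (u := []) (v := l) h3
lemma sg_ne (hR : ∀ r ∈ R, CyclicallyReduced r) {d : P.D} (h : P.fc d ≠ 0) : P.sg d ≠ d := by
  intro h1
  apply no_back hR (d := P.prv d) (by rwa [fc_prv])
  rw [nxt_prv]; exact h1
lemma two_le_deg (hR : ∀ r ∈ R, CyclicallyReduced r) {d : P.D} (h : P.fc d ≠ 0) :
    2 ≤ P.deg (P.src d) := by
  have h1 := sg_ne hR h
  have : ({d, P.sg d} : Finset P.D) ⊆ Finset.univ.filter fun e => P.src e = P.src d := by
    intro x hx
    simp only [Finset.mem_insert, Finset.mem_singleton] at hx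
    rcases hx with rfl | rfl <;> simp [src_sg]
  have h3 := Finset.card_le_card this
  rwa [Finset.card_pair (Ne.symm h1)] at h3
lemma one_le_deg (d : P.D) : 1 ≤ P.deg (P.src d) :=
  Finset.card_pos.2 ⟨d, by simp⟩
def hh (k : ℕ) : ℚ := 3 - 6 / k
lemma hh_one : hh 1 = -3 := by norm_num [hh]
lemma hh_two {k : ℕ} (h : 2 ≤ k) : 0 ≤ hh k := by
  have : (2 : ℚ) ≤ k := by exact_mod_cast h
  unfold hh
  rw [sub_nonneg, div_le_iff₀ (by linarith)]; linarith
lemma hh_three {k : ℕ} (h : 3 ≤ k) : 1 ≤ hh k := by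
  have : (3 : ℚ) ≤ k := by exact_mod_cast h
  unfold hh
  rw [le_sub_comm, div_le_iff₀ (by linarith)]; linarith
lemma hh_four {k : ℕ} (h : 4 ≤ k) : 3 / 2 ≤ hh k := by
  have : (4 : ℚ) ≤ k := by exact_mod_cast h
  unfold hh
  rw [le_sub_comm, div_le_iff₀ (by linarith)]; linarith
lemma sum_hh : ∑ d : P.D, hh (P.deg (P.src d)) = 6 * n - 6 := by
  have h1 : ∑ d : P.D, hh (P.deg (P.src d)) = ∑ v : P.V, (3 * (P.deg v : ℚ) - 6) := by
    rw [← Finset.sum_fiberwise' (Finset.univ) P.src (fun v => hh (P.deg v))]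
    apply Finset.sum_congr rfl
    intro v _
    rw [Finset.sum_const]
    change (P.deg v) • _ = _
    obtain ⟨d, rfl⟩ := P.hdeg v
    have : (1 : ℚ) ≤ P.deg (P.src d) := by exact_mod_cast one_le_deg d
    rw [nsmul_eq_mul, hh]
    grind
  rw [h1, Finset.sum_sub_distrib, ← Finset.mul_sum]
  have h2 : ∑ v : P.V, (P.deg v : ℚ) = Fintype.card P.D := by
    rw [← Nat.cast_sum]
    congr 1
    rw [← Finset.card_univ, Finset.card_eq_sum_card_fiberwise (f := P.src) (t := Finset.univ) (by simp)]
    rfl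
  rw [h2]
  have := P.euler
  have h3 : (2 * Fintype.card P.V + 2 * n : ℚ) = Fintype.card P.D + 2 := by exact_mod_cast this
  simp
  linarith
lemma sum_faces (p : P.D → Prop) [DecidablePred p] : ∑ f ∈ Finset.Icc 1 n, (Finset.univ.filter fun d => P.fc d = f ∧ p d).card
    = (Finset.univ.filter fun d => P.fc d ≠ 0 ∧ p d).card := by
  rw [Finset.card_eq_sum_card_fiberwise (f := P.fc) (t := Finset.Icc 1 n)]
  · apply Finset.sum_congr rfl
    intro f hf
    congr 1
    grind
  · intro d hd
    have := P.fc_le d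
    grind
lemma curv_pt (hR : ∀ r ∈ R, CyclicallyReduced r) (d : P.D) : 2 * hh (P.deg (P.src d)) ≥
      (if P.fc d ≠ 0 ∧ (P.fc (P.rev d) = 0 ∧ P.st d) then (2 : ℚ) else 0) +
      (if P.fc d ≠ 0 ∧ (P.fc (P.rev d) ≠ 0 ∧ P.st d) then (2 : ℚ) else 0) +
      (if P.fc d ≠ 0 ∧ (P.st d ∧ 4 ≤ P.deg (P.src d)) then (1 : ℚ) else 0) +
      (if P.fc (P.prv d) = 0 ∧ P.fc (P.rev (P.prv d)) ≠ 0 ∧ P.st (P.rev (P.prv d)) then (2 : ℚ) else 0)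
        - (if P.fc d = 0 ∧ P.deg (P.src d) = 1 then (6 : ℚ) else 0) := by
  rw [fc_prv]
  by_cases h0 : P.fc d = 0
  · simp only [h0, ne_eq, not_true_eq_false, false_and, if_false, true_and]
    by_cases h4 : ¬ P.fc (P.rev (P.prv d)) = 0 ∧ P.st (P.rev (P.prv d))
    · have h5 := three_le_deg h4.2
      have h6 : P.src (P.rev (P.prv d)) = P.src d := src_sg d
      rw [h6] at h5
      have h7 : ¬ P.deg (P.src d) = 1 := by omega
      have := hh_three h5
      grind
    · rw [if_neg h4]
      by_cases h8 : P.deg (P.src d) = 1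
      · rw [if_pos h8, h8, hh_one]; norm_num
      · have := one_le_deg d
        have := hh_two (k := P.deg (P.src d)) (by omega)
        grind
  · simp only [h0, ne_eq, not_false_eq_true, true_and, false_and, if_false]
    by_cases hs : P.st d
    · have h5 := three_le_deg hs
      have := hh_three h5
      simp only [hs, and_true, true_and]
      by_cases h4 : 4 ≤ P.deg (P.src d)
      · have := hh_four h4
        grind
      grind
    · have := hh_two (two_le_deg hR h0)
      grind
lemma sum_ind (p : P.D → Prop) [DecidablePred p] (c : ℚ) : ∑ d : P.D, (if p d then c else 0) =
    (Finset.univ.filter p).card * c := by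
  rw [← Finset.sum_filter, Finset.sum_const, nsmul_eq_mul]
theorem curv (P : Pl R n w) (hR : ∀ r ∈ R, CyclicallyReduced r) :
    (12 : ℤ) - 6 * P.spurs ≤ ∑ f ∈ Finset.Icc 1 n, (12 - 4 * P.eN f - 2 * P.iN f - P.hN f : ℤ) := by
  have key := Finset.sum_le_sum (s := Finset.univ) (fun d _ => curv_pt (P := P) hR d)
  simp only [Finset.sum_sub_distrib, Finset.sum_add_distrib, sum_ind, ← Finset.mul_sum] at key
  rw [sum_hh] at key
  have e1 : ∑ f ∈ Finset.Icc 1 n, P.eN f = _ := sum_faces _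
  have e2 : ∑ f ∈ Finset.Icc 1 n, P.iN f = _ := sum_faces _
  have e3 : ∑ f ∈ Finset.Icc 1 n, P.hN f = _ := sum_faces _
  have e4 : P.spurs = _ := rfl
  rw [← e1, ← e2, ← e3] at key
  have e6 : (Finset.univ.filter fun d => P.fc (P.prv d) = 0 ∧ P.fc (P.rev (P.prv d)) ≠ 0 ∧
      P.st (P.rev (P.prv d))).card = ∑ f ∈ Finset.Icc 1 n, P.eN f := by
    rw [e1]
    apply Finset.card_bij (fun d _ => P.rev (P.prv d))
    · intro d hd
      rw [Finset.mem_filter] at hd ⊢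
      exact ⟨Finset.mem_univ _, hd.2.2.1, by rw [P.rev_rev]; exact hd.2.1, hd.2.2.2⟩
    · intro a _ b _ h
      exact sg_inj h
    · intro d hd
      rw [Finset.mem_filter] at hd
      refine ⟨P.nxt (P.rev d), ?_, by rw [prv_nxt, P.rev_rev]⟩
      rw [Finset.mem_filter, prv_nxt, P.rev_rev]
      grind
  rw [e6] at key
  change _ ≤ _ at key
  have e7 : (Finset.univ.filter fun d => P.fc d = 0 ∧ P.deg (P.src d) = 1).card = P.spurs := rfl
  rw [e7] at key
  have e5 : ∑ f ∈ Finset.Icc 1 n, (12 - 4 * P.eN f - 2 * P.iN f - P.hN f : ℤ) =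
      12 * n - 4 * (∑ f ∈ Finset.Icc 1 n, P.eN f : ℕ) - 2 * (∑ f ∈ Finset.Icc 1 n, P.iN f : ℕ)
       - (∑ f ∈ Finset.Icc 1 n, P.hN f : ℕ) := by
    push_cast
    simp only [Finset.sum_sub_distrib, ← Finset.mul_sum]
    simp
    ring
  rw [e5]
  generalize ∑ f ∈ Finset.Icc 1 n, P.eN f = a at *
  generalize ∑ f ∈ Finset.Icc 1 n, P.iN f = b at *
  generalize ∑ f ∈ Finset.Icc 1 n, P.hN f = c at *
  generalize P.spurs = s at *
  have : ((12 : ℤ) - 6 * s : ℚ) ≤ (12 * n - 4 * a - 2 * b - c : ℤ) := by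
    push_cast; linarith
  exact_mod_cast this
end Pl
end P4
end MorseLTG
open Metric Set Filter
namespace MorseLTG
noncomputable section P5
local notation "oo" => (by omega)
open scoped Classical
variable {S : Type*} {R : Set (Word S)} {n : ℕ} {w : Word S}
lemma count_runs {α : Type*} (T A : Finset α) (p : α → α) (B : ℕ)
    (inj : ∀ a ∈ T, a ∉ A → ∀ b ∈ T, b ∉ A → p a = p b → a = b)
    (run : ∀ d ∈ T, ∃ k < B, p^[k] d ∈ A ∧ ∀ j < k, p^[j] d ∈ T ∧ p^[j] d ∉ A) :
    T.card ≤ B * A.card := by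
  choose! k hk hA hj using run
  have h1 : ∀ m a b, (∀ j < m, p^[j] a ∈ T ∧ p^[j] a ∉ A) → (∀ j < m, p^[j] b ∈ T ∧ p^[j] b ∉ A) →
      p^[m] a = p^[m] b → a = b := by
    intro m
    induction m with
    | zero => intro a b _ _ h; exact h
    | succ m ih =>
      intro a b ha hb h
      rw [Function.iterate_succ_apply', Function.iterate_succ_apply'] at h
      have := inj _ (ha m oo).1 (ha m oo).2 _ (hb m oo).1 (hb m oo).2 h
      exact ih a b (fun j hj => ha j oo) (fun j hj => hb j oo) this
  have := Finset.card_le_card_of_injOn (s := T) (t := Finset.range B ×ˢ A) (fun d => (k d, p^[k d] d))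
    (by
      intro d hd
      simp only [Finset.coe_product, Set.mem_prod, Finset.mem_coe, Finset.mem_range]
      exact ⟨hk d hd, hA d hd⟩)
    (by
      intro a ha b hb h
      simp only [Prod.mk.injEq] at h
      have h2 := h.2
      rw [← h.1] at h2
      have h3 := hj b hb
      rw [← h.1] at h3
      exact h1 _ a b (hj a ha) h3 h2)
  simpa using this
lemma piece_bound (hsc : SmallCancellation R (1 / 6)) {r₁ r₂ : Word S} (h1 : r₁ ∈ symmClosure R)
    (h2 : r₂ ∈ symmClosure R) (hne : r₁ ≠ r₂) (e1 : 0 < r₁.length) (e2 : 0 < r₂.length) (m : ℕ)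
    (hag : ∀ j < m, j < r₁.length → j < r₂.length → r₁[j]? = r₂[j]?) : 6 * m < r₁.length := by
  rcases Nat.eq_zero_or_pos m with rfl | hm
  · simpa using e1
  set l := min m (min r₁.length r₂.length) with hl
  have ht : r₁.take l = r₂.take l := by
    apply List.ext_getElem?
    intro j
    rw [List.getElem?_take, List.getElem?_take]
    split
    · exact hag j oo oo oo
    · rfl
  have hlen : (r₁.take l).length = l := by simp; omega
  have hp : IsPiece R (r₁.take l) := by
    refine ⟨?_, r₁, h1, r₂, h2, hne, List.take_prefix _ _, ?_⟩
    · intro h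
      have := congrArg List.length h
      rw [hlen] at this
      simp at this
      omega
    · rw [ht]; exact List.take_prefix _ _
  have a1 := hsc.2 r₁ h1 _ hp (List.take_prefix _ _).isInfix
  have a2 := hsc.2 r₂ h2 _ hp (by rw [ht]; exact (List.take_prefix _ _).isInfix)
  rw [hlen] at a1 a2
  have a1' : 6 * l < r₁.length := by
    have : (6 * l : ℝ) < r₁.length := by linarith
    exact_mod_cast this
  grind
namespace Pl
variable (P : Pl R n w)
def cS (f : ℕ) (T : P.D → Prop) : Finset P.D := Finset.univ.filter fun d => P.fc d = f ∧ T d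
def cN (f : ℕ) (T : P.D → Prop) : ℕ := (P.cS f T).card
lemma mem_cS {f : ℕ} {T : P.D → Prop} {d : P.D} : d ∈ P.cS f T ↔ P.fc d = f ∧ T d := by
  unfold cS; rw [Finset.mem_filter]; simp
def ext (d : P.D) : Prop := P.fc (P.rev d) = 0
lemma eN_eq (f : ℕ) : P.eN f = P.cN f (fun d => P.ext d ∧ P.st d) := by
  unfold eN cN cS ext; congr!
lemma iN_eq (f : ℕ) : P.iN f = P.cN f (fun d => ¬ P.ext d ∧ P.st d) := by
  unfold iN cN cS ext; congr!
lemma hN_eq (f : ℕ) : P.hN f = P.cN f (fun d => P.st d ∧ 4 ≤ P.deg (P.src d)) := by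
  unfold hN cN cS; congr!
variable {P}
lemma cN_mono {f : ℕ} {T U : P.D → Prop} (h : ∀ d, P.fc d = f → T d → U d) : P.cN f T ≤ P.cN f U := by
  unfold cN cS
  apply Finset.card_le_card
  grind
lemma cN_congr {f : ℕ} {T U : P.D → Prop} (h : ∀ d, P.fc d = f → (T d ↔ U d)) : P.cN f T = P.cN f U :=
  le_antisymm (cN_mono fun d h1 h2 => (h d h1).1 h2) (cN_mono fun d h1 h2 => (h d h1).2 h2)
lemma cN_split {f : ℕ} (T U : P.D → Prop) :
    P.cN f T = P.cN f (fun d => T d ∧ U d) + P.cN f (fun d => T d ∧ ¬ U d) := by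
  unfold cN cS
  rw [← Finset.card_filter_add_card_filter_not (s := Finset.univ.filter fun d => P.fc d = f ∧ T d) U,
    Finset.filter_filter, Finset.filter_filter]
  grind
lemma cN_pos {f : ℕ} {T : P.D → Prop} : 0 < P.cN f T ↔ ∃ d, P.fc d = f ∧ T d := by
  unfold cN cS
  rw [Finset.card_pos]
  constructor
  · grind
  · rintro ⟨d, hd⟩
    exact ⟨d, Finset.mem_filter.2 ⟨Finset.mem_univ _, hd⟩⟩
lemma cN_zero {f : ℕ} {T : P.D → Prop} (h : P.cN f T = 0) {d : P.D} (hd : P.fc d = f) : ¬ T d := by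
  intro h2
  have := cN_pos.2 ⟨d, hd, h2⟩
  omega
lemma cN_one {f : ℕ} {T : P.D → Prop} (h : P.cN f T ≤ 1) {a b : P.D} (ha : P.fc a = f) (hb : P.fc b = f)
    (h1 : T a) (h2 : T b) : a = b :=
  Finset.card_le_one.1 h a ((mem_cS P).2 ⟨ha, h1⟩) b ((mem_cS P).2 ⟨hb, h2⟩)
lemma cN_or {f : ℕ} (T U : P.D → Prop) : P.cN f (fun d => T d ∨ U d) ≤ P.cN f T + P.cN f U := by
  unfold cN cS
  refine le_trans (Finset.card_le_card ?_) (Finset.card_union_le _ _)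
  grind
lemma fc_iter_prv (d : P.D) (k : ℕ) : P.fc (P.prv^[k] d) = P.fc d := by
  induction k with
  | zero => rfl
  | succ k ih => rw [Function.iterate_succ_apply', fc_prv, ih]
lemma nxt_prv_iter (d : P.D) : ∀ k, P.nxt^[k] (P.prv^[k] d) = d := by
  intro k
  induction k generalizing d with
  | zero => rfl
  | succ k ih => rw [Function.iterate_succ_apply, Function.iterate_succ_apply', nxt_prv, ih]
lemma nxt_prv_iter' (d : P.D) (j k : ℕ) (h : j ≤ k) : P.nxt^[j] (P.prv^[k] d) = P.prv^[k - j] d := by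
  obtain ⟨m, rfl⟩ := Nat.exists_eq_add_of_le h
  rw [Function.iterate_add_apply, nxt_prv_iter]; congr 1; omega
lemma prv_nxt_iter (d : P.D) : ∀ k, P.prv^[k] (P.nxt^[k] d) = d := by
  intro k
  induction k generalizing d with
  | zero => rfl
  | succ k ih => rw [Function.iterate_succ_apply, Function.iterate_succ_apply', prv_nxt, ih]
lemma cN_all (d : P.D) : P.cN (P.fc d) (fun _ => True) = P.len (P.fc d) := by
  have h := Finset.card_image_of_injOn (s := Finset.range (P.len (P.fc d))) (f := fun k => P.nxt^[k] d)
    (by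
      intro i hi j hj h
      simp only [Finset.coe_range, Set.mem_Iio] at hi hj
      exact P.inj d i hi j hj h)
  rw [Finset.card_range] at h
  rw [← h]
  unfold cN cS
  congr 1
  ext x
  simp only [and_true, Finset.mem_filter, Finset.mem_univ, true_and, Finset.mem_image, Finset.mem_range]
  constructor
  · intro hx
    exact P.orb d x hx.symm
  · rintro ⟨k, _, rfl⟩
    exact fc_iter d k
lemma cN_all' {f : ℕ} (h1 : 1 ≤ f) (h2 : f ≤ n) : P.cN f (fun _ => True) = P.len f := by
  obtain ⟨d, rfl⟩ := P.surj f h1 h2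
  exact cN_all d
theorem count_face {f B : ℕ} (T A : P.D → Prop)
    (hp : ∀ d, P.fc d = f → T d → ¬ A d → T (P.prv d))
    (run : ∀ d m, P.fc d = f → T d → (∀ j, 0 < j → j < m → T (P.nxt^[j] d) ∧ ¬ A (P.nxt^[j] d)) → m ≤ B) :
    P.cN f T ≤ B * P.cN f (fun d => T d ∧ A d) := by
  unfold cN
  apply count_runs _ _ P.prv
  · intro a _ _ b _ _ h
    exact P.nxt.symm.injective h
  · intro d hd
    rw [mem_cS] at hd
    obtain ⟨hf, hT⟩ := hd
    have hall : ∀ k, (∀ j < k, ¬ A (P.prv^[j] d)) → T (P.prv^[k] d) := by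
      intro k
      induction k with
      | zero => intro _; exact hT
      | succ k ih =>
        intro h
        rw [Function.iterate_succ_apply']
        exact hp _ (by rw [fc_iter_prv, hf]) (ih fun j hj => h j oo) (h k oo)
    have hrun : ∀ k, (∀ j < k, ¬ A (P.prv^[j] d)) → k + 1 ≤ B := by
      intro k hk
      apply run (P.prv^[k] d) (k + 1) (by rw [fc_iter_prv, hf]) (hall k hk)
      intro j h0 hj
      rw [nxt_prv_iter' _ _ _ oo]
      grind
    have hex : ∃ k, A (P.prv^[k] d) := by
      by_contra hno
      push Not at hno
      have := hrun B fun j _ => hno j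
      omega
    refine ⟨Nat.find hex, ?_, ?_, ?_⟩
    · simp_all
    · rw [mem_cS]
      exact ⟨by rw [fc_iter_prv, hf], hall _ fun j hj => Nat.find_min hex hj, Nat.find_spec hex⟩
    · intro j hj
      rw [mem_cS, mem_cS]
      have h1 := hall j fun i hi => Nat.find_min hex (hi.trans hj)
      refine ⟨⟨by rw [fc_iter_prv, hf], h1⟩, fun h => Nat.find_min hex hj h.2.2⟩
lemma fc_rev_prv {d : P.D} (h : ¬ P.st d) : P.fc (P.rev (P.prv d)) = P.fc (P.rev d) := by
  rw [← not_st h, P.fc_nxt]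
lemma ext_prv {d : P.D} (h : ¬ P.st d) : P.ext (P.prv d) ↔ P.ext d := by
  unfold ext; rw [fc_rev_prv h]
lemma rev_run {d : P.D} {m : ℕ} (h : ∀ j, 0 < j → j < m → ¬ P.st (P.nxt^[j] d)) :
    ∀ j, j < m → P.nxt^[j] (P.rev (P.nxt^[j] d)) = P.rev d := by
  intro j
  induction j with
  | zero => intro _; rfl
  | succ j ih =>
    intro hj
    have h1 := not_st (h (j + 1) oo hj)
    rw [Function.iterate_succ_apply, h1]
    rw [Function.iterate_succ_apply' P.nxt j d, prv_nxt]
    grind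
lemma iter_per (d : P.D) (k : ℕ) (h : k ≤ P.len (P.fc d)) {x : P.D} (hx : P.nxt^[k] x = d) :
    x = P.nxt^[P.len (P.fc d) - k] d := by
  have h1 : P.fc x = P.fc d := by rw [← hx, fc_iter]
  have := P.per x
  rw [h1, show P.len (P.fc d) = (P.len (P.fc d) - k) + k by omega, Function.iterate_add_apply, hx] at this
  grind
lemma wd_cons (d : P.D) : P.wd d = P.lab d :: (P.wd d).tail := by
  have h := wd_len d
  have h2 := P.hlen d
  rcases hw : P.wd d with _ | ⟨a, l⟩
  · grind
  · have := wd_get d 0 oo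
    simp_all
theorem int_run (hsc : SmallCancellation R (1 / 6)) {d : P.D} (h0 : P.fc d ≠ 0) (he : ¬ P.ext d) (m : ℕ)
    (h : ∀ j, 0 < j → j < m → ¬ P.st (P.nxt^[j] d)) : 6 * m < P.len (P.fc d) := by
  have hm := wd_mem' (P.rev d) he
  have hred : (P.wd d).tail ≠ wordInv (P.wd (P.rev d)).tail := P.red d h0 he
  have h2 : P.lab d :: wordInv (P.wd (P.rev d)).tail ∈ symmClosure R := by
    have := sc_inv hm
    rw [wd_cons (P.rev d), P.lab_rev] at this
    rw [wordInv_eq, List.map_cons, List.reverse_cons, ← wordInv_eq] at this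
    have h3 := sc_comm this
    simp_all
  have hl1 := wd_len d
  have hl2 := wd_len (P.rev d)
  have hL1 := P.hlen d
  have hL2 := P.hlen (P.rev d)
  rw [← wd_len]
  apply piece_bound hsc (wd_mem' d h0) h2
  · grind
  · omega
  · simp
  · intro j hj hj1 hj2
    rcases j with _ | j
    · rw [wd_cons d]; rfl
    · simp only [List.length_cons, wordInv_eq, List.length_reverse, List.length_map, List.length_tail] at hj2
      rw [List.getElem?_eq_getElem hj1, wd_get]
      rw [List.getElem?_cons_succ, wordInv_eq, List.getElem?_reverse (by simp; omega)]
      simp only [List.getElem?_map, List.length_map, List.length_tail]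
      rw [List.getElem?_tail, List.getElem?_eq_getElem oo, wd_get]
      have h5 := rev_run h (j + 1) hj
      have h6 := iter_per (P.rev d) (j + 1) oo h5
      have h7 : (P.wd (P.rev d)).length - 1 - 1 - j + 1 = P.len (P.fc (P.rev d)) - (j + 1) := by omega
      rw [h7, ← h6, P.lab_rev]
      simp_all
theorem int_count (hsc : SmallCancellation R (1 / 6)) {f : ℕ} (hf : f ≠ 0) :
    P.cN f (fun d => ¬ P.ext d) ≤ (P.len f - 1) / 6 * P.iN f := by
  rw [iN_eq]
  apply count_face
  · intro d _ h1 h2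
    rwa [ext_prv h2]
  · rintro d m rfl h1 h2
    have := int_run hsc hf h1 m fun j h3 h4 => (h2 j h3 h4).2
    omega
end Pl
end P5
end MorseLTG
open Metric Set Filter
namespace MorseLTG
noncomputable section P5b
local notation "oo" => (by omega)
open scoped Classical
variable {S : Type*} {R : Set (Word S)} {n : ℕ} {w : Word S}
def SimpleW (R : Set (Word S)) (w : Word S) : Prop :=
  (∀ i < w.length, ∀ j < w.length, evalWord (presGen R) (w.take i) = evalWord (presGen R) (w.take j) → i = j) ∧
  ∀ x, w ≠ [x, linv x]
def GeoSide (R : Set (Word S)) (w : Word S) (lo hi : ℕ) : Prop :=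
  ∀ i j, lo ≤ i → i ≤ j → j ≤ hi → ∀ u : Word S,
    evalWord (presGen R) (w.take j) = evalWord (presGen R) (w.take i) * evalWord (presGen R) u → j ≤ i + u.length
namespace Pl
variable (P : Pl R n w)
def ix (d : P.D) : ℕ := if h : P.fc (P.rev d) = 0 then (P.out_surj d h).choose else 0
def sd (lo hi : ℕ) (d : P.D) : Prop := P.ext d ∧ lo ≤ P.ix d ∧ P.ix d < hi
variable {P}
lemma ix_lt {d : P.D} (h : P.ext d) : P.ix d < w.length := by
  unfold ix; rw [dif_pos (show P.fc (P.rev d) = 0 from h)]; exact (P.out_surj d h).choose_spec.1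
lemma out_ix {d : P.D} (h : P.ext d) : P.out (P.ix d) = d := by
  unfold ix; rw [dif_pos (show P.fc (P.rev d) = 0 from h)]; exact (P.out_surj d h).choose_spec.2
lemma ext_out (i : ℕ) : P.ext (P.out i) := P.out_fc i
lemma ix_out {i : ℕ} (h : i < w.length) : P.ix (P.out i) = i :=
  P.out_inj _ (ix_lt (ext_out i)) _ h (out_ix (ext_out i))
lemma prv_out {i : ℕ} (h : ¬ P.st (P.out (i + 1))) : P.prv (P.out (i + 1)) = P.out i := by
  have h1 := not_st h
  rw [P.out_nxt] at h1
  exact (rev_inj h1).symm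
lemma st_out_of {i : ℕ} (h : P.prv (P.out (i + 1)) = P.out i) : ¬ P.st (P.out (i + 1)) := by
  apply not_st_of
  rw [P.out_nxt, h]
lemma prv_ext {d : P.D} (he : P.ext d) (hs : ¬ P.st d) (h0 : 0 < P.ix d) :
    P.prv d = P.out (P.ix d - 1) ∧ P.ix (P.prv d) = P.ix d - 1 := by
  have h1 := out_ix he
  have h2 : P.prv d = P.out (P.ix d - 1) := by
    conv_lhs => rw [← h1]
    rw [show P.ix d = P.ix d - 1 + 1 by omega] at h1 ⊢
    rw [prv_out (by grind)]; rfl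
  refine ⟨h2, ?_⟩
  rw [h2, ix_out]
  have := ix_lt he
  omega
lemma out_mod (i : ℕ) : P.out (i % w.length) = P.out i := by
  have : ∀ k i, P.out (i + k * w.length) = P.out i := by
    intro k
    induction k with
    | zero => intro i; simp
    | succ k ih => intro i; rw [add_mul, one_mul, ← add_assoc, P.out_per, ih]
  conv_rhs => rw [← Nat.mod_add_div i w.length, mul_comm, this]
lemma pos_out (i : ℕ) (h : i ≤ w.length) :
    P.pos (P.src (P.out i)) = P.pos (P.src (P.out 0)) * evalWord (presGen R) (w.take i) := by
  induction i with
  | zero => simp [evalWord]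
  | succ i ih =>
    rw [P.out_src, P.hpos, ih oo, P.out_lab i oo, List.take_succ_eq_append_getElem oo,
      evalWord_append, mul_assoc]
lemma pos_inj (hs : SimpleW R w) {i j : ℕ} (hi : i < w.length) (hj : j < w.length)
    (h : P.src (P.out i) = P.src (P.out j)) : i = j := by
  apply hs.1 i hi j hj
  have := congrArg P.pos h
  rw [pos_out i hi.le, pos_out j hj.le] at this
  simp_all
lemma no_bridge (hs : SimpleW R w) (hw : w ≠ []) (i : ℕ) : P.fc (P.out i) ≠ 0 := by
  have hl : 0 < w.length := List.length_pos_iff.2 hw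
  have main : ∀ i < w.length, P.fc (P.out i) ≠ 0 := by
    intro i hi h0
    have he : P.ext (P.rev (P.out i)) := by unfold ext; rw [P.rev_rev]; exact h0
    obtain ⟨j, hj, hje⟩ := P.out_surj _ he
    have h1 : (i + 1) % w.length = j := by
      apply pos_inj (P := P) hs (Nat.mod_lt _ hl) hj
      rw [out_mod, P.out_src, hje]
    have h2 : (j + 1) % w.length = i := by
      apply pos_inj (P := P) hs (Nat.mod_lt _ hl) hi
      rw [out_mod, P.out_src, hje, P.rev_rev]
    have hne : i ≠ j := by
      rintro rfl
      exact P.rev_ne _ hje.symm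
    have hl2 : w.length = 2 := by
      rcases Nat.lt_or_ge (i + 1) w.length with h3 | h3
      · rw [Nat.mod_eq_of_lt h3] at h1
        rcases Nat.lt_or_ge (j + 1) w.length with h4 | h4
        · rw [Nat.mod_eq_of_lt h4] at h2; omega
        · rw [show j + 1 = w.length by omega, Nat.mod_self] at h2; omega
      · rw [show i + 1 = w.length by omega, Nat.mod_self] at h1
        rcases Nat.lt_or_ge (j + 1) w.length with h4 | h4
        · rw [Nat.mod_eq_of_lt h4] at h2; omega
        · omega
    have hlab : P.lab (P.out j) = linv (P.lab (P.out i)) := by rw [hje, P.lab_rev]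
    rw [P.out_lab i hi, P.out_lab j hj] at hlab
    have key : ∀ (w : Word S) (hi : i < w.length) (hj : j < w.length), w.length = 2 → w[j] = linv w[i] →
        ∃ x, w = [x, linv x] := by
      intro w hi hj hl2 hlab
      obtain ⟨x, y, rfl⟩ := List.length_eq_two.1 hl2
      simp only [List.length_cons, List.length_nil] at hi hj
      refine ⟨x, ?_⟩
      rcases i with _ | _ | i
      · rcases j with _ | _ | j
        · omega
        · simpa using hlab
        · omega
      · rcases j with _ | _ | j
        · simp only [List.getElem_cons_zero, zero_add, List.getElem_cons_succ] at hlab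
          rw [hlab]; simp [linv]
        · omega
        · omega
      · omega
    obtain ⟨x, hx⟩ := key w hi hj hl2 hlab
    exact hs.2 x hx
  rw [← out_mod]
  exact main _ (Nat.mod_lt _ hl)
lemma no_bridge' (hs : SimpleW R w) (hw : w ≠ []) {d : P.D} (h : P.ext d) : P.fc d ≠ 0 := by
  rw [← out_ix h]; exact no_bridge hs hw _
lemma no_spurs (hs : SimpleW R w) (hw : w ≠ []) : P.spurs = 0 := by
  unfold spurs
  rw [Finset.card_eq_zero, Finset.filter_eq_empty_iff]
  rintro d - ⟨h0, h1⟩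
  unfold deg at h1
  have h2 : P.sg d = d := Finset.card_le_one.1 h1.le _ (by simp [src_sg]) _ (by simp)
  have h3 : P.ext d := by
    unfold ext; rw [← h2, sg, P.rev_rev, fc_prv, h0]
  exact no_bridge' hs hw h3 h0
lemma st_ext (hs : SimpleW R w) (hw : w ≠ []) {d : P.D} (h : P.ext d) : P.st d ↔ ¬ P.ext (P.prv d) := by
  have hl : 0 < w.length := List.length_pos_iff.2 hw
  constructor
  · intro h1 h2
    have h3 : P.src (P.out (P.ix (P.prv d) + 1)) = P.src d := by
      rw [P.out_src, out_ix h2, ← P.src_nxt, nxt_prv]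
    have h4 : (P.ix (P.prv d) + 1) % w.length = P.ix d := by
      apply pos_inj (P := P) hs (Nat.mod_lt _ hl) (ix_lt h)
      rw [out_mod, h3, out_ix h]
    have h5 : d = P.out (P.ix (P.prv d) + 1) := by rw [← out_mod, h4, out_ix h]
    have h6 := st_out_of (P := P) (i := P.ix (P.prv d)) (by rw [← h5, out_ix h2])
    grind
  · intro h1
    by_contra h2
    exact h1 ((ext_prv h2).2 h)
lemma cN_prv {f : ℕ} (T : P.D → Prop) : P.cN f (fun d => T (P.prv d)) = P.cN f T := by
  unfold cN
  apply Finset.card_bij (fun d _ => P.prv d)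
  · intro d hd
    rw [mem_cS] at hd ⊢
    exact ⟨by rw [fc_prv]; exact hd.1, hd.2⟩
  · intro a _ b _ h
    exact P.nxt.symm.injective h
  · intro d hd
    rw [mem_cS] at hd
    exact ⟨P.nxt d, by rw [mem_cS, prv_nxt, P.fc_nxt]; exact hd, prv_nxt d⟩
lemma iN_eN (hs : SimpleW R w) (hw : w ≠ []) (f : ℕ) :
    P.iN f = P.eN f + P.cN f (fun d => (¬ P.ext d ∧ P.st d) ∧ ¬ P.ext (P.prv d)) := by
  rw [iN_eq, cN_split _ (fun d => P.ext (P.prv d)), eN_eq]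
  congr 1
  have h1 := cN_split (P := P) (f := f) (fun d => P.ext d) (fun d => P.ext (P.prv d))
  have h2 := cN_split (P := P) (f := f) (fun d => P.ext (P.prv d)) (fun d => P.ext d)
  rw [cN_prv (fun d => P.ext d)] at h2
  have h3 : P.cN f (fun d => P.ext d ∧ P.ext (P.prv d)) = P.cN f (fun d => P.ext (P.prv d) ∧ P.ext d) :=
    cN_congr fun d _ => by tauto
  have h4 : P.cN f (fun d => P.ext d ∧ P.st d) = P.cN f (fun d => P.ext d ∧ ¬ P.ext (P.prv d)) :=
    cN_congr fun d _ => ⟨fun h => ⟨h.1, (st_ext hs hw h.1).1 h.2⟩, fun h => ⟨h.1, (st_ext hs hw h.1).2 h.2⟩⟩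
  have h5 : P.cN f (fun d => (¬ P.ext d ∧ P.st d) ∧ P.ext (P.prv d)) =
      P.cN f (fun d => P.ext (P.prv d) ∧ ¬ P.ext d) := by
    apply cN_congr
    intro d _
    constructor
    · grind
    · rintro ⟨a, b⟩
      refine ⟨⟨b, ?_⟩, a⟩
      by_contra h
      exact b ((ext_prv h).1 a)
  omega
lemma pos_iter (d : P.D) (k : ℕ) : ∃ u : Word S, u.length = k ∧
    P.pos (P.src (P.nxt^[k] d)) = P.pos (P.src d) * evalWord (presGen R) u := by
  induction k with
  | zero => exact ⟨[], rfl, by simp [evalWord]⟩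
  | succ k ih =>
    obtain ⟨u, h1, h2⟩ := ih
    refine ⟨u ++ [P.lab (P.nxt^[k] d)], by simp [h1], ?_⟩
    rw [Function.iterate_succ_apply', P.src_nxt, P.hpos, h2, evalWord_append, mul_assoc]
lemma pos_face {a b : P.D} (h : P.fc a = P.fc b) : ∃ u : Word S, 2 * u.length ≤ P.len (P.fc a) ∧
    P.pos (P.src b) = P.pos (P.src a) * evalWord (presGen R) u := by
  obtain ⟨k, hk, hab⟩ := P.orb a b h
  rcases Nat.lt_or_ge (P.len (P.fc a)) (2 * k) with h1 | h1
  · obtain ⟨u, hu, hp⟩ := pos_iter b (P.len (P.fc a) - k)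
    have : P.nxt^[P.len (P.fc a) - k] b = a := by
      rw [← hab, ← Function.iterate_add_apply, Nat.sub_add_cancel hk.le, P.per]
    rw [this] at hp
    refine ⟨wordInv u, by rw [wordInv_eq]; simp; omega, ?_⟩
    simp_all
  · obtain ⟨u, hu, hp⟩ := pos_iter a k
    grind
lemma geo_half {lo hi : ℕ} (hg : GeoSide R w lo hi) (hhi : hi ≤ w.length) {f : ℕ} :
    2 * P.cN f (P.sd lo hi) ≤ P.len f := by
  by_cases h0 : ∃ d, P.fc d = f ∧ P.sd lo hi d
  swap
  · have := mt cN_pos.1 h0; omega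
  have hne : (P.cS f (P.sd lo hi)).Nonempty := by
    obtain ⟨d, h⟩ := h0; exact ⟨d, (mem_cS P).2 h⟩
  obtain ⟨a, ha, hamin⟩ := Finset.exists_min_image _ P.ix hne
  obtain ⟨b, hb, hbmax⟩ := Finset.exists_max_image _ P.ix hne
  have h1 : P.cN f (P.sd lo hi) ≤ (Finset.Icc (P.ix a) (P.ix b)).card := by
    apply Finset.card_le_card_of_injOn P.ix
    · intro d hd
      grind
    · intro x hx y hy h
      have hx := ((mem_cS P).1 hx).2.1
      have hy := ((mem_cS P).1 hy).2.1
      rw [← out_ix hx, ← out_ix hy, h]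
  rw [Nat.card_Icc] at h1
  rw [mem_cS] at ha hb
  have hab := hamin b ((mem_cS P).2 hb)
  obtain ⟨u, hu, hp⟩ := pos_face (P := P) (a := a) (b := P.nxt b) (by rw [P.fc_nxt, ha.1, hb.1])
  have e1 : P.src (P.nxt b) = P.src (P.out (P.ix b + 1)) := by
    rw [P.src_nxt, P.out_src, out_ix hb.2.1]
  have e2 : P.src a = P.src (P.out (P.ix a)) := by rw [out_ix ha.2.1]
  have := ix_lt hb.2.1
  have := ix_lt ha.2.1
  rw [e1, e2, pos_out (P.ix b + 1) oo, pos_out (P.ix a) oo, mul_assoc] at hp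
  have h3 := hg (P.ix a) (P.ix b + 1) ha.2.2.1 oo (by have := hb.2.2.2; omega) u (mul_left_cancel hp)
  grind
lemma sd_prv {lo hi : ℕ} {d : P.D} (h : P.sd lo hi d) (hs : ¬ (P.st d ∨ P.ix d = lo)) :
    P.sd lo hi (P.prv d) := by
  push Not at hs
  obtain ⟨h1, h2, h3⟩ := h
  have h4 := prv_ext h1 hs.1 oo
  refine ⟨(ext_prv hs.1).2 h1, ?_, ?_⟩ <;> omega
lemma sd_run {lo hi : ℕ} {d : P.D} (h : P.sd lo hi d) {m : ℕ}
    (hm : ∀ j, 0 < j → j < m → P.sd lo hi (P.nxt^[j] d) ∧ ¬ (P.st (P.nxt^[j] d) ∨ P.ix (P.nxt^[j] d) = lo)) :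
    ∀ j, j < m → P.ix (P.nxt^[j] d) = P.ix d + j ∧ P.nxt^[j] d = P.out (P.ix d + j) := by
  have h1 : ∀ j, j < m → P.ix (P.nxt^[j] d) = P.ix d + j := by
    intro j
    induction j with
    | zero => intro _; rfl
    | succ j ih =>
      intro hj
      obtain ⟨h1, h2⟩ := hm (j + 1) oo hj
      push Not at h2
      have h3 := (prv_ext h1.1 h2.1 (by have := h1.2.1; omega)).2
      have h4 := ih oo
      have h5 : P.prv (P.nxt^[j + 1] d) = P.nxt^[j] d := by rw [Function.iterate_succ_apply', prv_nxt]
      rw [h5, h4] at h3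
      have := h1.2.1
      omega
  intro j hj
  refine ⟨h1 j hj, ?_⟩
  rw [← h1 j hj, out_ix]
  rcases Nat.eq_zero_or_pos j with rfl | h0
  · exact h.1
  · exact (hm j h0 hj).1.1
theorem greendlinger (P : Pl R n w) (hsc : SmallCancellation R (1 / 6)) (hs : SimpleW R w) (hw : w ≠ []) :
    ∃ k u t v, w.rotate k = u ++ v ∧ u ++ t ∈ symmClosure R ∧ t.length < u.length := by
  have hcurv := P.curv hsc.1
  rw [no_spurs hs hw] at hcurv
  obtain ⟨f, hf, hpos⟩ : ∃ f ∈ Finset.Icc 1 n, (0 : ℤ) < 12 - 4 * P.eN f - 2 * P.iN f - P.hN f := by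
    by_contra hno
    push Not at hno
    have := Finset.sum_nonpos hno
    omega
  rw [Finset.mem_Icc] at hf
  have hie := iN_eN (P := P) hs hw f
  have hint := int_count (P := P) hsc (f := f) oo
  have hall := cN_all' (P := P) hf.1 hf.2
  have hlen : 0 < P.len f := by
    obtain ⟨d, rfl⟩ := P.surj f hf.1 hf.2
    exact P.hlen d
  have hsplit := cN_split (P := P) (f := f) (fun _ => True) (fun d => ¬ P.ext d)
  simp only [true_and, not_not] at hsplit
  obtain ⟨a, c, ha, hae, hcl, hrun, hc⟩ : ∃ a c, P.fc a = f ∧ P.ext a ∧ c ≤ P.len f ∧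
      (∀ j, 0 < j → j < c → P.ext (P.nxt^[j] a) ∧ ¬ P.st (P.nxt^[j] a)) ∧ P.len f < 2 * c := by
    by_cases he0 : P.eN f = 0
    · rw [eN_eq] at he0
      have hex : 0 < P.cN f (fun d => P.ext d) := by
        have : P.iN f ≤ 5 := by omega
        have := Nat.mul_le_mul_left ((P.len f - 1) / 6) this
        omega
      obtain ⟨a, ha, hae⟩ := cN_pos.1 hex
      have hpr : ∀ k, P.ext (P.prv^[k] a) := by
        intro k
        induction k with
        | zero => exact hae
        | succ k ih =>
          rw [Function.iterate_succ_apply']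
          have := cN_zero he0 (d := P.prv^[k] a) (by rw [fc_iter_prv, ha])
          exact (ext_prv fun h => this ⟨ih, h⟩).2 ih
      have hallx : ∀ d, P.fc d = f → P.ext d := by
        intro d hd
        obtain ⟨k, _, hk⟩ := P.orb d a oo
        have := hpr k
        rwa [← hk, prv_nxt_iter] at this
      refine ⟨a, P.len f, ha, hae, le_rfl, ?_, by omega⟩
      intro j _ _
      have h1 : P.fc (P.nxt^[j] a) = f := by rw [fc_iter, ha]
      exact ⟨hallx _ h1, fun h => cN_zero he0 h1 ⟨hallx _ h1, h⟩⟩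
    · have he1 : P.eN f = 1 := by omega
      have hi3 : P.iN f ≤ 3 := by omega
      have he1' := he1
      rw [eN_eq] at he1'
      obtain ⟨a, ha, hae, hast⟩ := cN_pos.1 (show 0 < P.cN f (fun d => P.ext d ∧ P.st d) by omega)
      have hust : ∀ k, 0 < k → k < P.len f → P.ext (P.nxt^[k] a) → ¬ P.st (P.nxt^[k] a) := by
        intro k h0 hk h1 h2
        have := cN_one he1'.le (a := a) (b := P.nxt^[k] a) ha (by rw [fc_iter, ha]) ⟨hae, hast⟩ ⟨h1, h2⟩
        have := P.inj a 0 (by grind) k (by rw [ha]; exact hk) (by simpa using this)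
        omega
      have hex : ∃ c, c = P.len f ∨ ¬ P.ext (P.nxt^[c] a) := ⟨_, Or.inl rfl⟩
      have hcl : Nat.find hex ≤ P.len f := Nat.find_min' hex (Or.inl rfl)
      have hbef : ∀ j < Nat.find hex, P.ext (P.nxt^[j] a) := by
        intro j hj
        have := Nat.find_min hex hj
        grind
      have haft : ∀ k, Nat.find hex ≤ k → k < P.len f → ¬ P.ext (P.nxt^[k] a) := by
        intro k hk
        induction k, hk using Nat.le_induction with
        | base =>
          grind
        | succ k hk ih =>
          intro h h1
          have := hust (k + 1) oo h h1
          have h2 := (ext_prv this).2 h1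
          rw [Function.iterate_succ_apply', prv_nxt] at h2
          grind
      refine ⟨a, Nat.find hex, ha, hae, hcl, fun j h0 hj => ⟨hbef j hj, hust j h0 oo (hbef j hj)⟩, ?_⟩
      have hle : P.cN f (fun d => P.ext d) ≤ Nat.find hex := by
        have : P.cS f (fun d => P.ext d) ⊆ (Finset.range (Nat.find hex)).image fun k => P.nxt^[k] a := by
          intro d hd
          rw [mem_cS] at hd
          obtain ⟨k, hk, hkd⟩ := P.orb a d oo
          grind
        refine (Finset.card_le_card this).trans (Finset.card_image_le.trans ?_)
        simp
      have := Nat.mul_le_mul_left ((P.len f - 1) / 6) hi3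
      omega
  have hout : ∀ j, j < c → P.nxt^[j] a = P.out (P.ix a + j) := by
    intro j
    induction j with
    | zero => intro _; exact (out_ix hae).symm
    | succ j ih =>
      intro hj
      obtain ⟨h1, h2⟩ := hrun (j + 1) oo hj
      have h3 := ih oo
      have h4 := not_st h2
      rw [Function.iterate_succ_apply', prv_nxt, h3, ← P.out_nxt] at h4
      rw [Function.iterate_succ_apply', h3]
      exact rev_inj (P.nxt.injective h4)
  have hcw : c ≤ w.length := by
    have h1 : ((Finset.range c).image fun k => P.nxt^[k] a).card = c := by
      rw [Finset.card_image_of_injOn, Finset.card_range]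
      intro i hi j hj h
      simp only [Finset.coe_range, Set.mem_Iio] at hi hj
      exact P.inj a i (by grind) j (by rw [ha]; omega) h
    rw [← h1]
    have h2 : ((Finset.range c).image fun k => P.nxt^[k] a) ⊆ (Finset.range w.length).image P.out := by
      intro d hd
      obtain ⟨k, hk, rfl⟩ := Finset.mem_image.1 hd
      rw [Finset.mem_range] at hk
      refine Finset.mem_image.2 ⟨(P.ix a + k) % w.length, ?_, by simp only [out_mod, hout k hk]⟩
      rw [Finset.mem_range]
      exact Nat.mod_lt _ (List.length_pos_iff.2 hw)
    refine (Finset.card_le_card h2).trans (Finset.card_image_le.trans ?_)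
    simp
  have hwl := wd_len a
  rw [ha] at hwl
  refine ⟨P.ix a, (w.rotate (P.ix a)).take c, (P.wd a).drop c, (w.rotate (P.ix a)).drop c,
    (List.take_append_drop _ _).symm, ?_, ?_⟩
  · have : (w.rotate (P.ix a)).take c = (P.wd a).take c := by
      apply List.ext_getElem
      · simp; omega
      · intro j h1 h2
        rw [List.getElem_take, List.getElem_take, wd_get]
        simp only [List.length_take, List.length_rotate] at h1
        rw [hout j oo, ← out_mod, P.out_lab _ (Nat.mod_lt _ (List.length_pos_iff.2 hw)),
          List.getElem_rotate]
        grind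
    rw [this, List.take_append_drop]
    exact wd_mem' a oo
  · simp; omega
end Pl
end P5b
end MorseLTG
open Metric Set Filter
namespace MorseLTG
noncomputable section P6
local notation "oo" => (by omega)
open scoped Classical
variable {S : Type*} {R : Set (Word S)} {n : ℕ} {w : Word S}
lemma exists_pl (hR : ∀ r ∈ R, CyclicallyReduced r) (hw : w ≠ []) {m : ℕ} (h : DG R m w) :
    ∃ n ≤ m, DG R n w ∧ Nonempty (Pl R n w) := by
  have hex : ∃ n, DG R n w := ⟨m, h⟩
  obtain ⟨K⟩ := DG.toKm hR (Nat.find_spec hex)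
  exact ⟨Nat.find hex, Nat.find_min' hex h, Nat.find_spec hex, K.toPl hw fun k hk => Nat.find_min hex hk⟩
def Rlt (R : Set (Word S)) (N : ℕ) : Set (Word S) := {r | r ∈ R ∧ r.length < N}
lemma Rlt_sub (R : Set (Word S)) (N : ℕ) : Rlt R N ⊆ R := fun _ h => h.1
lemma sc_sub {R' : Set (Word S)} (h : R' ⊆ R) (hsc : SmallCancellation R (1 / 6)) :
    SmallCancellation R' (1 / 6) := by
  refine ⟨fun r hr => hsc.1 r (h hr), fun r hr p hp hpr => hsc.2 r (sc_mono h hr) p ?_ hpr⟩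
  obtain ⟨h0, r1, h1, r2, h2, h3⟩ := hp
  exact ⟨h0, r1, sc_mono h h1, r2, sc_mono h h2, h3⟩
lemma null_sub {R' : Set (Word S)} (h : R' ⊆ R) (hw : evalWord (presGen R') w = 1) :
    evalWord (presGen R) w = 1 := by
  obtain ⟨n, hn⟩ := null_DG hw
  have : DG R n w := by
    clear hw
    induction hn with
    | nil => exact DG.nil
    | face ht _ ih => exact DG.face (sc_mono h ht) ih
    | bridge _ _ h1 h2 => exact DG.bridge h1 h2
  exact this.null
lemma eval_sub {R' : Set (Word S)} (h : R' ⊆ R) {u v : Word S}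
    (hw : evalWord (presGen R') u = evalWord (presGen R') v) :
    evalWord (presGen R) u = evalWord (presGen R) v := by
  have := null_sub (w := wordInv u ++ v) h (by simp [hw])
  rw [evalWord_append, evalWord_inv] at this
  exact (inv_mul_eq_one.1 this)
lemma simple_sub {R' : Set (Word S)} (h : R' ⊆ R) (hs : SimpleW R w) : SimpleW R' w :=
  ⟨fun i hi j hj he => hs.1 i hi j hj (eval_sub h he), hs.2⟩
lemma geo_sub {R' : Set (Word S)} (h : R' ⊆ R) {lo hi : ℕ} (hs : GeoSide R w lo hi) : GeoSide R' w lo hi := by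
  intro i j h1 h2 h3 u hu
  apply hs i j h1 h2 h3 u
  rw [← evalWord_append] at hu ⊢
  exact eval_sub h hu
lemma null_rot (k : ℕ) (h : evalWord (presGen R) (w.rotate k) = 1) : evalWord (presGen R) w = 1 := by
  obtain ⟨m, hm, e⟩ : ∃ m ≤ w.length, w.rotate k = w.rotate m := by
    rcases Nat.eq_zero_or_pos w.length with h | h
    · simp_all
    · exact ⟨k % w.length, (Nat.mod_lt _ h).le, (List.rotate_mod w k).symm⟩
  rw [e, List.rotate_eq_drop_append_take hm, evalWord_append] at h
  rw [← List.take_append_drop m w, evalWord_append]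
  exact mul_eq_one_comm.1 h
lemma null_rot' (k : ℕ) (h : evalWord (presGen R) w = 1) : evalWord (presGen R) (w.rotate k) = 1 := by
  obtain ⟨m, hm, e⟩ : ∃ m ≤ w.length, w.rotate k = w.rotate m := by
    rcases Nat.eq_zero_or_pos w.length with h | h
    · simp_all
    · exact ⟨k % w.length, (Nat.mod_lt _ h).le, (List.rotate_mod w k).symm⟩
  rw [e, List.rotate_eq_drop_append_take hm, evalWord_append]
  rw [← List.take_append_drop m w, evalWord_append] at h
  exact mul_eq_one_comm.1 h
lemma split3 (w : Word S) {i j : ℕ} (hij : i ≤ j) (hj : j ≤ w.length) :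
    ∃ a b c, w = a ++ b ++ c ∧ a.length = i ∧ b.length = j - i ∧ w.take i = a ∧ w.take j = a ++ b := by
  have h1 : w.take j = w.take i ++ (w.drop i).take (j - i) := by
    rw [← List.take_add, Nat.add_sub_cancel' hij]
  refine ⟨w.take i, (w.drop i).take (j - i), w.drop j, ?_, by simp; omega, by simp; omega, rfl, h1⟩
  rw [← h1, List.take_append_drop]
lemma not_simple (hw : w ≠ []) (h : ¬ SimpleW R w) : (∃ x, w = [x, linv x]) ∨
    ∃ a b c, w = a ++ b ++ c ∧ b ≠ [] ∧ a ++ c ≠ [] ∧ evalWord (presGen R) b = 1 ∧ c ≠ [] := by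
  unfold SimpleW at h
  rw [not_and_or] at h
  rcases h with h | h
  · right
    push Not at h
    obtain ⟨i, hi, j, hj, he, hne⟩ := h
    wlog hij : i < j generalizing i j
    · grind
    obtain ⟨a, b, c, h1, h2, h3, h4, h5⟩ := split3 w hij.le hj.le
    have hl := congrArg List.length h1
    simp only [List.length_append] at hl
    have hc : c ≠ [] := by grind
    refine ⟨a, b, c, h1, ?_, ?_, ?_, hc⟩
    · grind
    · grind
    simp_all
  grind
theorem dehn (hsc : SmallCancellation R (1 / 6)) (L : ℕ) : ∀ k, ∀ w : Word S, w.length = k → k ≤ L →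
    evalWord (presGen R) w = 1 → evalWord (presGen (Rlt R (2 * L))) w = 1 := by
  intro k
  induction k using Nat.strong_induction_on with
  | _ k ih =>
    intro w hk hL hn
    by_cases hw : w = []
    · simp_all
    by_cases hs : SimpleW R w
    · obtain ⟨m, hm⟩ := null_DG hn
      obtain ⟨n, _, _, ⟨P⟩⟩ := exists_pl hsc.1 hw hm
      obtain ⟨j, u, t, v, h1, h2, h3⟩ := P.greendlinger hsc hs hw
      have hl := congrArg List.length h1
      simp only [List.length_rotate, List.length_append] at hl
      have hn' := null_rot' j hn
      rw [h1] at hn'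
      have h4 : u ++ t ∈ symmClosure (Rlt R (2 * L)) := by
        obtain ⟨r, hr, i, hi⟩ := h2
        refine ⟨r, ⟨hr, ?_⟩, i, hi⟩
        have : r.length = (u ++ t).length := by rcases hi with hi | hi <;> simp [hi]
        rw [this]; simp; omega
      have h5 := eval_sc h2
      have h6 := eval_sc h4
      have h7 := ih (wordInv t ++ v).length (by simp; omega) _ rfl (by simp; omega) (by
        simp only [evalWord_append, evalWord_inv] at *
        rw [← eq_inv_of_mul_eq_one_left h5]; exact hn')
      apply null_rot j
      rw [h1]
      simp only [evalWord_append, evalWord_inv] at *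
      rw [eq_inv_of_mul_eq_one_left h6]; exact h7
    · rcases not_simple hw hs with ⟨x, rfl⟩ | ⟨a, b, c, rfl, hb, hac, hbn, -⟩
      · rw [evalWord_cons, evalWord_linv]; group
      · have hb' := List.length_pos_iff.2 hb
        have hac' := List.length_pos_iff.2 hac
        simp only [List.length_append] at hk hac'
        have h1 := ih b.length oo b rfl oo hbn
        have h2 := ih (a ++ c).length (by simp; omega) _ rfl (by simp; omega) (by
          simp only [evalWord_append, hbn, mul_one] at hn ⊢; exact hn)
        simp_all
theorem exists_pl' (hsc : SmallCancellation R (1 / 6)) (hw : w ≠ []) (h : evalWord (presGen R) w = 1) :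
    ∃ n, Nonempty (Pl (Rlt R (2 * w.length)) n w) := by
  obtain ⟨m, hm⟩ := null_DG (dehn hsc w.length _ w rfl le_rfl h)
  obtain ⟨n, _, _, h⟩ := exists_pl (sc_sub (Rlt_sub _ _) hsc).1 hw hm
  grind
namespace Pl
variable {P : Pl R n w}
lemma len_lt {N : ℕ} {P : Pl (Rlt R N) n w} (d : P.D) (h : P.fc d ≠ 0) : P.len (P.fc d) < N := by
  obtain ⟨r, hr, hl⟩ := sc_len (wd_mem' d h)
  rw [← wd_len, ← hl]; exact hr.2
lemma side_pos {lo hi : ℕ} {d : P.D} (h : P.sd lo hi d) :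
    ∃ d', P.fc d' = P.fc d ∧ P.sd lo hi d' ∧ (P.st d' ∨ P.ix d' = lo) := by
  have hne : (P.cS (P.fc d) (P.sd lo hi)).Nonempty := ⟨d, (mem_cS P).2 ⟨rfl, h⟩⟩
  obtain ⟨a, ha, hamin⟩ := Finset.exists_min_image _ P.ix hne
  rw [mem_cS] at ha
  refine ⟨a, ha.1, ha.2, ?_⟩
  by_contra hno
  have h1 := sd_prv ha.2 hno
  have h2 := hamin (P.prv a) ((mem_cS P).2 ⟨by rw [fc_prv, ha.1], h1⟩)
  push Not at hno
  have h3 := prv_ext ha.2.1 hno.1 (by have := ha.2.2.1; omega)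
  have := ha.2.2.1
  omega
lemma side_count {lo hi f B : ℕ}
    (run : ∀ a m, P.fc a = f → P.sd lo hi a → 0 < m →
      (∀ j < m, P.nxt^[j] a = P.out (P.ix a + j) ∧ P.ix a + j < hi) → m ≤ B) :
    P.cN f (P.sd lo hi) ≤ B * P.cN f (fun d => P.sd lo hi d ∧ (P.st d ∨ P.ix d = lo)) := by
  apply count_face
  · intro d _ h1 h2
    exact sd_prv h1 h2
  · intro d m h1 h2 h3
    rcases Nat.eq_zero_or_pos m with rfl | hm
    · omega
    apply run d m h1 h2 hm
    intro j hj
    have h4 := sd_run h2 h3 j hj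
    refine ⟨h4.2, ?_⟩
    rw [← h4.1]
    rcases Nat.eq_zero_or_pos j with rfl | h0
    · exact h2.2.2
    · exact (h3 j h0 hj).1.2.2
def mkd (P : Pl R n w) (M : Finset ℕ) (f : ℕ) : ℕ := P.cN f (fun d => P.ext d ∧ ¬ P.st d ∧ P.ix d ∈ M)
lemma st_mk (M : Finset ℕ) (f : ℕ) :
    P.cN f (fun d => P.ext d ∧ (P.st d ∨ P.ix d ∈ M)) = P.eN f + P.mkd M f := by
  rw [eN_eq, mkd, cN_split (fun d => P.ext d ∧ (P.st d ∨ P.ix d ∈ M)) P.st]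
  grind
lemma sum_cN (T : P.D → Prop) (A : Finset ℕ) (hT : ∀ d, P.fc d ≠ 0 → T d → P.ext d ∧ P.ix d ∈ A) :
    ∑ f ∈ Finset.Icc 1 n, P.cN f T ≤ A.card := by
  unfold cN cS
  refine (le_of_eq (P.sum_faces T)).trans ?_
  apply Finset.card_le_card_of_injOn P.ix
  · intro d hd
    grind
  · intro x hx y hy h
    rw [Finset.mem_coe, Finset.mem_filter] at hx hy
    rw [← out_ix (hT x hx.2.1 hx.2.2).1, ← out_ix (hT y hy.2.1 hy.2.2).1, h]
lemma sum_mk (M : Finset ℕ) : ∑ f ∈ Finset.Icc 1 n, P.mkd M f ≤ M.card := by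
  exact sum_cN _ M fun d _ h => ⟨h.1, h.2.2⟩
lemma curv_marks (hR : ∀ r ∈ R, CyclicallyReduced r) (hs : SimpleW R w) (hw : w ≠ []) (M : Finset ℕ)
    (hM : M.card ≤ 2)
    (h : ∀ f ∈ Finset.Icc 1 n, 12 ≤ 4 * P.cN f (fun d => P.ext d ∧ (P.st d ∨ P.ix d ∈ M)) + 2 * P.iN f) :
    False := by
  have hc := P.curv hR
  rw [no_spurs hs hw] at hc
  have h2 : ∑ f ∈ Finset.Icc 1 n, (12 - 4 * P.eN f - 2 * P.iN f - P.hN f : ℤ) ≤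
      ∑ f ∈ Finset.Icc 1 n, ((4 * P.mkd M f : ℕ) : ℤ) := by
    apply Finset.sum_le_sum
    intro f hf
    have := h f hf
    rw [st_mk] at this
    push_cast
    omega
  rw [← Nat.cast_sum, ← Finset.mul_sum] at h2
  have := P.sum_mk M
  omega
lemma run_piece (hsc : SmallCancellation R (1 / 6)) {R' : Set (Word S)} (hR' : R' ⊆ R) {P : Pl R' n w}
    {v c z : Word S} (hw : w = v ++ z) (hv : v ++ c ∈ symmClosure R) {a : P.D} {m : ℕ} (h0 : P.fc a ≠ 0)
    (hm : 0 < m) (hne : P.wd a ≠ (v ++ c).rotate (P.ix a))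
    (h : ∀ j < m, P.nxt^[j] a = P.out (P.ix a + j) ∧ P.ix a + j < v.length) : 6 * m < P.len (P.fc a) := by
  rw [← wd_len]
  have hl := P.hlen a
  have hv0 := (h 0 hm).2
  apply piece_bound hsc (sc_mono hR' (wd_mem' a h0)) (sc_rot hv (P.ix a)) hne
  · rw [wd_len]; exact hl
  · simp; omega
  · intro j hj h1 h2
    rw [List.getElem?_eq_getElem h1, List.getElem?_eq_getElem h2, wd_get, List.getElem_rotate]
    obtain ⟨h3, h4⟩ := h j hj
    subst hw
    rw [h3, P.out_lab _ (by simp; omega)]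
    congr 1
    rw [List.getElem_append_left h4]
    have : (j + P.ix a) % (v ++ c).length = P.ix a + j := by
      rw [Nat.mod_eq_of_lt (by simp; omega)]; omega
    simp only [this]
    rw [List.getElem_append_left h4]
end Pl
lemma cx0 (hsc : SmallCancellation R (1 / 6)) : ∀ k, ∀ a b : Word S, a.length = k → a ++ b ∈ symmClosure R →
    a ≠ [] → b ≠ [] → evalWord (presGen R) a ≠ 1 := by
  intro k
  induction k using Nat.strong_induction_on with
  | _ k ih =>
    intro a b hk hab ha hb hn
    have hle : a.length ≤ b.length := by
      by_contra hlt
      have h1 := eval_sc hab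
      rw [evalWord_append, hn, one_mul] at h1
      exact ih b.length oo b a rfl (sc_comm hab) hb ha h1
    have hs : SimpleW R a := by
      by_contra hs
      rcases not_simple ha hs with ⟨x, rfl⟩ | ⟨a1, a2, a3, rfl, h1, h2, h3, -⟩
      · have := sc_red hsc.1 hab 0
        exact red_pair (u := []) (a := x) (v := b) (by simpa using this)
      · have hb' := List.length_pos_iff.2 h2
        simp only [List.length_append] at hk hb'
        refine ih a2.length oo a2 (a3 ++ b ++ a1) rfl ?_ h1 (by simp [hb]) h3
        have := sc_comm (u := a1) (v := a2 ++ a3 ++ b) (by simpa using hab)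
        simpa using this
    obtain ⟨n, ⟨P⟩⟩ := exists_pl' hsc ha hn
    have hsub := Rlt_sub R (2 * a.length)
    apply Pl.curv_marks (P := P) (sc_sub hsub hsc).1 (simple_sub hsub hs) ha {0} (by simp)
    intro f hf
    rw [Finset.mem_Icc] at hf
    have h1 := Pl.int_count (P := P) (sc_sub hsub hsc) (f := f) oo
    have h2 := Pl.side_count (P := P) (lo := 0) (hi := a.length) (f := f) (B := (P.len f - 1) / 6) (by
      rintro d m rfl h2 hm h3
      have hf0 : P.fc d ≠ 0 := by omega
      have := Pl.run_piece hsc hsub (P := P) (z := []) (by simp) hab hf0 hm (by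
        intro h4
        have h5 := Pl.len_lt d hf0
        have h6 := congrArg List.length h4
        rw [Pl.wd_len] at h6
        simp at h6
        omega) h3
      omega)
    have h3 := Pl.cN_all' (P := P) hf.1 hf.2
    have h4 := Pl.cN_split (P := P) (f := f) (fun _ => True) (fun d => ¬ P.ext d)
    simp only [true_and, not_not] at h4
    have h5 : P.cN f (fun d => P.ext d) = P.cN f (P.sd 0 a.length) :=
      Pl.cN_congr fun d _ => ⟨fun h => ⟨h, by omega, Pl.ix_lt h⟩, fun h => h.1⟩
    have h6 : P.cN f (fun d => P.sd 0 a.length d ∧ (P.st d ∨ P.ix d = 0)) =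
        P.cN f (fun d => P.ext d ∧ (P.st d ∨ P.ix d ∈ ({0} : Finset ℕ))) :=
      Pl.cN_congr fun d _ => by
        simp only [Finset.mem_singleton]
        exact ⟨fun h => ⟨h.1.1, h.2⟩, fun h => ⟨⟨h.1, by omega, Pl.ix_lt h.1⟩, h.2⟩⟩
    have hlen : 0 < P.len f := by
      obtain ⟨d, rfl⟩ := P.surj f hf.1 hf.2
      exact P.hlen d
    rw [h6] at h2
    by_contra hlt
    have h7 : P.cN f (fun d => P.ext d ∧ (P.st d ∨ P.ix d ∈ ({0} : Finset ℕ))) + P.iN f ≤ 6 := by omega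
    have h8 := Nat.mul_le_mul_left ((P.len f - 1) / 6) h7
    grind
end P6
end MorseLTG
open Metric Set Filter
namespace MorseLTG
noncomputable section P6b
local notation "oo" => (by omega)
open scoped Classical
variable {S : Type*} {R : Set (Word S)} {n : ℕ} {w : Word S}
lemma cx_simple (hsc : SmallCancellation R (1 / 6)) {a b s : Word S} (hs0 : s ≠ [])
    (ih : ∀ m < s.length, ∀ a b t : Word S, t.length = m → a ++ b ∈ symmClosure R →
      evalWord (presGen R) t = evalWord (presGen R) a → m < a.length → m < b.length → False)
    (hab : a ++ b ∈ symmClosure R) (he : evalWord (presGen R) s = evalWord (presGen R) a)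
    (h1 : s.length < a.length) (h2 : s.length < b.length) : SimpleW R (a ++ wordInv s) := by
  have hs1 := List.length_pos_iff.2 hs0
  constructor
  swap
  · intro x hx
    have := congrArg List.length hx
    simp at this; omega
  suffices H : ∀ i j, i < j → j < (a ++ wordInv s).length →
      evalWord (presGen R) ((a ++ wordInv s).take i) = evalWord (presGen R) ((a ++ wordInv s).take j) → False by
    grind
  intro i j hij hj heq
  simp only [List.length_append, wordInv_length] at hj
  rcases Nat.lt_or_ge a.length j with hja | hja
  · rcases Nat.lt_or_ge i a.length with hia | hia
    · -- mixed
      have e1 : (a ++ wordInv s).take i = a.take i := List.take_append_of_le_length hia.le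
      have e2 : (a ++ wordInv s).take j = a ++ (wordInv s).take (j - a.length) := by
        rw [List.take_append, List.take_of_length_le hja.le]
      rw [e1, e2, evalWord_append] at heq
      set a1 := a.take i
      set a2 := a.drop i
      set s1 := (wordInv s).take (j - a.length)
      set s2 := (wordInv s).drop (j - a.length)
      have ha : a = a1 ++ a2 := (List.take_append_drop _ _).symm
      have hs : wordInv s = s1 ++ s2 := (List.take_append_drop _ _).symm
      have l1 : a1.length = i := by simp [a1]; omega
      have l2 : a2.length = a.length - i := by simp [a2]
      have l3 : s1.length = j - a.length := by simp [s1]; omega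
      have l4 : s2.length = s.length - (j - a.length) := by simp [s2]
      have hs' := congrArg (evalWord (presGen R)) hs
      rw [evalWord_inv, he, evalWord_append] at hs'
      have ha' := congrArg (evalWord (presGen R)) ha
      rw [evalWord_append] at ha'
      rw [ha'] at heq hs'
      have hab1 : a1 ++ (a2 ++ b) ∈ symmClosure R := by grind
      have hab2 : a2 ++ (b ++ a1) ∈ symmClosure R := by
        have := sc_comm hab1; rwa [List.append_assoc] at this
      have q2 : evalWord (presGen R) (wordInv s1) = evalWord (presGen R) a2 := by
        rw [evalWord_inv, inv_eq_iff_mul_eq_one]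
        rw [mul_assoc, left_eq_mul] at heq
        exact mul_eq_one_comm.1 heq
      have q1 : evalWord (presGen R) (wordInv s2) = evalWord (presGen R) a1 := by
        rw [evalWord_inv, inv_eq_iff_mul_eq_one]
        rw [evalWord_inv] at q2
        rw [← q2] at hs'
        rw [mul_inv_rev, inv_inv, mul_left_cancel_iff] at hs'
        rw [← hs']; group
      rcases Nat.lt_or_ge s1.length a2.length with h3 | h3
      · exact ih s1.length oo a2 (b ++ a1) (wordInv s1) (by simp) hab2 q2 h3 (by simp; omega)
      · exact ih s2.length oo a1 (a2 ++ b) (wordInv s2) (by simp) hab1 q1 oo (by simp; omega)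
    · -- both on s
      have e1 : (a ++ wordInv s).take i = a ++ (wordInv s).take (i - a.length) := by
        rw [List.take_append, List.take_of_length_le hia]
      have e2 : (a ++ wordInv s).take j = a ++ (wordInv s).take (j - a.length) := by
        rw [List.take_append, List.take_of_length_le hja.le]
      rw [e1, e2, evalWord_append, evalWord_append, mul_left_cancel_iff] at heq
      have h3 : evalWord (presGen R) ((wordInv s).take (i - a.length) ++ (wordInv s).drop (j - a.length)) =
          evalWord (presGen R) (wordInv s) := by
        conv_rhs => rw [← List.take_append_drop (j - a.length) (wordInv s)]
        rw [evalWord_append, evalWord_append, heq]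
      refine ih ((wordInv s).take (i - a.length) ++ (wordInv s).drop (j - a.length)).length ?_ a b
        (wordInv ((wordInv s).take (i - a.length) ++ (wordInv s).drop (j - a.length))) (wordInv_length _) hab ?_ ?_ ?_
      · simp; omega
      · rw [evalWord_inv, h3, evalWord_inv, inv_inv, he]
      · simp; omega
      · simp; omega
  · -- both on a
    have e1 : (a ++ wordInv s).take i = a.take i := List.take_append_of_le_length oo
    have e2 : (a ++ wordInv s).take j = a.take j := List.take_append_of_le_length oo
    rw [e1, e2] at heq
    obtain ⟨x, y, z, h3, h4, h5, h6, h7⟩ := split3 a hij.le hja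
    rw [h6, h7, evalWord_append, left_eq_mul] at heq
    refine cx0 hsc y.length y (z ++ b ++ x) rfl ?_ ?_ ?_ heq
    · rw [h3] at hab
      have := sc_comm (u := x) (v := y ++ z ++ b) (by simpa using hab)
      grind
    · rw [← List.length_pos_iff]; omega
    · rw [← List.length_pos_iff]; simp; omega
lemma cx_geo {a b s : Word S}
    (ih : ∀ m < s.length, ∀ a b t : Word S, t.length = m → a ++ b ∈ symmClosure R →
      evalWord (presGen R) t = evalWord (presGen R) a → m < a.length → m < b.length → False)
    (hab : a ++ b ∈ symmClosure R) (he : evalWord (presGen R) s = evalWord (presGen R) a)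
    (h1 : s.length < a.length) (h2 : s.length < b.length) :
    GeoSide R (a ++ wordInv s) a.length (a ++ wordInv s).length := by
  intro i j hi hij hj u hu
  simp only [List.length_append, wordInv_length] at hj
  by_contra hlt
  have e1 : (a ++ wordInv s).take i = a ++ (wordInv s).take (i - a.length) := by
    rw [List.take_append, List.take_of_length_le hi]
  have e2 : (a ++ wordInv s).take j = a ++ (wordInv s).take (j - a.length) := by
    rw [List.take_append, List.take_of_length_le (hi.trans hij)]
  rw [e1, e2, evalWord_append, evalWord_append, mul_assoc, mul_left_cancel_iff] at hu
  have h3 : evalWord (presGen R) ((wordInv s).take (i - a.length) ++ u ++ (wordInv s).drop (j - a.length)) =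
      evalWord (presGen R) (wordInv s) := by
    conv_rhs => rw [← List.take_append_drop (j - a.length) (wordInv s)]
    rw [evalWord_append, evalWord_append, evalWord_append, hu]
  refine ih ((wordInv s).take (i - a.length) ++ u ++ (wordInv s).drop (j - a.length)).length ?_ a b
    (wordInv ((wordInv s).take (i - a.length) ++ u ++ (wordInv s).drop (j - a.length)))
    (wordInv_length _) hab ?_ ?_ ?_
  · simp; omega
  · rw [evalWord_inv, h3, evalWord_inv, inv_inv, he]
  · simp; omega
  · simp; omega
lemma cx_step (hsc : SmallCancellation R (1 / 6)) {s : Word S} (hs0 : s ≠ [])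
    (ih : ∀ m < s.length, ∀ a b t : Word S, t.length = m → a ++ b ∈ symmClosure R →
      evalWord (presGen R) t = evalWord (presGen R) a → m < a.length → m < b.length → False) :
    ∀ n, ∀ a b : Word S, DG R n (a ++ wordInv s) → a ++ b ∈ symmClosure R →
    evalWord (presGen R) s = evalWord (presGen R) a → s.length < a.length → s.length < b.length → False := by
  intro N
  induction N using Nat.strong_induction_on with
  | _ N ihn =>
    intro a b hDG hab he h1 h2
    have hs1 := List.length_pos_iff.2 hs0
    have hsim := cx_simple hsc hs0 ih hab he h1 h2
    have hgeo := cx_geo ih hab he h1 h2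
    have hw : a ++ wordInv s ≠ [] := by grind
    obtain ⟨n, hnN, -, ⟨P⟩⟩ := exists_pl hsc.1 hw hDG
    have hab' : wordInv b ++ wordInv a ∈ symmClosure R := by simpa using sc_inv hab
    have he' : evalWord (presGen R) s = evalWord (presGen R) (wordInv b) := by
      rw [he, evalWord_inv, eq_inv_iff_mul_eq_one, ← evalWord_append]; exact eval_sc hab
    have mirror : ∀ d, P.fc d ≠ 0 → P.ext d → P.ix d < a.length → P.wd d ≠ (a ++ b).rotate (P.ix d) := by
      intro d h0 hd hia heq
      obtain ⟨k, hk, hD⟩ := P.drop (P.ix d) (by simp; omega) (by rw [Pl.out_ix hd]; exact h0)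
      rw [Pl.out_ix hd] at hD
      change DG R k (_ ++ wordInv (P.wd d).tail ++ _) at hD
      rw [heq] at hD
      set p := P.ix d
      have e2 : (a ++ b).rotate p = a[p] :: (a.drop (p + 1) ++ b ++ a.take p) := by
        rw [List.rotate_eq_drop_append_take (by simp; omega), List.drop_append_of_le_length hia.le,
          List.take_append_of_le_length hia.le, List.drop_eq_getElem_cons hia]
        rfl
      rw [e2, List.tail_cons, List.take_append_of_le_length oo, List.drop_append_of_le_length oo] at hD
      obtain ⟨k1, hk1, hD1⟩ := DG.cancelR (R := R) (a.take p) (n := k) (U := [])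
        (V := wordInv b ++ wordInv (a.drop (p + 1)) ++ a.drop (p + 1) ++ wordInv s) (by simpa using hD)
      obtain ⟨k2, hk2, hD2⟩ := DG.cancelL (R := R) (a.drop (p + 1)) (n := k1) (U := wordInv b)
        (V := wordInv s) (by grind)
      exact ihn k2 oo (wordInv b) (wordInv a) hD2 hab' he' (by simpa using h2) (by simpa using h1)
    apply Pl.curv_marks (P := P) hsc.1 hsim hw {0, a.length} Finset.card_le_two
    intro f hf
    rw [Finset.mem_Icc] at hf
    have q1 := Pl.int_count (P := P) hsc (f := f) oo
    have q2 := Pl.side_count (P := P) (lo := 0) (hi := a.length) (f := f) (B := (P.len f - 1) / 6) (by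
      rintro d m rfl h2 hm h3
      have hf0 : P.fc d ≠ 0 := by omega
      have := Pl.run_piece hsc (subset_refl R) (P := P) (z := wordInv s) rfl hab hf0 hm
        (mirror d hf0 h2.1 h2.2.2) h3
      omega)
    have q3 := Pl.cN_all' (P := P) hf.1 hf.2
    have q4 := Pl.cN_split (P := P) (f := f) (fun _ => True) (fun d => ¬ P.ext d)
    simp only [true_and, not_not] at q4
    have q5 := Pl.cN_split (P := P) (f := f) (fun d => P.ext d) (fun d => P.ix d < a.length)
    have q6 : P.cN f (fun d => P.ext d ∧ P.ix d < a.length) = P.cN f (P.sd 0 a.length) :=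
      Pl.cN_congr fun d _ => ⟨fun h => ⟨h.1, by omega, h.2⟩, fun h => ⟨h.1, h.2.2⟩⟩
    have q7 : P.cN f (fun d => P.ext d ∧ ¬ P.ix d < a.length) =
        P.cN f (P.sd a.length (a ++ wordInv s).length) :=
      Pl.cN_congr fun d _ => ⟨fun h => ⟨h.1, by omega, Pl.ix_lt h.1⟩, fun h => ⟨h.1, by have := h.2.1; omega⟩⟩
    have q8 := Pl.cN_split (P := P) (f := f)
      (fun d => P.ext d ∧ (P.st d ∨ P.ix d ∈ ({0, a.length} : Finset ℕ))) (fun d => P.ix d < a.length)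
    have q9 : P.cN f (fun d => P.sd 0 a.length d ∧ (P.st d ∨ P.ix d = 0)) ≤
        P.cN f (fun d => (P.ext d ∧ (P.st d ∨ P.ix d ∈ ({0, a.length} : Finset ℕ))) ∧ P.ix d < a.length) :=
      Pl.cN_mono fun d _ h => ⟨⟨h.1.1, h.2.imp id fun h => by simp [h]⟩, h.1.2.2⟩
    have q10 := Pl.geo_half (P := P) hgeo le_rfl (f := f)
    have hlen : 0 < P.len f := by
      obtain ⟨d, rfl⟩ := P.surj f hf.1 hf.2
      exact P.hlen d
    set B := (P.len f - 1) / 6 with hB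
    set ev := P.cN f (fun d => P.sd 0 a.length d ∧ (P.st d ∨ P.ix d = 0))
    by_cases hz : P.cN f (P.sd a.length (a ++ wordInv s).length) = 0
    · by_contra hlt
      have h7 : ev + P.iN f ≤ 6 := by omega
      have h8 := Nat.mul_le_mul_left B h7
      grind
    · obtain ⟨d, hd1, hd2⟩ := Pl.cN_pos.1 (Nat.pos_of_ne_zero hz)
      obtain ⟨d', hd3, hd4, hd5⟩ := Pl.side_pos hd2
      have h9 : 0 < P.cN f (fun d => (P.ext d ∧ (P.st d ∨ P.ix d ∈ ({0, a.length} : Finset ℕ))) ∧ ¬ P.ix d < a.length) :=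
        Pl.cN_pos.2 ⟨d', by omega, ⟨hd4.1, hd5.imp id fun h => by simp [h]⟩, by have := hd4.2.1; omega⟩
      by_contra hlt
      have h7 : ev + P.iN f ≤ 3 := by omega
      have h8 := Nat.mul_le_mul_left B h7
      grind
theorem cx (hsc : SmallCancellation R (1 / 6)) {a b s : Word S} (hab : a ++ b ∈ symmClosure R)
    (he : evalWord (presGen R) s = evalWord (presGen R) a) : min a.length b.length ≤ s.length := by
  by_contra hlt
  have key : ∀ k, ∀ a b s : Word S, s.length = k → a ++ b ∈ symmClosure R →
      evalWord (presGen R) s = evalWord (presGen R) a → k < a.length → k < b.length → False := by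
    intro k
    induction k using Nat.strong_induction_on with
    | _ k ih =>
      intro a b s hk hab he h1 h2
      by_cases hs0 : s = []
      · subst hs0
        exact cx0 hsc a.length a b rfl hab (List.length_pos_iff.1 oo) (List.length_pos_iff.1 oo)
          (by simp_all)
      · obtain ⟨n, hn⟩ := null_DG (R := R) (w := a ++ wordInv s) (by simp_all)
        subst hk
        exact cx_step hsc hs0 ih n a b hn hab he h1 h2
  exact key s.length a b s rfl hab he oo oo
end P6b
end MorseLTG
open Metric Set Filter
namespace MorseLTG
noncomputable section P7a
local notation "oo" => (by omega)
open scoped Classical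
variable {S : Type*} {R : Set (Word S)} {n : ℕ} {w : Word S}
namespace Pl
def Nx (P : Pl R n w) (a b : P.D) : Prop :=
  ∃ k, b = P.nxt^[k + 1] a ∧ P.st b ∧ ∀ j < k, ¬ P.st (P.nxt^[j + 1] a)
def NxK (P : Pl R n w) (k : ℕ) (a b : P.D) : Prop :=
  b = P.nxt^[k + 1] a ∧ P.st b ∧ ∀ j < k, ¬ P.st (P.nxt^[j + 1] a)
variable {P : Pl R n w}
lemma sg_nr (a : P.D) : P.sg (P.nxt (P.rev a)) = a := by rw [sg, prv_nxt, P.rev_rev]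
lemma nr_sg (a : P.D) : P.nxt (P.rev (P.sg a)) = a := by rw [sg, P.rev_rev, nxt_prv]
lemma st_nr {a : P.D} : P.st (P.nxt (P.rev a)) ↔ P.st a := by
  unfold st
  rw [sg_nr]
  constructor
  · intro h h2
    apply h
    apply sg_inj
    rw [sg_nr, h2]
  · intro h h2
    apply h
    rw [h2, sg_nr]
lemma nr_eq {a : P.D} (h : P.st a) (hd : P.deg (P.src a) = 3) : P.nxt (P.rev a) = P.sg (P.sg a) := by
  apply sg_inj
  rw [sg_nr, sg3 h hd]
lemma Nx.fc {a b : P.D} (h : P.Nx a b) : P.fc b = P.fc a := by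
  obtain ⟨k, rfl, _⟩ := h; rw [fc_iter]
lemma Nx.st {a b : P.D} (h : P.Nx a b) : P.st b := by
  obtain ⟨k, _, h, _⟩ := h; exact h
lemma Nx.uniq {a b c : P.D} (h1 : P.Nx a b) (h2 : P.Nx a c) : b = c := by
  obtain ⟨k, h1, h3, h4⟩ := h1
  obtain ⟨l, h5, h6, h7⟩ := h2
  grind
lemma Nx.inj' {a b c : P.D} (ha : P.st a) (h1 : P.Nx a c) (h2 : P.Nx b c) (k l : ℕ) (hkl : l < k)
    (e1 : c = P.nxt^[k + 1] b) (e2 : c = P.nxt^[l + 1] a) (h4 : ∀ j < k, ¬ P.st (P.nxt^[j + 1] b)) : False := by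
  have : a = P.nxt^[k - l] b := by
    apply P.nxt.injective.iterate (l + 1)
    rw [← e2, ← Function.iterate_add_apply, e1]; congr 1; omega
  apply h4 (k - l - 1) oo
  grind
lemma Nx.inj {a b c : P.D} (ha : P.st a) (hb : P.st b) (h1 : P.Nx a c) (h2 : P.Nx b c) : a = b := by
  obtain ⟨k, e1, h3, h4⟩ := id h1
  obtain ⟨l, e2, h6, h7⟩ := id h2
  rcases Nat.lt_trichotomy k l with h | h | h
  · exact (Nx.inj' ha h1 h2 l k h e2 e1 h7).elim
  · subst h
    exact P.nxt.injective.iterate (k + 1) (e1.symm.trans e2)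
  · exact (Nx.inj' hb h2 h1 k l h e1 e2 h4).elim
lemma not_st_rev {x : P.D} (h : ¬ P.st (P.nxt x)) : ¬ P.st (P.rev x) := by
  unfold st at *
  push Not at *
  have h1 : P.sg (P.nxt x) = P.rev x := by rw [sg, prv_nxt]
  rw [h1] at h
  rw [h, h1]
lemma NxK.rev {a b : P.D} {k : ℕ} (ha : P.st a) (h : P.NxK k a b) : P.NxK k (P.sg b) (P.nxt (P.rev a)) := by
  obtain ⟨rfl, h1, h2⟩ := h
  have e : P.sg (P.nxt^[k + 1] a) = P.rev (P.nxt^[k] a) := by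
    rw [sg, Function.iterate_succ_apply', prv_nxt]
  have hr : ∀ j, j ≤ k → P.nxt^[j] (P.rev (P.nxt^[j] a)) = P.rev a := fun j hj =>
    rev_run (m := k + 1) (fun j h0 hj => by
      have := h2 (j - 1) oo
      rwa [show j - 1 + 1 = j by omega] at this) j oo
  have hr2 : ∀ j, j ≤ k → P.nxt^[j] (P.rev (P.nxt^[k] a)) = P.rev (P.nxt^[k - j] a) := by
    intro j hj
    apply P.nxt.injective.iterate (k - j)
    rw [← Function.iterate_add_apply, Nat.sub_add_cancel hj, hr k le_rfl, hr _ oo]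
  refine ⟨?_, st_nr.2 ha, ?_⟩
  · rw [e, Function.iterate_succ_apply', hr k le_rfl]
  · intro j hj
    rw [e, hr2 (j + 1) oo]
    apply not_st_rev
    rw [← Function.iterate_succ_apply' P.nxt]
    grind
lemma Nx.rev {a b : P.D} (ha : P.st a) (h : P.Nx a b) : P.Nx (P.sg b) (P.nxt (P.rev a)) := by
  obtain ⟨k, hk⟩ := h
  exact ⟨k, NxK.rev ha hk⟩
lemma NxK.uniq {a b : P.D} {k l : ℕ} (h1 : P.NxK k a b) (h2 : P.NxK l a b) : k = l := by
  rcases Nat.lt_trichotomy k l with h | h | h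
  · exact (h2.2.2 k h (h1.1 ▸ h1.2.1)).elim
  · omega
  · exact (h1.2.2 l h (h2.1 ▸ h2.2.1)).elim
lemma Nx.fcr {a b : P.D} (h : P.Nx a b) : P.fc (P.rev (P.prv b)) = P.fc (P.rev a) := by
  obtain ⟨k, rfl, h1, h2⟩ := h
  rw [Function.iterate_succ_apply', prv_nxt]
  clear h1
  induction k with
  | zero => rfl
  | succ k ih =>
    rw [← ih fun j hj => h2 j oo]
    have := fc_rev_prv (h2 k oo)
    rw [Function.iterate_succ_apply', prv_nxt] at this
    rw [Function.iterate_succ_apply', this]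
lemma Nx.fcs {a b : P.D} (h : P.Nx a b) : P.fc (P.sg b) = P.fc (P.rev a) := h.fcr
lemma five {f : ℕ} (h5 : P.cN f P.st = 5) {a : P.D} (ha : P.fc a = f) (hs : P.st a) :
    ∃ a1 a2 a3 a4, P.Nx a a1 ∧ P.Nx a1 a2 ∧ P.Nx a2 a3 ∧ P.Nx a3 a4 ∧ P.Nx a4 a ∧
      a1 ≠ a ∧ a2 ≠ a ∧ a3 ≠ a ∧ a4 ≠ a ∧
      (∀ d, P.fc d = f → P.st d → d = a ∨ d = a1 ∨ d = a2 ∨ d = a3 ∨ d = a4) := by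
  subst ha
  set L := P.len (P.fc a) with hL
  have hL0 := P.hlen a
  set K : Finset ℕ := (Finset.range L).filter fun k => P.st (P.nxt^[k] a) with hK
  have hcard : K.card = 5 := by
    rw [← h5]
    unfold cN
    apply Finset.card_bij (fun k _ => P.nxt^[k] a)
    · intro k hk
      rw [hK, Finset.mem_filter] at hk
      rw [mem_cS, fc_iter]; exact ⟨rfl, hk.2⟩
    · intro i hi j hj h
      rw [hK, Finset.mem_filter, Finset.mem_range] at hi hj
      exact P.inj a i hi.1 j hj.1 h
    · intro d hd
      rw [mem_cS] at hd
      obtain ⟨k, hk, e⟩ := P.orb a d hd.1.symm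
      grind
  set e := K.orderEmbOfFin hcard with he
  have hmem : ∀ t, e t < L ∧ P.st (P.nxt^[e t] a) := by
    intro t
    have := Finset.orderEmbOfFin_mem K hcard t
    grind
  have hsur : ∀ k, k < L → P.st (P.nxt^[k] a) → ∃ t, e t = k := by
    intro k h1 h2
    have h3 : k ∈ Set.range e := by
      simp_all
    grind
  have h0 : e 0 = 0 := by
    obtain ⟨t, ht⟩ := hsur 0 hL0 hs
    have := e.monotone (Fin.zero_le t)
    omega
  have hstep : ∀ t t' : Fin 5, t'.val = t.val + 1 → P.Nx (P.nxt^[e t] a) (P.nxt^[e t'] a) := by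
    intro t t' htt
    have hlt : e t < e t' := e.strictMono oo
    refine ⟨e t' - e t - 1, ?_, (hmem t').2, ?_⟩
    · rw [← Function.iterate_add_apply]; congr 1; omega
    · intro j hj hst
      rw [← Function.iterate_add_apply] at hst
      obtain ⟨s, hs⟩ := hsur _ (by grind) hst
      have h1 : t < s := e.lt_iff_lt.1 oo
      have h2 : s < t' := e.lt_iff_lt.1 oo
      omega
  have hlast : P.Nx (P.nxt^[e 4] a) a := by
    have h4 := (hmem 4).1
    refine ⟨L - e 4 - 1, ?_, hs, ?_⟩
    · rw [← Function.iterate_add_apply, show L - e 4 - 1 + 1 + e 4 = L by omega, P.per]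
    · intro j hj hst
      rw [← Function.iterate_add_apply] at hst
      obtain ⟨s, hs⟩ := hsur _ oo hst
      have h1 : (4 : Fin 5) < s := e.lt_iff_lt.1 oo
      omega
  have hne : ∀ t : Fin 5, t ≠ 0 → P.nxt^[e t] a ≠ a := by
    intro t ht h
    have := P.inj a _ (hmem t).1 0 hL0 h
    rw [← h0] at this
    exact ht (e.injective this)
  have hz : P.nxt^[e 0] a = a := by rw [h0]; rfl
  refine ⟨P.nxt^[e 1] a, P.nxt^[e 2] a, P.nxt^[e 3] a, P.nxt^[e 4] a, ?_, hstep 1 2 rfl, hstep 2 3 rfl,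
    hstep 3 4 rfl, hlast, hne 1 (by decide), hne 2 (by decide), hne 3 (by decide), hne 4 (by decide), ?_⟩
  · have := hstep 0 1 rfl
    grind
  · intro d hd hds
    obtain ⟨k, hk, rfl⟩ := P.orb a d hd.symm
    obtain ⟨t, rfl⟩ := hsur k hk hds
    fin_cases t
    · grind
    · grind
    · grind
    · grind
    grind
end Pl
end P7a
end MorseLTG
open Metric Set Filter
namespace MorseLTG
noncomputable section P7b
local notation "oo" => (by omega)
open scoped Classical
variable {S : Type*} {R : Set (Word S)} {n : ℕ} {w : Word S} {m1 m2 m3 N K : ℕ}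
structure Quad (R : Set (Word S)) (w : Word S) (m1 m2 m3 N K : ℕ) : Prop where
  hsc : SmallCancellation R (1 / 6)
  hw : w ≠ []
  hs : SimpleW R w
  h12 : m1 ≤ m2
  h23 : m2 ≤ m3
  h34 : m3 ≤ w.length
  h1W : m1 < w.length
  g1 : GeoSide R w 0 m1
  g2 : GeoSide R w m1 m2
  g3 : GeoSide R w m2 m3
  g4 : GeoSide R w m3 w.length
  hK : 12 ≤ K
  hlen : ∀ r ∈ R, r.length < 2 * w.length
  big : ∀ i m z, i + m ≤ m1 → (w.drop i).take m ++ z ∈ symmClosure R → N ≤ m + z.length → K * m ≤ m + z.length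
  beta : ∀ i j u, i ≤ m1 → m1 ≤ j → j ≤ m2 → evalWord (presGen R) (w.take j) =
    evalWord (presGen R) (w.take i) * evalWord (presGen R) u → j ≤ m1 + u.length
  alpha : ∀ i j u, i ≤ m1 → m3 ≤ j → j ≤ w.length → evalWord (presGen R) (w.take j) =
    evalWord (presGen R) (w.take i) * evalWord (presGen R) u → w.length ≤ j + u.length
  delta : ∀ i j u, i ≤ m1 → m2 ≤ j → j ≤ m3 → evalWord (presGen R) (w.take j) =
    evalWord (presGen R) (w.take i) * evalWord (presGen R) u → 2 * N < u.length
namespace Pl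
variable {P : Pl R n w}
def sm (P : Pl R n w) (M : Finset ℕ) (d : P.D) : Prop := P.st d ∨ P.ix d ∈ M
def sc (P : Pl R n w) (M : Finset ℕ) (f lo hi : ℕ) : ℕ := P.cN f (fun d => P.sd lo hi d ∧ P.sm M d)
lemma sc_pos {M : Finset ℕ} {f lo hi : ℕ} (hlo : lo ∈ M) (h : P.sc M f lo hi = 0) : P.cN f (P.sd lo hi) = 0 := by
  by_contra h0
  obtain ⟨d, hd, h1⟩ := cN_pos.1 (Nat.pos_of_ne_zero h0)
  obtain ⟨d', h2, h3, h4⟩ := side_pos h1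
  refine cN_zero h (h2.trans hd) ⟨h3, ?_⟩
  rcases h4 with h4 | h4
  · exact Or.inl h4
  · exact Or.inr (h4 ▸ hlo)
lemma cN_union {f : ℕ} (T U V : P.D → Prop) (h : ∀ d, P.ext d → (T d ↔ U d ∨ V d)) (hT : ∀ d, T d → P.ext d)
    (hU : ∀ d, U d → P.ext d) (hV : ∀ d, V d → P.ext d)
    (hd : ∀ d, U d → V d → False) : P.cN f T = P.cN f U + P.cN f V := by
  rw [cN_split T U]
  congr 1
  · exact cN_congr fun d _ => ⟨fun h => h.2, fun h1 => ⟨(h d (hU d h1)).2 (Or.inl h1), h1⟩⟩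
  · apply cN_congr
    grind
lemma sd_split {f lo mi hi : ℕ} (h1 : lo ≤ mi) (h2 : mi ≤ hi) :
    P.cN f (P.sd lo hi) = P.cN f (P.sd lo mi) + P.cN f (P.sd mi hi) := by
  apply cN_union
  · intro d he
    unfold sd
    grind
  · exact fun d h => h.1
  · exact fun d h => h.1
  · exact fun d h => h.1
  · intro d h1 h2
    have := h1.2.2
    have := h2.2.1
    omega
lemma sc_split {M : Finset ℕ} {f lo mi hi : ℕ} (h1 : lo ≤ mi) (h2 : mi ≤ hi) :
    P.sc M f lo hi = P.sc M f lo mi + P.sc M f mi hi := by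
  apply cN_union
  · intro d he
    unfold sd
    grind
  · exact fun d h => h.1.1
  · exact fun d h => h.1.1
  · exact fun d h => h.1.1
  · intro d h1 h2
    have := h1.1.2.2
    have := h2.1.2.1
    omega
lemma sc_all (M : Finset ℕ) (f : ℕ) : P.sc M f 0 w.length = P.eN f + P.mkd M f := by
  rw [← st_mk]
  apply cN_congr
  intro d _
  unfold sd sm
  constructor
  · grind
  · rintro ⟨a, b⟩; exact ⟨⟨a, by omega, ix_lt a⟩, b⟩
lemma sd_all (f : ℕ) : P.cN f (P.sd 0 w.length) = P.cN f P.ext := by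
  apply cN_congr
  intro d _
  exact ⟨fun h => h.1, fun h => ⟨h, by omega, ix_lt h⟩⟩
lemma gam_run (Q : Quad R w m1 m2 m3 N K) {f : ℕ} (hf0 : f ≠ 0) (hN : N ≤ P.len f) {M : Finset ℕ} (h0 : 0 ∈ M) :
    K * P.cN f (P.sd 0 m1) ≤ P.len f * P.sc M f 0 m1 := by
  have hK := Q.hK
  have h1 : P.cN f (P.sd 0 m1) ≤ P.len f / K * P.cN f (fun d => P.sd 0 m1 d ∧ (P.st d ∨ P.ix d = 0)) := by
    apply side_count
    intro a m ha hsd hm hr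
    rw [Nat.le_div_iff_mul_le oo]
    have hlt : P.ix a + m ≤ m1 := by have := (hr (m - 1) oo).2; omega
    have hml : m ≤ P.len f := by
      by_contra hlt'
      have e1 := (hr (P.len f) oo)
      rw [← ha, P.per, ha] at e1
      have e2 := out_ix hsd.1
      rw [← e2] at e1
      have := P.out_inj _ (ix_lt hsd.1) (P.ix a + P.len f) (by have := Q.h1W; rw [← ha] at e1 ⊢; rw [e2] at e1; have := e1.2; omega)
        (by grind)
      have := P.hlen a
      grind
    have hpre : (P.wd a) = (w.drop (P.ix a)).take m ++ (P.wd a).drop m := by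
      conv_lhs => rw [← List.take_append_drop m (P.wd a)]
      congr 1
      apply List.ext_getElem
      · have := Q.h1W; simp [wd_len, ha]; omega
      · intro j h1 h2
        have hj : j < m := by simp at h1; omega
        rw [List.getElem_take, List.getElem_take, List.getElem_drop, wd_get, (hr j hj).1, P.out_lab]
    have hl : m + ((P.wd a).drop m).length = P.len f := by
      rw [List.length_drop, wd_len, ha]; omega
    have := Q.big (P.ix a) m ((P.wd a).drop m) hlt (by rw [← hpre]; exact wd_mem' a oo)
      oo
    grind
  have h2 : P.cN f (fun d => P.sd 0 m1 d ∧ (P.st d ∨ P.ix d = 0)) ≤ P.sc M f 0 m1 := by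
    apply cN_mono
    rintro d _ ⟨a, b⟩
    refine ⟨a, b.imp id fun h => ?_⟩
    grind
  calc K * P.cN f (P.sd 0 m1) ≤ K * (P.len f / K * P.sc M f 0 m1) :=
        Nat.mul_le_mul_left _ (h1.trans (Nat.mul_le_mul_left _ h2))
    _ = (P.len f / K * K) * P.sc M f 0 m1 := by ring
    _ ≤ _ := Nat.mul_le_mul_right _ (Nat.div_mul_le_self _ _)
def Mk (m1 m2 m3 : ℕ) : Finset ℕ := {0, m1, m2, m3}
lemma fc_mem {d : P.D} (h : P.fc d ≠ 0) : P.fc d ∈ Finset.Icc 1 n := by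
  rw [Finset.mem_Icc]; exact ⟨by omega, P.fc_le d⟩
lemma face_num (Q : Quad R w m1 m2 m3 N K) {f : ℕ} (hf : f ∈ Finset.Icc 1 n) :
    ∃ X1 X2 X3 X4 s1 s2 s3 s4 Y : ℕ, P.cN f (P.sd 0 m1) = X1 ∧ P.cN f P.ext = X1 + X2 + X3 + X4 ∧
      P.cN f (P.sd m1 w.length) = X2 + X3 + X4 ∧ 
      P.sc (Mk m1 m2 m3) f 0 m1 = s1 ∧ P.sc (Mk m1 m2 m3) f m1 w.length = s2 + s3 + s4 ∧
      s1 + s2 + s3 + s4 = P.eN f + P.mkd (Mk m1 m2 m3) f ∧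
      2 * X1 ≤ P.len f ∧ 2 * X2 ≤ P.len f ∧ 2 * X3 ≤ P.len f ∧ 2 * X4 ≤ P.len f ∧
      (s1 = 0 → X1 = 0) ∧ (s2 = 0 → X2 = 0) ∧ (s3 = 0 → X3 = 0) ∧ (s4 = 0 → X4 = 0) ∧
      P.len f = X1 + X2 + X3 + X4 + Y ∧ 6 * Y ≤ (P.len f - 1) * P.iN f ∧ (N ≤ P.len f → K * X1 ≤ P.len f * s1) ∧
      0 < P.len f ∧ P.len f < 2 * w.length ∧ P.eN f ≤ P.iN f := by
  rw [Finset.mem_Icc] at hf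
  have := Q.h12
  have := Q.h23
  have := Q.h34
  have hint := int_count (P := P) Q.hsc (f := f) oo
  have hall := cN_all' (P := P) hf.1 hf.2
  have hspl := cN_split (P := P) (f := f) (fun _ => True) P.ext
  have e1 : P.cN f (fun d => True ∧ P.ext d) = P.cN f P.ext := cN_congr fun d _ => by tauto
  have e2 : P.cN f (fun d => True ∧ ¬ P.ext d) = P.cN f (fun d => ¬ P.ext d) := cN_congr fun d _ => by tauto
  have a1 := sd_split (P := P) (f := f) (lo := 0) (mi := m1) (hi := w.length) oo oo
  have a2 := sd_split (P := P) (f := f) (lo := m1) (mi := m2) (hi := w.length) oo oo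
  have a3 := sd_split (P := P) (f := f) (lo := m2) (mi := m3) (hi := w.length) oo oo
  have b1 := sc_split (P := P) (M := Mk m1 m2 m3) (f := f) (lo := 0) (mi := m1) (hi := w.length) oo oo
  have b2 := sc_split (P := P) (M := Mk m1 m2 m3) (f := f) (lo := m1) (mi := m2) (hi := w.length) oo oo
  have b3 := sc_split (P := P) (M := Mk m1 m2 m3) (f := f) (lo := m2) (mi := m3) (hi := w.length) oo oo
  rw [sd_all] at a1
  rw [sc_all] at b1
  obtain ⟨d, hd⟩ := P.surj f hf.1 hf.2
  have hl0 := P.hlen d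
  have hlt : P.len f < 2 * w.length := by
    obtain ⟨r, hr, hl⟩ := sc_len (wd_mem' d oo)
    have := Q.hlen r hr
    rwa [hl, wd_len, hd] at this
  rw [hd] at hl0
  have hgam := gam_run (P := P) Q (f := f) (M := Mk m1 m2 m3) oo
  refine ⟨P.cN f (P.sd 0 m1), P.cN f (P.sd m1 m2), P.cN f (P.sd m2 m3), P.cN f (P.sd m3 w.length),
    P.sc (Mk m1 m2 m3) f 0 m1, P.sc (Mk m1 m2 m3) f m1 m2, P.sc (Mk m1 m2 m3) f m2 m3,
    P.sc (Mk m1 m2 m3) f m3 w.length, P.cN f (fun d => ¬ P.ext d), rfl, by omega, by omega, rfl, by omega, by omega,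
    geo_half Q.g1 oo, geo_half Q.g2 oo, geo_half Q.g3 oo, geo_half Q.g4 oo,
    sc_pos (by simp [Mk]), sc_pos (by simp [Mk]), sc_pos (by simp [Mk]), sc_pos (by simp [Mk]), by omega, ?_,
    fun h => hgam h (by simp [Mk]), hl0, hlt, by rw [iN_eN Q.hs Q.hw]; omega⟩
  calc 6 * P.cN f (fun d => ¬ P.ext d) ≤ 6 * ((P.len f - 1) / 6 * P.iN f) := Nat.mul_le_mul_left _ hint
    _ = ((P.len f - 1) / 6 * 6) * P.iN f := by ring
    _ ≤ _ := Nat.mul_le_mul_right _ (Nat.div_mul_le_self _ _)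
def TA (P : Pl R n w) (m1 m2 m3 f : ℕ) : Prop := P.eN f = 1 ∧ P.iN f = 4 ∧ P.hN f = 0 ∧ P.mkd (Mk m1 m2 m3) f = 0
def TB (P : Pl R n w) (m1 m2 m3 f : ℕ) : Prop := P.eN f = 2 ∧ P.iN f = 2 ∧ P.hN f = 0 ∧ P.mkd (Mk m1 m2 m3) f = 0
def TE (P : Pl R n w) (m1 m2 m3 f : ℕ) : Prop := ¬ P.TA m1 m2 m3 f ∧ ¬ P.TB m1 m2 m3 f
lemma defect (Q : Quad R w m1 m2 m3 N K) {f : ℕ} (hf : f ∈ Finset.Icc 1 n) :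
    12 ≤ 6 * P.mkd (Mk m1 m2 m3) f + 4 * P.eN f + 2 * P.iN f + P.hN f ∧
    (P.TE m1 m2 m3 f → 13 ≤ 7 * P.mkd (Mk m1 m2 m3) f + 4 * P.eN f + 2 * P.iN f + P.hN f) := by
  obtain ⟨X1, X2, X3, X4, s1, s2, s3, s4, Y, -, -, -, -, -, hs, g1, g2, g3, g4, z1, z2, z3, z4, hl, hY, -, l0, -, hei⟩ :=
    face_num (P := P) Q hf
  unfold TE TA TB
  generalize P.mkd (Mk m1 m2 m3) f = c at *
  generalize P.eN f = e at *
  generalize P.iN f = i at *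
  generalize P.hN f = h at *
  have hq0 : e + c = 0 → 7 ≤ i := by
    intro h
    by_contra hi
    have : (P.len f - 1) * i ≤ (P.len f - 1) * 6 := Nat.mul_le_mul_left _ oo
    omega
  have hq1 : e + c = 1 → 4 ≤ i := by
    intro h
    by_contra hi
    have : (P.len f - 1) * i ≤ (P.len f - 1) * 3 := Nat.mul_le_mul_left _ oo
    omega
  grind
end Pl
end P7b
end MorseLTG
open Metric Set Filter
namespace MorseLTG
noncomputable section P7c
local notation "oo" => (by omega)
open scoped Classical
variable {S : Type*} {R : Set (Word S)} {n : ℕ} {w : Word S} {m1 m2 m3 N K : ℕ}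
namespace Pl
variable {P : Pl R n w}
lemma sum_defect (Q : Quad R w m1 m2 m3 N K) :
    ∑ f ∈ Finset.Icc 1 n, (6 * P.mkd (Mk m1 m2 m3) f + 4 * P.eN f + 2 * P.iN f + P.hN f - 12) ≤ 12 := by
  have hc := P.curv Q.hsc.1
  rw [no_spurs Q.hs Q.hw] at hc
  have hm : ∑ f ∈ Finset.Icc 1 n, P.mkd (Mk m1 m2 m3) f ≤ 4 :=
    (P.sum_mk (Mk m1 m2 m3)).trans (Finset.card_le_four)
  have : ((∑ f ∈ Finset.Icc 1 n, (6 * P.mkd (Mk m1 m2 m3) f + 4 * P.eN f + 2 * P.iN f + P.hN f - 12) : ℕ) : ℤ) =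
      6 * ((∑ f ∈ Finset.Icc 1 n, P.mkd (Mk m1 m2 m3) f : ℕ) : ℤ) -
      ∑ f ∈ Finset.Icc 1 n, (12 - 4 * P.eN f - 2 * P.iN f - P.hN f : ℤ) := by
    push_cast
    rw [Finset.mul_sum, ← Finset.sum_sub_distrib]
    apply Finset.sum_congr rfl
    intro f hf
    have := (defect (P := P) Q hf).1
    omega
  omega
lemma exc_bd (Q : Quad R w m1 m2 m3 N K) {f : ℕ} (hf : f ∈ Finset.Icc 1 n) :
    P.eN f + P.mkd (Mk m1 m2 m3) f ≤ 6 ∧ P.eN f + P.iN f ≤ 12 := by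
  have h := sum_defect (P := P) Q
  have h2 := (Finset.single_le_sum (f := fun f => 6 * P.mkd (Mk m1 m2 m3) f + 4 * P.eN f + 2 * P.iN f + P.hN f - 12)
    (fun i _ => Nat.zero_le _) hf).trans h
  omega
lemma exc_card (Q : Quad R w m1 m2 m3 N K) :
    ((Finset.Icc 1 n).filter fun f => P.TE m1 m2 m3 f).card ≤ 16 := by
  have h := sum_defect (P := P) Q
  have hm : ∑ f ∈ Finset.Icc 1 n, P.mkd (Mk m1 m2 m3) f ≤ 4 :=
    (P.sum_mk (Mk m1 m2 m3)).trans (Finset.card_le_four)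
  have h3 : ∑ f ∈ (Finset.Icc 1 n).filter (fun f => P.TE m1 m2 m3 f), 1 ≤
     ∑ f ∈ Finset.Icc 1 n, ((6 * P.mkd (Mk m1 m2 m3) f + 4 * P.eN f + 2 * P.iN f + P.hN f - 12) +
      P.mkd (Mk m1 m2 m3) f) := by
    rw [Finset.sum_filter]
    apply Finset.sum_le_sum
    intro f hf
    split_ifs with hE
    · have := (defect (P := P) Q hf).2 hE
      omega
    omega
  rw [Finset.sum_add_distrib, Finset.sum_const, smul_eq_mul, mul_one] at h3
  omega
lemma st_count (f : ℕ) : P.cN f P.st = P.eN f + P.iN f := by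
  rw [cN_split _ P.ext, eN_eq, iN_eq]
  grind
lemma A_num (Q : Quad R w m1 m2 m3 N K) {f : ℕ} (hf : f ∈ Finset.Icc 1 n) (hA : P.TA m1 m2 m3 f)
    (h : P.cN f (P.sd 0 m1) ≠ 0) : P.len f < N ∧ P.cN f (P.sd m1 w.length) = 0 := by
  obtain ⟨X1, X2, X3, X4, s1, s2, s3, s4, Y, e1, e2, e3, e4, e5, hs, g1, g2, g3, g4, z1, z2, z3, z4, hl, hY, hg, l0, -, hei⟩ :=
    face_num (P := P) Q hf
  obtain ⟨h1, h2, h3, h4⟩ := hA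
  rw [h1, h4] at hs
  rw [h2] at hY
  rw [e1] at h
  have h1 : s1 = 1 := by omega
  have h2 : X2 = 0 := z2 oo
  have h3 : X3 = 0 := z3 oo
  have h4 : X4 = 0 := z4 oo
  refine ⟨?_, by omega⟩
  by_contra hN
  have h5 := hg oo
  rw [h1] at h5
  have h6 : 12 * X1 ≤ K * X1 := Nat.mul_le_mul_right _ Q.hK
  omega
lemma B_num (Q : Quad R w m1 m2 m3 N K) {f : ℕ} (hf : f ∈ Finset.Icc 1 n) (hB : P.TB m1 m2 m3 f)
    (h : P.cN f (P.sd 0 m1) ≠ 0) : P.len f < N ∧ 0 < P.sc (Mk m1 m2 m3) f m1 w.length := by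
  obtain ⟨X1, X2, X3, X4, s1, s2, s3, s4, Y, e1, e2, e3, e4, e5, hs, g1, g2, g3, g4, z1, z2, z3, z4, hl, hY, hg, l0, -, hei⟩ :=
    face_num (P := P) Q hf
  obtain ⟨h1, h2, h3, h4⟩ := hB
  rw [h1, h4] at hs
  rw [h2] at hY
  rw [e1] at h
  rw [e5]
  have hs1 : s1 = 1 := by
    grind
  refine ⟨?_, by omega⟩
  by_contra hN
  have h5 := hg oo
  rw [hs1] at h5
  have h6 : 12 * X1 ≤ K * X1 := Nat.mul_le_mul_right _ Q.hK
  omega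
def Zs (w : Word S) (m1 N : ℕ) : Finset ℕ := Finset.Ico m1 (m1 + 2 * N + 1) ∪ Finset.Ico (w.length - 2 * N) w.length
lemma Zs_card (w : Word S) (m1 N : ℕ) : (Zs w m1 N).card ≤ 4 * N + 1 := by
  refine (Finset.card_union_le _ _).trans ?_
  rw [Nat.card_Ico, Nat.card_Ico]; omega
lemma near (Q : Quad R w m1 m2 m3 N K) {a b : P.D} (ha : P.sd 0 m1 a) (hb : P.ext b) (hb1 : m1 ≤ P.ix b) {u : Word S}
    (hu : u.length ≤ 2 * N) (h : P.pos (P.src b) = P.pos (P.src a) * evalWord (presGen R) u) : P.ix b ∈ Zs w m1 N := by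
  have ea : P.src a = P.src (P.out (P.ix a)) := by rw [out_ix ha.1]
  have eb : P.src b = P.src (P.out (P.ix b)) := by rw [out_ix hb]
  have h1 := ix_lt ha.1
  have h2 := ix_lt hb
  have h3 := ha.2.2
  rw [ea, eb, pos_out _ h1.le, pos_out _ h2.le, mul_assoc] at h
  have h := mul_left_cancel h
  unfold Zs
  rw [Finset.mem_union, Finset.mem_Ico, Finset.mem_Ico]
  rcases Nat.lt_or_ge (P.ix b) m2 with h4 | h4
  · have := Q.beta _ _ _ h3.le hb1 h4.le h
    omega
  · rcases Nat.lt_or_ge (P.ix b) m3 with h5 | h5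
    · have := Q.delta _ _ _ h3.le h4 h5.le h
      omega
    · have := Q.alpha _ _ _ h3.le h5 h2.le h
      omega
def T1 (P : Pl R n w) (m1 N : ℕ) (d : P.D) : Prop := P.ext d ∧ P.ix d ∈ Zs w m1 N
lemma B_near (Q : Quad R w m1 m2 m3 N K) {f : ℕ} (hf : f ∈ Finset.Icc 1 n) (hB : P.TB m1 m2 m3 f)
    (h : P.cN f (P.sd 0 m1) ≠ 0) : 0 < P.cN f (P.T1 m1 N) := by
  obtain ⟨h1, h2⟩ := B_num Q hf hB h
  obtain ⟨a, ha, ha2⟩ := cN_pos.1 (Nat.pos_of_ne_zero h)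
  obtain ⟨b, hb, hb2, -⟩ := cN_pos.1 h2
  obtain ⟨u, hu, hp⟩ := pos_face (P := P) (a := a) (b := b) (ha.trans hb.symm)
  rw [ha] at hu
  exact cN_pos.2 ⟨b, hb, hb2.1, near Q ha2 hb2.1 hb2.2.1 oo hp⟩
def Yb (P : Pl R n w) (m1 m2 m3 N : ℕ) (d : P.D) : Prop :=
  (P.ext d ∧ P.ix d = m1) ∨ (P.st d ∧ P.TE m1 m2 m3 (P.fc d)) ∨
    (P.st d ∧ ¬ P.TE m1 m2 m3 (P.fc d) ∧ 0 < P.cN (P.fc d) (P.T1 m1 N))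
lemma sum_T1 : ∑ f ∈ Finset.Icc 1 n, P.cN f (P.T1 m1 N) ≤ 4 * N + 1 :=
  (sum_cN _ (Zs w m1 N) fun _ _ h => h).trans (Zs_card _ _ _)
lemma sum_Yb (Q : Quad R w m1 m2 m3 N K) : ∑ f ∈ Finset.Icc 1 n, P.cN f (P.Yb m1 m2 m3 N) ≤ 1 + 16 * 12 + 5 * (4 * N + 1) := by
  have h1 : ∑ f ∈ Finset.Icc 1 n, P.cN f (fun d => P.ext d ∧ P.ix d = m1) ≤ 1 := by
    have := sum_cN (P := P) (fun d => P.ext d ∧ P.ix d = m1) {m1} (fun d _ h => ⟨h.1, by simp [h.2]⟩)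
    grind
  have h2 := exc_card (P := P) Q
  have h3 := sum_T1 (P := P) (m1 := m1) (N := N)
  have h4 : ∑ f ∈ Finset.Icc 1 n, P.cN f (P.Yb m1 m2 m3 N) ≤ ∑ f ∈ Finset.Icc 1 n,
      (P.cN f (fun d => P.ext d ∧ P.ix d = m1) + (if P.TE m1 m2 m3 f then 12 else 0) + 5 * P.cN f (P.T1 m1 N)) := by
    apply Finset.sum_le_sum
    intro f hf
    have h5 : P.cN f (P.Yb m1 m2 m3 N) ≤ P.cN f (fun d => P.ext d ∧ P.ix d = m1) + (P.cN f (fun d => P.st d ∧ P.TE m1 m2 m3 f) +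
        P.cN f (fun d => P.st d ∧ ¬ P.TE m1 m2 m3 f ∧ 0 < P.cN f (P.T1 m1 N))) := by
      refine le_trans (cN_mono (U := fun d => (P.ext d ∧ P.ix d = m1) ∨ (P.st d ∧ P.TE m1 m2 m3 f) ∨
        (P.st d ∧ ¬ P.TE m1 m2 m3 f ∧ 0 < P.cN f (P.T1 m1 N))) ?_) ?_
      · rintro d rfl h; exact h
      · refine (cN_or _ _).trans ?_
        gcongr
        grind
    have h6 : P.cN f (fun d => P.st d ∧ P.TE m1 m2 m3 f) ≤ if P.TE m1 m2 m3 f then 12 else 0 := by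
      split_ifs with h
      · refine (cN_mono (U := P.st) fun d _ h => h.1).trans ?_
        rw [st_count]; exact (exc_bd Q hf).2
      · by_contra h0
        obtain ⟨d, _, h1⟩ := cN_pos.1 (Nat.lt_of_not_le h0)
        grind
    have h7 : P.cN f (fun d => P.st d ∧ ¬ P.TE m1 m2 m3 f ∧ 0 < P.cN f (P.T1 m1 N)) ≤ 5 * P.cN f (P.T1 m1 N) := by
      by_cases h : ¬ P.TE m1 m2 m3 f ∧ 0 < P.cN f (P.T1 m1 N)
      · refine (cN_mono (U := P.st) fun d _ h => h.1).trans ?_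
        rw [st_count]
        have : P.TA m1 m2 m3 f ∨ P.TB m1 m2 m3 f := by
          have := h.1; unfold TE at this; tauto
        unfold TA TB at this
        omega
      · by_contra h0
        obtain ⟨d, _, h1⟩ := cN_pos.1 (lt_of_le_of_lt (Nat.zero_le _) (Nat.lt_of_not_le h0))
        grind
    omega
  rw [Finset.sum_add_distrib, Finset.sum_add_distrib, ← Finset.mul_sum, ← Finset.sum_filter, Finset.sum_const, smul_eq_mul] at h4
  omega
lemma card_pred (T : P.D → Prop) : (Finset.univ.filter fun d => P.fc d ≠ 0 ∧ T d).card = ∑ f ∈ Finset.Icc 1 n, P.cN f T := by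
  have := P.sum_faces T
  unfold cN cS
  omega
lemma gam_total (Q : Quad R w m1 m2 m3 N K) : m1 ≤ ∑ f ∈ Finset.Icc 1 n, P.cN f (P.sd 0 m1) := by
  rw [← card_pred]
  conv_lhs => rw [← Finset.card_range m1]
  apply Finset.card_le_card_of_injOn P.out
  · intro i hi
    have hi := Finset.mem_range.1 hi
    have := Q.h1W
    rw [Finset.mem_coe, Finset.mem_filter]
    refine ⟨Finset.mem_univ _, no_bridge Q.hs Q.hw i, ext_out i, by omega, ?_⟩
    rw [ix_out oo]; exact hi
  · intro i hi j hj h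
    have hi := Finset.mem_range.1 hi
    have hj := Finset.mem_range.1 hj
    have := Q.h1W
    exact P.out_inj i oo j oo h
def AG (P : Pl R n w) (m1 m2 m3 : ℕ) (d : P.D) : Prop := P.sd 0 m1 d ∧ P.st d ∧ P.TA m1 m2 m3 (P.fc d)
lemma total1 (Q : Quad R w m1 m2 m3 N K) : K * m1 ≤ 16 * (K * N + 12 * w.length) + K * (N * (4 * N + 1)) +
    K * (N * ∑ f ∈ Finset.Icc 1 n, P.cN f (P.AG m1 m2 m3)) := by
  have h1 := gam_total (P := P) Q
  have h2 := exc_card (P := P) Q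
  have h3 := sum_T1 (P := P) (m1 := m1) (N := N)
  have h4 : ∑ f ∈ Finset.Icc 1 n, K * P.cN f (P.sd 0 m1) ≤ ∑ f ∈ Finset.Icc 1 n,
      ((if P.TE m1 m2 m3 f then K * N + 12 * w.length else 0) + K * N * P.cN f (P.T1 m1 N) + 
        K * N * P.cN f (P.AG m1 m2 m3)) := by
    apply Finset.sum_le_sum
    intro f hf
    have hall := cN_all' (P := P) (Finset.mem_Icc.1 hf).1 (Finset.mem_Icc.1 hf).2
    have hle : P.cN f (P.sd 0 m1) ≤ P.len f := by rw [← hall]; exact cN_mono fun _ _ _ => trivial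
    split_ifs with h
    · rcases Nat.lt_or_ge (P.len f) N with hN | hN
      · have : K * P.cN f (P.sd 0 m1) ≤ K * N := Nat.mul_le_mul_left _ oo
        omega
      · obtain ⟨X1, X2, X3, X4, s1, s2, s3, s4, Y, e1, e2, e3, e4, e5, hs, g1, g2, g3, g4, z1, z2, z3, z4, hl, hY, hg, l0, hlt, hei⟩ :=
          face_num (P := P) Q hf
        have h5 := hg hN
        have h6 := (exc_bd (P := P) Q hf).1
        have : P.len f * s1 ≤ (2 * w.length) * 6 := Nat.mul_le_mul oo oo
        grind
    · by_cases h0 : P.cN f (P.sd 0 m1) = 0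
      · grind
      have hAB : P.TA m1 m2 m3 f ∨ P.TB m1 m2 m3 f := by
        unfold TE at h; tauto
      rcases hAB with hA | hB
      · obtain ⟨a1, a2⟩ := A_num Q hf hA h0
        have : 0 < P.cN f (P.AG m1 m2 m3) := by
          obtain ⟨d, hd, h5⟩ := cN_pos.1 (Nat.pos_of_ne_zero h0)
          obtain ⟨d', h6, h7, h8⟩ := side_pos h5
          refine cN_pos.2 ⟨d', h6.trans hd, h7, ?_, by grind⟩
          by_contra hst
          have := h8.resolve_left hst
          apply cN_zero hA.2.2.2 (h6.trans hd)
          exact ⟨h7.1, hst, by rw [this]; simp [Mk]⟩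
        have : K * P.cN f (P.sd 0 m1) ≤ K * N * 1 := by rw [mul_one]; exact Nat.mul_le_mul_left _ oo
        have : K * N * 1 ≤ K * N * P.cN f (P.AG m1 m2 m3) := Nat.mul_le_mul_left _ oo
        omega
      · obtain ⟨a1, a2⟩ := B_num Q hf hB h0
        have := B_near Q hf hB h0
        have : K * P.cN f (P.sd 0 m1) ≤ K * N * 1 := by rw [mul_one]; exact Nat.mul_le_mul_left _ oo
        have : K * N * 1 ≤ K * N * P.cN f (P.T1 m1 N) := Nat.mul_le_mul_left _ oo
        omega
  rw [← Finset.mul_sum, Finset.sum_add_distrib, Finset.sum_add_distrib, ← Finset.mul_sum, ← Finset.mul_sum,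
    ← Finset.sum_filter, Finset.sum_const, smul_eq_mul] at h4
  have h5 : K * N * ∑ f ∈ Finset.Icc 1 n, P.cN f (P.T1 m1 N) ≤ K * N * (4 * N + 1) := Nat.mul_le_mul_left _ h3
  have h6 := Nat.mul_le_mul_left K h1
  have h7 := Nat.mul_le_mul_right (K * N + 12 * w.length) h2
  grind
end Pl
end P7c
end MorseLTG
open Metric Set Filter
namespace MorseLTG
noncomputable section P7d
local notation "oo" => (by omega)
open scoped Classical
variable {S : Type*} {R : Set (Word S)} {n : ℕ} {w : Word S} {m1 m2 m3 N K : ℕ}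
namespace Pl
variable {P : Pl R n w}
def nx (P : Pl R n w) (a : P.D) : P.D := if h : ∃ b, P.Nx a b then h.choose else a
lemma nx_eq {a b : P.D} (h : P.Nx a b) : P.nx a = b := by
  have h' : ∃ b, P.Nx a b := ⟨b, h⟩
  unfold nx
  rw [dif_pos h']
  exact h'.choose_spec.uniq h
def U (P : Pl R n w) (a : P.D) : P.D := P.nxt (P.rev (P.nx a))
lemma sg_eq_nr {a : P.D} (h : P.st a) (hd : P.deg (P.src a) = 3) : P.sg (P.sg a) = P.nxt (P.rev a) :=
  (nr_eq h hd).symm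
structure Fv (P : Pl R n w) (m1 m2 m3 : ℕ) (a a1 a2 a3 a4 : P.D) : Prop where
  n0 : P.Nx a a1
  n1 : P.Nx a1 a2
  n2 : P.Nx a2 a3
  n3 : P.Nx a3 a4
  n4 : P.Nx a4 a
  st : P.st a
  ex : P.ext a
  e1 : ¬ P.ext a1
  e2 : ¬ P.ext a2
  e3 : ¬ P.ext a3
  e4 : ¬ P.ext a4
  all : ∀ d, P.fc d = P.fc a → P.st d → d = a ∨ d = a1 ∨ d = a2 ∨ d = a3 ∨ d = a4
  dg : ∀ d, P.fc d = P.fc a → P.st d → P.deg (P.src d) = 3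
  nm : ∀ d, P.fc d = P.fc a → P.ext d → ¬ P.st d → P.ix d ∉ Mk m1 m2 m3
  ue : ∀ d, P.fc d = P.fc a → P.ext d → P.st d → d = a
lemma exFv {a : P.D} (hA : P.TA m1 m2 m3 (P.fc a)) (hs : P.st a) (he : P.ext a) :
    ∃ a1 a2 a3 a4, P.Fv m1 m2 m3 a a1 a2 a3 a4 := by
  obtain ⟨h1, h2, h3, h4⟩ := hA
  have h5 : P.cN (P.fc a) P.st = 5 := by rw [st_count]; omega
  obtain ⟨a1, a2, a3, a4, n0, n1, n2, n3, n4, d1, d2, d3, d4, all⟩ := five h5 rfl hs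
  rw [eN_eq] at h1
  rw [hN_eq] at h3
  have ue : ∀ d, P.fc d = P.fc a → P.ext d → P.st d → d = a := fun d hd h6 h7 =>
    cN_one h1.le hd rfl ⟨h6, h7⟩ ⟨he, hs⟩
  have f1 : P.fc a1 = P.fc a := n0.fc
  have f2 : P.fc a2 = P.fc a := n1.fc.trans f1
  have f3 : P.fc a3 = P.fc a := n2.fc.trans f2
  have f4 : P.fc a4 = P.fc a := n3.fc.trans f3
  exact ⟨a1, a2, a3, a4, n0, n1, n2, n3, n4, hs, he, fun h => d1 (ue _ f1 h n0.st),
    fun h => d2 (ue _ f2 h n1.st), fun h => d3 (ue _ f3 h n2.st), fun h => d4 (ue _ f4 h n3.st), all,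
    fun d hd h6 => by
      have := cN_zero h3 hd
      have := three_le_deg h6
      by_contra hne
      apply cN_zero h3 hd
      exact ⟨h6, by omega⟩,
    fun d hd h6 h7 h8 => cN_zero h4 hd ⟨h6, h7, h8⟩, ue⟩
section
variable {a a1 a2 a3 a4 : P.D}
lemma Fv.f1 (F : P.Fv m1 m2 m3 a a1 a2 a3 a4) : P.fc a1 = P.fc a := F.n0.fc
lemma Fv.f2 (F : P.Fv m1 m2 m3 a a1 a2 a3 a4) : P.fc a2 = P.fc a := F.n1.fc.trans F.f1
lemma Fv.f3 (F : P.Fv m1 m2 m3 a a1 a2 a3 a4) : P.fc a3 = P.fc a := F.n2.fc.trans F.f2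
lemma Fv.f4 (F : P.Fv m1 m2 m3 a a1 a2 a3 a4) : P.fc a4 = P.fc a := F.n3.fc.trans F.f3
lemma Fv.U_eq (F : P.Fv m1 m2 m3 a a1 a2 a3 a4) : P.U a = P.nxt (P.rev a1) := by rw [U, nx_eq F.n0]
lemma Fv.stU (F : P.Fv m1 m2 m3 a a1 a2 a3 a4) : P.st (P.U a) := by rw [F.U_eq, st_nr]; exact F.n0.st
lemma Fv.fcU (F : P.Fv m1 m2 m3 a a1 a2 a3 a4) : P.fc (P.U a) = P.fc (P.rev a1) := by rw [F.U_eq, P.fc_nxt]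
lemma Fv.out_U (F : P.Fv m1 m2 m3 a a1 a2 a3 a4) (Q : Quad R w m1 m2 m3 N K) (ha : P.AG m1 m2 m3 a) :
    ∃ j, P.ix a ≤ j ∧ j < m1 ∧ P.U a = P.out (j + 1) := by
  have hfa : P.fc a ≠ 0 := no_bridge' Q.hs Q.hw F.ex
  obtain ⟨h1, h2⟩ := A_num Q (fc_mem hfa) ha.2.2 (Nat.pos_iff_ne_zero.1 (cN_pos.2 ⟨a, rfl, ha.1⟩))
  obtain ⟨k, hk, hst, hr⟩ := F.n0
  have hext : ∀ j, j ≤ k → P.ext (P.nxt^[j] a) ∧ P.ix (P.nxt^[j] a) = P.ix a + j := by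
    intro j
    induction j with
    | zero => intro _; exact ⟨F.ex, rfl⟩
    | succ j ih =>
      intro hj
      obtain ⟨i1, i2⟩ := ih oo
      have hns := hr j oo
      have hpr : P.prv (P.nxt^[j + 1] a) = P.nxt^[j] a := by rw [Function.iterate_succ_apply', prv_nxt]
      have he : P.ext (P.nxt^[j + 1] a) := by rw [← ext_prv hns, hpr]; exact i1
      have h0 := F.nm _ (fc_iter a (j + 1)) he hns
      have h0' : 0 < P.ix (P.nxt^[j + 1] a) := by
        rcases Nat.eq_zero_or_pos (P.ix (P.nxt^[j + 1] a)) with h | h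
        · rw [h] at h0; simp [Mk] at h0
        omega
      have := (prv_ext he hns h0').2
      rw [hpr, i2] at this
      exact ⟨he, by omega⟩
  obtain ⟨i1, i2⟩ := hext k le_rfl
  refine ⟨P.ix a + k, by omega, ?_, ?_⟩
  · by_contra hge
    apply cN_zero h2 (fc_iter a k)
    exact ⟨i1, by omega, ix_lt i1⟩
  · have hpr : P.prv a1 = P.nxt^[k] a := by rw [hk, Function.iterate_succ_apply', prv_nxt]
    have hsg : P.sg a1 = P.rev (P.out (P.ix a + k)) := by rw [sg, hpr, ← i2, out_ix i1]
    rw [F.U_eq, nr_eq F.n0.st (F.dg _ F.f1 F.n0.st), hsg, sg, ← P.out_nxt, prv_nxt, P.rev_rev]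
lemma Fv.extU (F : P.Fv m1 m2 m3 a a1 a2 a3 a4) (Q : Quad R w m1 m2 m3 N K) (ha : P.AG m1 m2 m3 a) :
    P.ext (P.U a) ∧ P.ix a < P.ix (P.U a) ∧ P.ix (P.U a) ≤ m1 := by
  obtain ⟨j, h1, h2, h3⟩ := F.out_U Q ha
  have := Q.h1W
  rw [h3, ix_out oo]
  exact ⟨ext_out _, by omega, by omega⟩
lemma Fv.len_le (F : P.Fv m1 m2 m3 a a1 a2 a3 a4) : ∀ k0 k1 k2 k3 k4, P.NxK k0 a a1 → P.NxK k1 a1 a2 → P.NxK k2 a2 a3 → P.NxK k3 a3 a4 → P.NxK k4 a4 a →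
    P.len (P.fc a) ≤ k0 + k1 + k2 + k3 + k4 + 5 := by
  intro k0 k1 k2 k3 k4 h0 h1 h2 h3 h4
  by_contra hlt
  have := P.inj a (k0 + k1 + k2 + k3 + k4 + 5) oo 0 (P.hlen a) (by
    have e := h4.1
    rw [h3.1, h2.1, h1.1, h0.1] at e
    simp only [← Function.iterate_add_apply] at e
    rw [Function.iterate_zero, id]
    conv_rhs => rw [e]
    congr 1; omega)
  omega
lemma int_k (hsc : SmallCancellation R (1 / 6)) {x y : P.D} {k : ℕ} (h0 : P.fc x ≠ 0) (he : ¬ P.ext x)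
    (h : P.NxK k x y) : 6 * (k + 1) < P.len (P.fc x) := by
  apply int_run hsc h0 he
  intro j h1 h2
  have := h.2.2 (j - 1) oo
  grind
lemma Fv.ext_k (F : P.Fv m1 m2 m3 a a1 a2 a3 a4) (Q : Quad R w m1 m2 m3 N K) (hA : P.TA m1 m2 m3 (P.fc a)) {k : ℕ} (h : P.NxK k a a1) :
    2 * (k + 1) ≤ P.len (P.fc a) := by
  have hfa : P.fc a ≠ 0 := no_bridge' Q.hs Q.hw F.ex
  obtain ⟨X1, X2, X3, X4, s1, s2, s3, s4, Y, e1, e2, e3, e4, e5, hs, g1, g2, g3, g4, z1, z2, z3, z4, hl, hY, hg, l0, hlt, hei⟩ :=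
    face_num (P := P) Q (fc_mem hfa)
  rw [hA.1, hA.2.2.2] at hs
  have h1 : 2 * P.cN (P.fc a) P.ext ≤ P.len (P.fc a) := by
    omega
  have hkl : k < P.len (P.fc a) := by
    by_contra hge
    have h3 := h.2.2 (P.len (P.fc a) - 1) oo
    rw [show P.len (P.fc a) - 1 + 1 = P.len (P.fc a) by omega, P.per] at h3
    exact h3 F.st
  have h2 : k + 1 ≤ P.cN (P.fc a) P.ext := by
    unfold cN
    conv_lhs => rw [← Finset.card_range (k + 1)]
    apply Finset.card_le_card_of_injOn (fun j => P.nxt^[j] a)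
    · intro j hj
      have hj := Finset.mem_range.1 hj
      rw [Finset.mem_coe, mem_cS, fc_iter]
      refine ⟨rfl, ?_⟩
      clear hkl
      induction j with
      | zero => exact F.ex
      | succ j ih =>
        have := ih (Finset.mem_coe.2 (Finset.mem_range.2 oo)) oo
        rw [← ext_prv (h.2.2 j oo), Function.iterate_succ_apply', prv_nxt]
        omega
    · intro i hi j hj he
      have hi := Finset.mem_range.1 hi
      have hj := Finset.mem_range.1 hj
      exact P.inj a i oo j oo he
  omega
end
end Pl
end P7d
end MorseLTG
open Metric Set Filter
namespace MorseLTG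
noncomputable section P7e
local notation "oo" => (by omega)
open scoped Classical
variable {S : Type*} {R : Set (Word S)} {n : ℕ} {w : Word S} {m1 m2 m3 N K : ℕ}
namespace Pl
variable {P : Pl R n w}
def t3 (P : Pl R n w) (a : P.D) : P.D := P.nx (P.nx (P.nx a))
variable {a a1 a2 a3 a4 : P.D}
lemma Fv.t3_eq (F : P.Fv m1 m2 m3 a a1 a2 a3 a4) : P.t3 a = a3 := by
  rw [t3, nx_eq F.n0, nx_eq F.n1, nx_eq F.n2]
lemma rev_sg (d : P.D) : P.rev (P.sg d) = P.prv d := by rw [sg, P.rev_rev]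
lemma ext_sg (d : P.D) : P.ext (P.sg d) ↔ P.fc d = 0 := by unfold ext; rw [rev_sg, fc_prv]
lemma Fv.ext_nr (F : P.Fv m1 m2 m3 a a1 a2 a3 a4) : P.ext (P.nxt (P.rev a1)) := by
  rw [nr_eq F.n0.st (F.dg _ F.f1 F.n0.st), ext_sg, F.n0.fcs]
  exact F.ex
lemma close_ix (Q : Quad R w m1 m2 m3 N K) {b : P.D} (ha : P.sd 0 m1 a) (hb : P.sd 0 m1 b) (hab : P.ix a ≤ P.ix b)
    {u : Word S} (h : P.pos (P.src b) = P.pos (P.src a) * evalWord (presGen R) u) : P.ix b ≤ P.ix a + u.length := by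
  have ea : P.src a = P.src (P.out (P.ix a)) := by rw [out_ix ha.1]
  have eb : P.src b = P.src (P.out (P.ix b)) := by rw [out_ix hb.1]
  rw [ea, eb, pos_out _ (ix_lt ha.1).le, pos_out _ (ix_lt hb.1).le, mul_assoc] at h
  exact Q.g1 _ _ oo hab hb.2.2.le u (mul_left_cancel h)
theorem step (Q : Quad R w m1 m2 m3 N K) (ha : P.AG m1 m2 m3 a) (F : P.Fv m1 m2 m3 a a1 a2 a3 a4)
    (ha' : P.AG m1 m2 m3 (P.U a)) {c1 c2 c3 c4 : P.D} (F' : P.Fv m1 m2 m3 (P.U a) c1 c2 c3 c4)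
    (hY : ¬ P.Yb m1 m2 m3 N (P.sg a3)) :
    ∃ b, P.AG m1 m2 m3 b ∧ (P.ix a ≤ P.ix b + N ∧ P.ix b ≤ P.ix a + N) ∧ P.fc b = P.fc (P.sg a3) ∧
      P.fc (P.U b) = P.fc (P.rev a3) ∧ P.fc (P.rev c3) = P.fc b := by
  have hfa : P.fc a ≠ 0 := no_bridge' Q.hs Q.hw F.ex
  have hfa' : P.fc (P.U a) ≠ 0 := no_bridge' Q.hs Q.hw F'.ex
  have hlf := (A_num Q (fc_mem hfa) ha.2.2 (Nat.pos_iff_ne_zero.1 (cN_pos.2 ⟨a, rfl, ha.1⟩))).1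
  have hlf' := (A_num Q (fc_mem hfa') ha'.2.2 (Nat.pos_iff_ne_zero.1 (cN_pos.2 ⟨_, rfl, ha'.1⟩))).1
  have d1 := F.dg _ F.f1 F.n0.st
  have d2 := F.dg _ F.f2 F.n1.st
  have d3 := F.dg _ F.f3 F.n2.st
  have hc4 : c4 = P.sg a2 := by
    refine Nx.inj F'.n3.st (st_sg F.n1.st d2) F'.n4 ?_
    rw [F.U_eq]; exact Nx.rev F.n0.st F.n1
  obtain ⟨k2, hk2⟩ := F.n2
  obtain ⟨l3, hl3⟩ := F'.n3
  have hxy := NxK.rev F.n1.st hk2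
  have hyz := NxK.rev F'.n2.st hl3
  have hy : P.sg c4 = P.nxt (P.rev a2) := by rw [hc4, nr_eq F.n1.st d2]
  rw [hy] at hyz
  have hk2' := int_k Q.hsc (by rw [F.f2]; exact hfa) F.e2 hk2
  have hl3' := int_k Q.hsc (by rw [F'.f3]; exact hfa') F'.e3 hl3
  rw [F.f2] at hk2'
  rw [F'.f3] at hl3'
  have sx : P.st (P.sg a3) := st_sg F.n2.st d3
  have sy : P.st (P.nxt (P.rev a2)) := hxy.2.1
  have nex : ¬ P.ext (P.sg a3) := by rw [ext_sg, F.f3]; exact hfa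
  have ney : ¬ P.ext (P.nxt (P.rev a2)) := by rw [← hy, ext_sg, F'.f4]; exact hfa'
  have fx : P.fc (P.sg a3) = P.fc (P.rev a2) := F.n2.fcs
  have fx0 : P.fc (P.sg a3) ≠ 0 := by rw [fx]; exact F.e2
  have NXY : P.Nx (P.sg a3) (P.nxt (P.rev a2)) := ⟨k2, hxy⟩
  have NYZ : P.Nx (P.nxt (P.rev a2)) (P.nxt (P.rev c3)) := ⟨l3, hyz⟩
  set x := P.sg a3 with hx
  set y := P.nxt (P.rev a2) with hyd
  set z := P.nxt (P.rev c3) with hzd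
  have fy : P.fc y = P.fc x := NXY.fc
  unfold Yb at hY
  push Not at hY
  obtain ⟨-, hY2, hY3⟩ := hY
  have hTE := hY2 sx
  have hT1 := hY3 sx hTE
  have hTAB : P.TA m1 m2 m3 (P.fc x) ∨ P.TB m1 m2 m3 (P.fc x) := by unfold TE at hTE; tauto
  have hTA : P.TA m1 m2 m3 (P.fc x) := by
    refine hTAB.resolve_right fun hB => ?_
    have h := iN_eN (P := P) Q.hs Q.hw (P.fc x)
    rw [hB.1, hB.2.1] at h
    have h0 : P.cN (P.fc x) (fun d => (¬ P.ext d ∧ P.st d) ∧ ¬ P.ext (P.prv d)) = 0 := by omega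
    refine cN_zero h0 fy ⟨⟨ney, sy⟩, ?_⟩
    unfold ext
    rw [NXY.fcr]; exact nex
  obtain ⟨b, hb, hbe, hbs⟩ : ∃ b, P.fc b = P.fc x ∧ P.ext b ∧ P.st b := by
    have := hTA.1
    rw [eN_eq] at this
    exact cN_pos.1 oo
  rw [← hb] at hTA
  obtain ⟨b1, b2, b3, b4, G⟩ := exFv hTA hbs hbe
  have xb2 : x = b2 := by
    rcases G.all x hb.symm sx with h | h | h | h | h
    · grind
    · exfalso
      have := G.ext_nr
      rw [← h, hx, nr_sg] at this
      exact F.e3 this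
    · omega
    · exfalso
      have h1 : y = b4 := Nx.uniq NXY (h ▸ G.n3)
      have h2 : z = b := Nx.uniq NYZ (h1 ▸ G.n4)
      have h3 : P.sg b = c3 := by rw [← h2, hzd, sg_nr]
      have h4 := nr_eq G.st (G.dg b rfl G.st)
      rw [h3] at h4
      have h5 := congrArg P.fc h4
      rw [P.fc_nxt, F'.n2.fcs] at h5
      exact F'.e2 (h5.symm.trans G.ex)
    · exact (ney (Nx.uniq NXY (h ▸ G.n4) ▸ hbe)).elim
  have yb3 : y = b3 := Nx.uniq NXY (xb2 ▸ G.n2)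
  have zb4 : z = b4 := Nx.uniq NYZ (yb3 ▸ G.n3)
  rw [xb2, yb3] at hxy
  rw [yb3, zb4] at hyz
  have hfb : P.fc b ≠ 0 := by omega
  have hlen : P.len (P.fc b) ≤ 2 * N := by
    obtain ⟨k0, h0⟩ := G.n0
    obtain ⟨k1, h1⟩ := G.n1
    obtain ⟨k4, h4⟩ := G.n4
    have q := G.len_le k0 k1 k2 l3 k4 h0 h1 hxy hyz h4
    have q0 := G.ext_k Q hTA h0
    have q1 := int_k Q.hsc (by rw [G.f1]; exact hfb) G.e1 h1
    have q4 := int_k Q.hsc (by rw [G.f4]; exact hfb) G.e4 h4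
    rw [G.f1] at q1
    rw [G.f4] at q4
    omega
  obtain ⟨u1, hu1, hp1⟩ := pos_face (P := P) (a := a) (b := a3) F.f3.symm
  obtain ⟨u2, hu2, hp2⟩ := pos_face (P := P) (a := b) (b := x) hb
  rw [hx, src_sg] at hp2
  have hp : P.pos (P.src b) = P.pos (P.src a) * evalWord (presGen R) (u1 ++ wordInv u2) := by
    rw [evalWord_append, evalWord_inv, ← mul_assoc, ← hp1, hp2, mul_inv_cancel_right]
  have hul : (u1 ++ wordInv u2).length = u1.length + u2.length := by simp
  have hbm : P.ix b < m1 := by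
    by_contra hge
    have := near Q ha.1 hbe oo oo hp
    have : 0 < P.cN (P.fc x) (P.T1 m1 N) := cN_pos.2 ⟨b, hb, hbe, this⟩
    omega
  have hAGb : P.AG m1 m2 m3 b := ⟨⟨hbe, by omega, hbm⟩, hbs, hTA⟩
  have hlb := (A_num Q (fc_mem hfb) hTA (Nat.pos_iff_ne_zero.1 (cN_pos.2 ⟨b, rfl, hAGb.1⟩))).1
  refine ⟨b, hAGb, ?_, hb, ?_, ?_⟩
  · rcases le_total (P.ix a) (P.ix b) with h | h
    · have := close_ix Q ha.1 hAGb.1 h hp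
      omega
    · have := close_ix Q hAGb.1 ha.1 h (u := wordInv (u1 ++ wordInv u2)) (by
        rw [hp, evalWord_inv, mul_inv_cancel_right])
      rw [wordInv_length, hul] at this
      omega
  · rw [G.fcU, ← G.n1.fcs, ← xb2, hx, ← nr_eq F.n2.st d3, P.fc_nxt]
  · rw [← F'.n3.fcs, hy, fy, hb]
def Gd (P : Pl R n w) (m1 m2 m3 N : ℕ) (a : P.D) : Prop :=
  P.AG m1 m2 m3 a ∧ ¬ P.Yb m1 m2 m3 N (P.U a) ∧ ¬ P.Yb m1 m2 m3 N (P.sg (P.t3 a))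
lemma AG.fv (h : P.AG m1 m2 m3 a) : ∃ a1 a2 a3 a4, P.Fv m1 m2 m3 a a1 a2 a3 a4 := exFv h.2.2 h.2.1 h.1.1
lemma AG_U (Q : Quad R w m1 m2 m3 N K) (h : P.AG m1 m2 m3 a) (hY : ¬ P.Yb m1 m2 m3 N (P.U a)) :
    P.AG m1 m2 m3 (P.U a) := by
  obtain ⟨a1, a2, a3, a4, F⟩ := h.fv
  obtain ⟨h1, h2, h3⟩ := F.extU Q h
  have h4 := F.stU
  have h0 : P.fc (P.U a) ≠ 0 := no_bridge' Q.hs Q.hw h1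
  unfold Yb at hY
  push Not at hY
  obtain ⟨hY1, hY2, hY3⟩ := hY
  have hTE := hY2 h4
  have hT1 := hY3 h4 hTE
  have h5 : P.ix (P.U a) < m1 := lt_of_le_of_ne h3 (hY1 h1)
  have hTAB : P.TA m1 m2 m3 (P.fc (P.U a)) ∨ P.TB m1 m2 m3 (P.fc (P.U a)) := by unfold TE at hTE; tauto
  have hsd : P.sd 0 m1 (P.U a) := ⟨h1, by omega, h5⟩
  refine ⟨hsd, h4, hTAB.resolve_right fun hB => ?_⟩
  have := B_near Q (fc_mem h0) hB (Nat.pos_iff_ne_zero.1 (cN_pos.2 ⟨_, rfl, hsd⟩))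
  omega
def bf (P : Pl R n w) (m1 m2 m3 N : ℕ) (a : P.D) : P.D :=
  if h : ∃ b, P.AG m1 m2 m3 b ∧ (P.ix a ≤ P.ix b + N ∧ P.ix b ≤ P.ix a + N) ∧ P.fc b = P.fc (P.sg (P.t3 a)) ∧
      P.fc (P.U b) = P.fc (P.rev (P.t3 a)) ∧ P.fc (P.rev (P.t3 (P.U a))) = P.fc b then h.choose else a
lemma bf_spec (Q : Quad R w m1 m2 m3 N K) (h : P.Gd m1 m2 m3 N a) : P.AG m1 m2 m3 (P.bf m1 m2 m3 N a) ∧ 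
      (P.ix a ≤ P.ix (P.bf m1 m2 m3 N a) + N ∧ P.ix (P.bf m1 m2 m3 N a) ≤ P.ix a + N) ∧ 
      P.fc (P.bf m1 m2 m3 N a) = P.fc (P.sg (P.t3 a)) ∧
      P.fc (P.U (P.bf m1 m2 m3 N a)) = P.fc (P.rev (P.t3 a)) ∧
      P.fc (P.rev (P.t3 (P.U a))) = P.fc (P.bf m1 m2 m3 N a) := by
  obtain ⟨h1, h2, h3⟩ := h
  have h4 := AG_U Q h1 h2
  obtain ⟨a1, a2, a3, a4, F⟩ := h1.fv
  obtain ⟨c1, c2, c3, c4, F'⟩ := h4.fv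
  have h5 := step Q h1 F h4 F' (by rw [← F.t3_eq]; exact h3)
  rw [← F.t3_eq, ← F'.t3_eq] at h5
  unfold bf
  grind
lemma bf_dec (Q : Quad R w m1 m2 m3 N K) (h : P.Gd m1 m2 m3 N a) (h' : P.Gd m1 m2 m3 N (P.U a)) :
    P.ix (P.bf m1 m2 m3 N (P.U a)) < P.ix (P.bf m1 m2 m3 N a) := by
  obtain ⟨x1, -, -, -, x2⟩ := bf_spec Q h
  obtain ⟨y1, -, -, y2, -⟩ := bf_spec Q h'
  obtain ⟨a1, a2, a3, a4, F⟩ := x1.fv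
  obtain ⟨c1, c2, c3, c4, G⟩ := y1.fv
  obtain ⟨z1, z2, z3⟩ := G.extU Q y1
  have : P.U (P.bf m1 m2 m3 N (P.U a)) = P.bf m1 m2 m3 N a := F.ue _ (y2.trans x2) z1 G.stU
  grind
lemma U_inj (ha : P.AG m1 m2 m3 a) {b : P.D} (hb : P.AG m1 m2 m3 b) (h : P.U a = P.U b) : a = b := by
  obtain ⟨a1, a2, a3, a4, F⟩ := ha.fv
  obtain ⟨c1, c2, c3, c4, G⟩ := hb.fv
  rw [F.U_eq, G.U_eq] at h
  have h1 := rev_inj (P.nxt.injective h)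
  exact Nx.inj F.st G.st F.n0 (h1 ▸ G.n0)
lemma t_inj (ha : P.AG m1 m2 m3 a) {b : P.D} (hb : P.AG m1 m2 m3 b) (h : P.sg (P.t3 a) = P.sg (P.t3 b)) : a = b := by
  obtain ⟨a1, a2, a3, a4, F⟩ := ha.fv
  obtain ⟨c1, c2, c3, c4, G⟩ := hb.fv
  rw [F.t3_eq, G.t3_eq] at h
  have h3 := sg_inj h
  have h2 := Nx.inj F.n1.st G.n1.st F.n2 (h3 ▸ G.n2)
  have h1 := Nx.inj F.n0.st G.n0.st F.n1 (h2 ▸ G.n1)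
  exact Nx.inj F.st G.st F.n0 (h1 ▸ G.n0)
lemma bad_card (Q : Quad R w m1 m2 m3 N K) (g : P.D → P.D) (hg : ∀ a, P.AG m1 m2 m3 a → P.fc (g a) ≠ 0)
    (hi : ∀ a b, P.AG m1 m2 m3 a → P.AG m1 m2 m3 b → g a = g b → a = b) :
    (Finset.univ.filter fun a => P.AG m1 m2 m3 a ∧ P.Yb m1 m2 m3 N (g a)).card ≤ 198 + 20 * N := by
  have h1 := sum_Yb (P := P) Q
  rw [← card_pred] at h1
  refine le_trans (Finset.card_le_card_of_injOn g ?_ ?_) (h1.trans oo)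
  · intro d hd
    grind
  · intro x hx y hy h
    grind
theorem AG_card (Q : Quad R w m1 m2 m3 N K) :
    ∑ f ∈ Finset.Icc 1 n, P.cN f (P.AG m1 m2 m3) ≤ (N + 2) * (2 * (198 + 20 * N)) := by
  rw [← card_pred]
  set T := (Finset.univ.filter fun d => P.fc d ≠ 0 ∧ P.AG m1 m2 m3 d) with hT
  set A := (Finset.univ.filter fun d => P.AG m1 m2 m3 d ∧ ¬ P.Gd m1 m2 m3 N d) with hA
  have mT : ∀ d, d ∈ T ↔ P.AG m1 m2 m3 d := by
    intro d
    rw [hT, Finset.mem_filter]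
    exact ⟨fun h => h.2.2, fun h => ⟨Finset.mem_univ _, no_bridge' Q.hs Q.hw h.1.1, h⟩⟩
  have mA : ∀ d, d ∈ A ↔ P.AG m1 m2 m3 d ∧ ¬ P.Gd m1 m2 m3 N d := by
    grind
  have hAc : A.card ≤ 2 * (198 + 20 * N) := by
    have b1 := bad_card (P := P) Q P.U (fun a ha => by
      obtain ⟨a1, a2, a3, a4, F⟩ := ha.fv
      rw [F.fcU]; exact F.e1) (fun a b ha hb => U_inj ha hb)
    have b2 := bad_card (P := P) Q (fun a => P.sg (P.t3 a)) (fun a ha => by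
      obtain ⟨a1, a2, a3, a4, F⟩ := ha.fv
      rw [F.t3_eq, F.n2.fcs]; exact F.e2) (fun a b ha hb => t_inj ha hb)
    have hsub : A ⊆ (Finset.univ.filter fun a => P.AG m1 m2 m3 a ∧ P.Yb m1 m2 m3 N (P.U a)) ∪
        (Finset.univ.filter fun a => P.AG m1 m2 m3 a ∧ P.Yb m1 m2 m3 N (P.sg (P.t3 a))) := by
      intro d hd
      rw [mA] at hd
      rw [Finset.mem_union, Finset.mem_filter, Finset.mem_filter]
      obtain ⟨h1, h2⟩ := hd
      unfold Gd at h2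
      grind
    have := (Finset.card_le_card hsub).trans (Finset.card_union_le _ _)
    omega
  refine le_trans (count_runs T A P.U (N + 2) ?_ ?_) (Nat.mul_le_mul_left _ hAc)
  · intro a ha _ b hb _ h
    exact U_inj ((mT a).1 ha) ((mT b).1 hb) h
  · intro d hd
    rw [mT] at hd
    have hex : ∃ k, ¬ P.Gd m1 m2 m3 N (P.U^[k] d) ∧ k < N + 2 := by
      by_contra hno
      push Not at hno
      have hgood : ∀ k, k < N + 2 → P.Gd m1 m2 m3 N (P.U^[k] d) := by
        grind
      have hinc : ∀ k, k < N + 2 → P.ix d + k ≤ P.ix (P.U^[k] d) ∧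
          P.ix (P.bf m1 m2 m3 N (P.U^[k] d)) + k ≤ P.ix (P.bf m1 m2 m3 N d) := by
        intro k
        induction k with
        | zero => intro _; exact ⟨le_rfl, le_rfl⟩
        | succ k ih =>
          intro hk
          obtain ⟨i1, i2⟩ := ih oo
          have g1 := hgood k oo
          have g2 := hgood (k + 1) hk
          rw [Function.iterate_succ_apply'] at g2 ⊢
          have h1 := bf_dec Q g1 g2
          obtain ⟨a1, a2, a3, a4, F⟩ := g1.1.fv
          have h2 := (F.extU Q g1.1).2.1
          omega
      have h1 := hinc (N + 1) oo
      have h2 := (bf_spec Q (hgood 0 oo)).2.1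
      have h3 := (bf_spec Q (hgood (N + 1) oo)).2.1
      rw [Function.iterate_zero, id] at h2
      omega
    obtain ⟨h1, h2⟩ := Nat.find_spec hex
    have hlt : ∀ j < Nat.find hex, P.Gd m1 m2 m3 N (P.U^[j] d) := by
      intro j hj
      have := Nat.find_min hex hj
      grind
    refine ⟨Nat.find hex, h2, ?_, ?_⟩
    · rw [mA]
      refine ⟨?_, h1⟩
      rcases Nat.eq_zero_or_pos (Nat.find hex) with h0 | h0
      · rw [h0]; exact hd
      · have h3 := hlt (Nat.find hex - 1) oo
        have h4 := AG_U Q h3.1 h3.2.1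
        rw [← Function.iterate_succ_apply' P.U, show (Nat.find hex - 1).succ = Nat.find hex by omega] at h4
        omega
    · intro j hj
      rw [mT, mA]
      exact ⟨(hlt j hj).1, fun h => h.2 (hlt j hj)⟩
theorem quad_bd (Q : Quad R w m1 m2 m3 N K) (P : Pl R n w) : K * m1 ≤ 192 * w.length + K *
    (16 * N + N * (4 * N + 1) + N * ((N + 2) * (2 * (198 + 20 * N)))) := by
  have h1 := total1 (P := P) Q
  have h2 := Nat.mul_le_mul_left K (Nat.mul_le_mul_left N (AG_card (P := P) Q))
  grind
end Pl
end P7e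
end MorseLTG
open Metric Set Filter
namespace MorseLTG
noncomputable section P7f
local notation "oo" => (by omega)
open scoped Classical
variable {S : Type*} {R : Set (Word S)}
local notation "ev" => evalWord (presGen R)
variable (R) in
structure Cfg (Γ : Set (PresentedGroup (FreeGroup.mk '' R))) (g b d a : Word S) : Prop where
  cl : ev g * ev b * ev d * ev a = 1
  hb : ∀ z ∈ Γ, ∀ u, ev g * ev b = z * ev u → b.length ≤ u.length
  ha : ∀ z ∈ Γ, ∀ u, (ev a)⁻¹ = z * ev u → a.length ≤ u.length
  hd : ∀ u, ev d = ev u → d.length ≤ u.length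
  hdd : ∀ z ∈ Γ, ∀ k ≤ d.length, ∀ u, ev g * ev b * ev (d.take k) = z * ev u → d.length ≤ u.length
lemma ev_split (w : Word S) (k : ℕ) : ev w = ev (w.take k) * ev (w.drop k) := by
  rw [← evalWord_append, List.take_append_drop]
variable {Γ : Set (PresentedGroup (FreeGroup.mk '' R))} {g b d a : Word S}
lemma Cfg.red_bd (C : Cfg R Γ g b d a) {k l : ℕ} (hk : k ≤ b.length) (hl : l ≤ d.length)
    (h : ev g * ev (b.take k) = ev g * ev b * ev (d.take l)) : Cfg R Γ g (b.take k) (d.drop l) a where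
  cl := by
    have := C.cl
    rw [ev_split d l, ← mul_assoc, ← h] at this
    omega
  hb := fun z hz u hu => by
    have := C.hb z hz (u ++ b.drop k) (by
      rw [ev_split b k, ← mul_assoc, hu, evalWord_append, mul_assoc])
    grind
  ha := C.ha
  hd := fun u hu => by
    have := C.hd (d.take l ++ u) (by rw [ev_split d l, hu, evalWord_append])
    grind
  hdd := fun z hz m hm u hu => by
    have := C.hdd z hz (l + m) (by simp at hm; omega) u (by
      rw [← hu, h, List.take_add, evalWord_append, mul_assoc, mul_assoc, mul_assoc])
    grind
lemma Cfg.red_ba (C : Cfg R Γ g b d a) {k l : ℕ} (hk : k ≤ b.length) (hl : l ≤ a.length)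
    (h : ev g * ev (b.take k) = ev g * ev b * ev d * ev (a.take l)) : Cfg R Γ g (b.take k) [] (a.drop l) where
  cl := by
    have := C.cl
    rw [ev_split a l, ← mul_assoc, ← h] at this
    simp_all
  hb := fun z hz u hu => by
    have := C.hb z hz (u ++ b.drop k) (by
      rw [ev_split b k, ← mul_assoc, hu, evalWord_append, mul_assoc])
    grind
  ha := fun z hz u hu => by
    have := C.ha z hz (u ++ wordInv (a.take l)) (by
      rw [ev_split a l, mul_inv_rev, hu, evalWord_append, evalWord_inv, mul_assoc])
    simp_all
  hd := fun u hu => by simp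
  hdd := fun z hz m hm u hu => by simp
lemma Cfg.red_da (C : Cfg R Γ g b d a) {k l : ℕ} (hk : k ≤ d.length) (hl : l ≤ a.length)
    (h : ev g * ev b * ev (d.take k) = ev g * ev b * ev d * ev (a.take l)) :
    Cfg R Γ g b (d.take k) (a.drop l) where
  cl := by
    have := C.cl
    rw [ev_split a l, ← mul_assoc, ← h] at this
    omega
  hb := C.hb
  ha := fun z hz u hu => by
    have := C.ha z hz (u ++ wordInv (a.take l)) (by
      rw [ev_split a l, mul_inv_rev, hu, evalWord_append, evalWord_inv, mul_assoc])
    simp_all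
  hd := fun u hu => by
    have := C.hd (u ++ d.drop k) (by rw [ev_split d k, hu, evalWord_append])
    simp at this ⊢; omega
  hdd := fun z hz m hm u hu => by
    have := C.hdd z hz m (by simp at hm; omega) u (by
      rw [← hu, List.take_take, min_eq_left (by simp at hm; omega)])
    grind
lemma geo_app {w : Word S} {k l : ℕ} (hkl : k ≤ l) (hl : l ≤ w.length) {u : Word S}
    (h : ev (w.take l) = ev (w.take k) * ev u) : ∃ v, v.length + l = k + u.length + w.length ∧ ev w = ev v :=
  ⟨w.take k ++ (u ++ w.drop l), by simp; omega, by
    rw [ev_split w l, h, evalWord_append, evalWord_append, mul_assoc]⟩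
lemma quad_sub {w : Word S} {m1 m2 m3 N K : ℕ} (hsc : SmallCancellation R (1 / 6))
  (hw : w ≠ []) (hs : SimpleW R w) (h12 : m1 ≤ m2) (h23 : m2 ≤ m3) (h34 : m3 ≤ w.length) (h1W : m1 < w.length)
  (g1 : GeoSide R w 0 m1) (g2 : GeoSide R w m1 m2) (g3 : GeoSide R w m2 m3) (g4 : GeoSide R w m3 w.length)
  (hK : 12 ≤ K)
  (big : ∀ i m z, i + m ≤ m1 → (w.drop i).take m ++ z ∈ symmClosure R → N ≤ m + z.length → K * m ≤ m + z.length)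
  (beta : ∀ i j u, i ≤ m1 → m1 ≤ j → j ≤ m2 → ev (w.take j) = ev (w.take i) * ev u → j ≤ m1 + u.length)
  (alpha : ∀ i j u, i ≤ m1 → m3 ≤ j → j ≤ w.length → ev (w.take j) =
    ev (w.take i) * ev u → w.length ≤ j + u.length)
  (delta : ∀ i j u, i ≤ m1 → m2 ≤ j → j ≤ m3 → ev (w.take j) =
    ev (w.take i) * ev u → 2 * N < u.length) : Quad (Rlt R (2 * w.length)) w m1 m2 m3 N K := by
  have sub := Rlt_sub R (2 * w.length)
  have cv : ∀ {i j : ℕ} {u : Word S}, evalWord (presGen (Rlt R (2 * w.length))) (w.take j) =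
    evalWord (presGen (Rlt R (2 * w.length))) (w.take i) * evalWord (presGen (Rlt R (2 * w.length))) u →
      ev (w.take j) = ev (w.take i) * ev u := fun h => by
    rw [← evalWord_append] at h ⊢
    exact eval_sub sub h
  exact ⟨sc_sub sub hsc, hw, simple_sub sub hs, h12, h23, h34, h1W, geo_sub sub g1, geo_sub sub g2, geo_sub sub g3,
    geo_sub sub g4, hK, fun r hr => hr.2, fun i m z h1 h2 => big i m z h1 (sc_mono sub h2),
    fun i j u h1 h2 h3 h => beta i j u h1 h2 h3 (cv h), fun i j u h1 h2 h3 h => alpha i j u h1 h2 h3 (cv h),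
    fun i j u h1 h2 h3 h => delta i j u h1 h2 h3 (cv h)⟩
def CN (N : ℕ) : ℕ := 16 * N + N * (4 * N + 1) + N * ((N + 2) * (2 * (198 + 20 * N))) + 10 * N
lemma Cfg.bd0 (hsc : SmallCancellation R (1 / 6)) {N K : ℕ} (hK : 12 ≤ K)
    (gg : GeoSide R g 0 g.length) (gΓ : ∀ k ≤ g.length, ev (g.take k) ∈ Γ)
    (big : ∀ i m z, i + m ≤ g.length → (g.drop i).take m ++ z ∈ symmClosure R → N ≤ m + z.length →
      K * m ≤ m + z.length)
    (C : Cfg R Γ g b d a)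
    (mn : ∀ b' d' a', Cfg R Γ g b' d' a' → b.length + d.length + a.length ≤ b'.length + d'.length + a'.length) :
    K * g.length ≤ 192 * (g.length + (b.length + d.length + a.length)) + K * CN N := by
  by_cases hm : g.length = 0
  · grind
  by_cases hnr : ∃ z ∈ Γ, ∃ k ≤ d.length, ∃ u, ev g * ev b * ev (d.take k) = z * ev u ∧ u.length ≤ 2 * N
  · obtain ⟨z, hz, k, hk, u, hu, hul⟩ := hnr
    have h1 := C.hdd z hz k hk u hu
    have h2 := C.hb z hz (u ++ wordInv (d.take k)) (by
      rw [evalWord_append, evalWord_inv, ← mul_assoc, ← hu, mul_inv_cancel_right])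
    have h3 := C.ha z hz (u ++ d.drop k) (by
      rw [evalWord_append, ← mul_assoc, ← hu, mul_assoc, ← ev_split, inv_eq_iff_eq_inv, eq_comm, inv_eq_iff_mul_eq_one]
      exact C.cl)
    have h4 := gg 0 g.length le_rfl oo le_rfl (wordInv (b ++ (d ++ a))) (by
      have := C.cl
      rw [mul_assoc, mul_assoc, ← evalWord_append, ← evalWord_append] at this
      rw [evalWord_inv, List.take_length, eq_inv_of_mul_eq_one_left this]
      simp [evalWord])
    simp at h2 h3 h4
    have h5 : K * g.length ≤ K * CN N := Nat.mul_le_mul_left _ (by unfold CN; omega)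
    omega
  push Not at hnr
  set w := g ++ (b ++ (d ++ a)) with hw
  have wl : w.length = g.length + b.length + d.length + a.length := by simp [hw]; omega
  have t1 : ∀ k ≤ g.length, w.take k = g.take k := fun k hk => by
    grind
  have t2 : ∀ k ≤ b.length, w.take (g.length + k) = g ++ b.take k := fun k hk => by
    rw [hw, List.take_length_add_append, List.take_append_of_le_length hk]
  have t3 : ∀ k ≤ d.length, w.take (g.length + b.length + k) = g ++ (b ++ d.take k) := fun k hk => by
    rw [hw, add_assoc, List.take_length_add_append, List.take_length_add_append, List.take_append_of_le_length hk]
  have t4 : ∀ k ≤ a.length, w.take (g.length + b.length + d.length + k) = g ++ (b ++ (d ++ a.take k)) := fun k hk => by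
    rw [hw, add_assoc, add_assoc, List.take_length_add_append, List.take_length_add_append,
      List.take_length_add_append]
  have e2 : ∀ k ≤ b.length, ev (w.take (g.length + k)) = ev g * ev (b.take k) := fun k hk => by
    rw [t2 k hk, evalWord_append]
  have e3 : ∀ k ≤ d.length, ev (w.take (g.length + b.length + k)) = ev g * ev b * ev (d.take k) := fun k hk => by
    rw [t3 k hk, evalWord_append, evalWord_append, mul_assoc]
  have e4 : ∀ k ≤ a.length, ev (w.take (g.length + b.length + d.length + k)) =
      ev g * ev b * ev d * ev (a.take k) := fun k hk => by
    rw [t4 k hk, evalWord_append, evalWord_append, evalWord_append, mul_assoc, mul_assoc]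
  have g1 : GeoSide R w 0 g.length := fun i j h1 h2 h3 u h => by
    rw [t1 _ h3, t1 _ oo] at h
    exact gg i j h1 h2 h3 u h
  have hΓ : ∀ k ≤ g.length, ev (w.take k) ∈ Γ := fun k hk => by grind
  have z0 : (1 : PresentedGroup (FreeGroup.mk '' R)) ∈ Γ := by simpa [evalWord] using gΓ 0 oo
  have zg : ev g ∈ Γ := by simpa using gΓ g.length le_rfl
  have g2 : GeoSide R w g.length (g.length + b.length) := fun i j h1 h2 h3 u h => by
    obtain ⟨k, rfl⟩ := Nat.exists_eq_add_of_le h1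
    obtain ⟨l, rfl⟩ := Nat.exists_eq_add_of_le (h1.trans h2)
    rw [e2 _ oo, e2 _ oo, mul_assoc] at h
    obtain ⟨v, hv, hv'⟩ := geo_app oo oo (mul_left_cancel h)
    have := C.hb _ zg v (by grind)
    omega
  have g3 : GeoSide R w (g.length + b.length) (g.length + b.length + d.length) := fun i j h1 h2 h3 u h => by
    obtain ⟨k, rfl⟩ := Nat.exists_eq_add_of_le h1
    obtain ⟨l, rfl⟩ := Nat.exists_eq_add_of_le (h1.trans h2)
    rw [e3 _ oo, e3 _ oo, mul_assoc _ _ (ev u)] at h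
    obtain ⟨v, hv, hv'⟩ := geo_app oo oo (mul_left_cancel h)
    have := C.hd v hv'
    omega
  have g4 : GeoSide R w (g.length + b.length + d.length) w.length := fun i j h1 h2 h3 u h => by
    obtain ⟨k, rfl⟩ := Nat.exists_eq_add_of_le h1
    obtain ⟨l, rfl⟩ := Nat.exists_eq_add_of_le (h1.trans h2)
    rw [e4 _ oo, e4 _ oo, mul_assoc _ _ (ev u)] at h
    obtain ⟨v, hv, hv'⟩ := geo_app oo oo (mul_left_cancel h)
    have := C.ha 1 z0 (wordInv v) (by rw [hv', evalWord_inv, one_mul])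
    simp at this
    omega
  have beta : ∀ i j u, i ≤ g.length → g.length ≤ j → j ≤ g.length + b.length →
      ev (w.take j) = ev (w.take i) * ev u → j ≤ g.length + u.length := fun i j u h1 h2 h3 h => by
    obtain ⟨k, rfl⟩ := Nat.exists_eq_add_of_le h2
    rw [e2 _ oo] at h
    have := C.hb _ (hΓ i h1) (u ++ b.drop k) (by
      rw [ev_split b k, ← mul_assoc, h, evalWord_append, mul_assoc])
    grind
  have alpha : ∀ i j u, i ≤ g.length → g.length + b.length + d.length ≤ j → j ≤ w.length →
      ev (w.take j) = ev (w.take i) * ev u → w.length ≤ j + u.length := fun i j u h1 h2 h3 h => by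
    obtain ⟨k, rfl⟩ := Nat.exists_eq_add_of_le h2
    rw [e4 _ oo] at h
    have := C.ha _ (hΓ i h1) (u ++ wordInv (a.take k)) (by
      rw [evalWord_append, evalWord_inv, ← mul_assoc, ← h, mul_inv_cancel_right]
      exact (eq_inv_of_mul_eq_one_left C.cl).symm)
    simp at this; omega
  have delta : ∀ i j u, i ≤ g.length → g.length + b.length ≤ j → j ≤ g.length + b.length + d.length →
      ev (w.take j) = ev (w.take i) * ev u → 2 * N < u.length := fun i j u h1 h2 h3 h => by
    obtain ⟨k, rfl⟩ := Nat.exists_eq_add_of_le h2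
    rw [e3 _ oo] at h
    exact hnr _ (hΓ i h1) k oo u h
  have null : ev w = 1 := by
    rw [hw, evalWord_append, evalWord_append, evalWord_append, ← mul_assoc, ← mul_assoc]; exact C.cl
  have nd : ∀ i j, i ≤ g.length → g.length + b.length ≤ j → j ≤ g.length + b.length + d.length →
      ev (w.take j) ≠ ev (w.take i) := fun i j h1 h2 h3 h => by
    have := delta i j [] h1 h2 h3 (by rw [h]; simp [evalWord])
    grind
  have h1W : g.length < w.length := by
    by_contra hc
    exact nd g.length g.length le_rfl oo oo rfl
  have key : ∀ k l, k < l → l < w.length → ev (w.take k) = ev (w.take l) → False := fun k l hkl hl h => by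
    have h' : ev (w.take l) = ev (w.take k) * ev [] := by rw [h]; simp [evalWord]
    rcases le_or_gt k g.length with a1 | a1
    · rcases le_or_gt l (g.length + b.length) with a2 | a2
      · rcases le_or_gt l g.length with a3 | a3
        · have := g1 k l oo oo a3 _ h'
          simp at this; omega
        · have := beta k l _ a1 oo a2 h'
          grind
      · rcases le_or_gt l (g.length + b.length + d.length) with a3 | a3
        · grind
        · have := alpha k l _ a1 oo oo h'
          grind
    rcases le_or_gt k (g.length + b.length) with a2 | a2
    · rcases le_or_gt l (g.length + b.length) with a3 | a3
      · have := g2 k l oo oo a3 _ h'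
        simp at this; omega
      obtain ⟨k, rfl⟩ := Nat.exists_eq_add_of_le a1.le
      rw [e2 _ oo] at h
      rcases le_or_gt l (g.length + b.length + d.length) with a4 | a4
      · obtain ⟨l, rfl⟩ := Nat.exists_eq_add_of_le a3.le
        rw [e3 _ oo] at h
        have := mn _ _ _ (C.red_bd oo oo h)
        simp at this; omega
      · obtain ⟨l, rfl⟩ := Nat.exists_eq_add_of_le a4.le
        rw [e4 _ oo] at h
        have := mn _ _ _ (C.red_ba oo oo h)
        simp at this; omega
    rcases le_or_gt k (g.length + b.length + d.length) with a3 | a3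
    · rcases le_or_gt l (g.length + b.length + d.length) with a4 | a4
      · have := g3 k l oo oo a4 _ h'
        simp at this; omega
      obtain ⟨k, rfl⟩ := Nat.exists_eq_add_of_le a2.le
      obtain ⟨l, rfl⟩ := Nat.exists_eq_add_of_le a4.le
      rw [e3 _ oo, e4 _ oo] at h
      have := mn _ _ _ (C.red_da oo oo h)
      simp at this; omega
    · have := g4 k l oo oo oo _ h'
      simp at this; omega
  have hs : SimpleW R w := by
    refine ⟨fun i hi j hj h => ?_, fun x hx => ?_⟩
    · grind
    · have h2 : w.length = 2 := by rw [hx]; rfl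
      have h3 : g.length = 1 := by omega
      rcases Nat.lt_or_ge (g.length + b.length) 2 with h4 | h4
      · grind
      · exact nd 0 (g.length + b.length) oo le_rfl oo (by
          rw [show g.length + b.length = w.length by omega, List.take_length, null]; simp [evalWord])
  have hw0 : w ≠ [] := fun h => by grind
  have Q : Quad (Rlt R (2 * w.length)) w g.length (g.length + b.length) (g.length + b.length + d.length) N K := by
    refine quad_sub hsc hw0 hs oo oo oo h1W g1 g2 g3 g4 hK ?_ beta alpha delta
    intro i m z him hz hN
    refine big i m z him ?_ hN
    rwa [hw, List.drop_append_of_le_length oo, List.take_append_of_le_length (by simp; omega)] at hz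
  obtain ⟨n, ⟨P⟩⟩ := exists_pl' hsc hw0 null
  have := Pl.quad_bd Q P
  refine this.trans ?_
  rw [wl]
  refine Nat.add_le_add oo (Nat.mul_le_mul_left _ ?_)
  unfold CN
  omega
lemma Cfg.bd (hsc : SmallCancellation R (1 / 6)) {N K : ℕ} (hK : 12 ≤ K)
    (gg : GeoSide R g 0 g.length) (gΓ : ∀ k ≤ g.length, ev (g.take k) ∈ Γ)
    (big : ∀ i m z, i + m ≤ g.length → (g.drop i).take m ++ z ∈ symmClosure R → N ≤ m + z.length →
      K * m ≤ m + z.length)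
    (C : Cfg R Γ g b d a) :
    K * g.length ≤ 192 * (g.length + (b.length + d.length + a.length)) + K * CN N := by
  have hex : ∃ L, ∃ b d a, Cfg R Γ g b d a ∧ b.length + d.length + a.length = L := ⟨_, b, d, a, C, rfl⟩
  obtain ⟨b', d', a', C', h⟩ := Nat.find_spec hex
  have h1 := C'.bd0 hsc hK gg gΓ big (fun b2 d2 a2 C2 => by
    rw [h]; exact Nat.find_min' hex ⟨b2, d2, a2, C2, rfl⟩)
  have h2 := Nat.find_min' hex ⟨b, d, a, C, rfl⟩
  omega
end P7f
end MorseLTG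
open Metric Set Filter
namespace MorseLTG
noncomputable section P8
local notation "oo" => (by omega)
open scoped Classical
variable {S : Type*} {R : Set (Word S)}
abbrev Gp (R : Set (Word S)) := PresentedGroup (FreeGroup.mk '' R)
local notation "ev" => evalWord (presGen R)
lemma ev_nil : ev [] = 1 := by simp [evalWord]
lemma ev_surj (g : Gp R) : ∃ w, ev w = g := by
  obtain ⟨x, rfl⟩ := QuotientGroup.mk_surjective g
  obtain ⟨w, rfl⟩ := Quot.exists_rep x
  exact ⟨w, evalPres R w⟩
lemma wd_ex (g h : Gp R) : ∃ w, w.length = wordDist (presGen R) g h ∧ g * ev w = h := by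
  have : {n : ℕ | ∃ w : Word S, w.length = n ∧ g * ev w = h}.Nonempty := by
    obtain ⟨w, hw⟩ := ev_surj (g⁻¹ * h)
    exact ⟨_, w, rfl, by simp_all⟩
  exact Nat.sInf_mem this
lemma wd_le {g h : Gp R} {w : Word S} (e : h = g * ev w) : wordDist (presGen R) g h ≤ w.length := Nat.sInf_le ⟨w, rfl, e.symm⟩
lemma wd_self (g : Gp R) : wordDist (presGen R) g g = 0 := by
  have := wd_le (g := g) (h := g) (w := []) (by simp_all)
  grind
lemma wd_comm (g h : Gp R) : wordDist (presGen R) g h = wordDist (presGen R) h g := by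
  have key : ∀ g h : Gp R, wordDist (presGen R) h g ≤ wordDist (presGen R) g h := fun g h => by
    obtain ⟨w, hw, e⟩ := wd_ex g h
    have := wd_le (g := h) (h := g) (w := wordInv w) (by rw [evalWord_inv, ← e, mul_inv_cancel_right])
    simp_all
  grind
lemma wd_tri (g h k : Gp R) : wordDist (presGen R) g k ≤ wordDist (presGen R) g h + wordDist (presGen R) h k := by
  obtain ⟨w, hw, e⟩ := wd_ex g h
  obtain ⟨v, hv, e'⟩ := wd_ex h k
  have := wd_le (g := g) (h := k) (w := w ++ v) (by rw [evalWord_append, ← mul_assoc, e, e'])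
  grind
lemma wd_zero {g h : Gp R} (e : wordDist (presGen R) g h = 0) : g = h := by
  obtain ⟨w, hw, e'⟩ := wd_ex g h
  simp_all
variable (R) in
def Along (γ : ℤ → Gp R) (i : ℤ) (x : Word S) : Prop := ∀ k : ℕ, k ≤ x.length → γ (i + k) = γ i * ev (x.take k)
variable {γ : ℤ → Gp R} {I : Set ℤ}
lemma Along.sub {i : ℤ} {x : Word S} (h : Along R γ i x) {j m : ℕ} (hj : j + m ≤ x.length) :
    Along R γ (i + j) ((x.drop j).take m) := fun k hk => by
  simp at hk
  have h1 := h (j + k) oo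
  rw [h j oo, mul_assoc, ← evalWord_append, List.take_take, min_eq_left oo, ← List.take_add, ← h1]
  grind
lemma Along.exists (hI : I.OrdConnected) (hγ : DGeodesicOn (presGen R) I γ) {i : ℤ} (hi : i ∈ I) :
    ∀ m : ℕ, i + m ∈ I → ∃ x, x.length = m ∧ Along R γ i x := by
  intro m
  induction m with
  | zero => exact fun _ => ⟨[], rfl, fun k hk => by simp at hk; subst hk; simp [ev_nil]⟩
  | succ m ih =>
    intro hm
    have hm' : i + m ∈ I := hI.out hi hm ⟨by omega, by omega⟩
    obtain ⟨x, hx, ha⟩ := ih hm'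
    obtain ⟨v, hv, e⟩ := wd_ex (γ (i + m)) (γ (i + (m + 1 : ℕ)))
    have h1 := hγ _ hm' _ hm
    have h2 : v.length = 1 := by
      grind
    refine ⟨x ++ v, by simp [hx, h2], fun k hk => ?_⟩
    simp [hx, h2] at hk
    rcases Nat.lt_or_ge k (m + 1) with h3 | h3
    · rw [List.take_append_of_le_length oo]
      exact ha k oo
    · have : k = m + 1 := by omega
      subst this
      have h4 := ha m oo
      rw [← hx, List.take_length] at h4
      rw [List.take_of_length_le (by simp; omega), evalWord_append, ← mul_assoc, ← h4, hx, e]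
variable (R) in
def Big (γ : ℤ → Gp R) (I : Set ℤ) (K N : ℕ) : Prop := ∀ i x z, i ∈ I → i + (x.length : ℤ) ∈ I → Along R γ i x →
  x ++ z ∈ symmClosure R → N ≤ x.length + z.length → K * x.length ≤ x.length + z.length
lemma projA (hsc : SmallCancellation R (1 / 6)) (hI : I.OrdConnected) (hγ : DGeodesicOn (presGen R) I γ)
    {K N : ℕ} (hK : 12 ≤ K) (hB : Big R γ I K N) {x y : Gp R} {i : ℤ} {m : ℕ} (hi : i ∈ I) (hj : i + m ∈ I)
    (hx : ∀ l ∈ I, wordDist (presGen R) x (γ i) ≤ wordDist (presGen R) x (γ l)) (hy : ∀ l ∈ I, wordDist (presGen R) y (γ (i + m)) ≤ wordDist (presGen R) y (γ l))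
    (hz : ∀ z, ∀ l ∈ I, wordDist (presGen R) x z + wordDist (presGen R) z y = wordDist (presGen R) x y → wordDist (presGen R) x y ≤ wordDist (presGen R) z (γ l)) :
    K * m ≤ 192 * (m + (wordDist (presGen R) x (γ i) + wordDist (presGen R) y (γ (i + m)) + wordDist (presGen R) x y)) + K * CN N := by
  obtain ⟨g, hg, ag⟩ := Along.exists hI hγ hi m hj
  obtain ⟨b, hb, eb⟩ := wd_ex (γ (i + m)) y
  obtain ⟨d, hd, ed⟩ := wd_ex y x
  obtain ⟨a, ha, ea⟩ := wd_ex x (γ i)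
  have eg : γ (i + m) = γ i * ev g := by have := ag m oo; rwa [← hg, List.take_length, hg] at this
  have inI : ∀ k : ℕ, k ≤ m → i + k ∈ I := fun k hk => hI.out hi hj ⟨by omega, by omega⟩
  have C : Cfg R {z | ∃ l ∈ I, z = (γ i)⁻¹ * γ l} g b d a := by
    refine ⟨?_, ?_, ?_, ?_, ?_⟩
    · rw [← mul_right_inj (γ i), mul_one, ← mul_assoc, ← mul_assoc, ← mul_assoc, ← eg, eb, ed, ea]
    · rintro _ ⟨l, hl, rfl⟩ u hu
      have h1 : y = γ l * ev u := by
        rw [← eb, eg, mul_assoc, hu]; group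
      have := hy l hl
      rw [wd_comm, ← hb, wd_comm] at this
      exact this.trans (wd_le h1)
    · rintro _ ⟨l, hl, rfl⟩ u hu
      have h1 : x = γ l * ev u := by
        rw [← mul_right_inj (γ i)⁻¹, ← mul_assoc, ← hu, ← ea]; group
      have := hx l hl
      rw [← ha, wd_comm] at this
      exact this.trans (wd_le h1)
    · intro u hu
      rw [hd]; exact wd_le (by grind)
    · rintro _ ⟨l, hl, rfl⟩ k hk u hu
      have h1 : γ i * (ev g * ev b * ev (d.take k)) = γ l * ev u := by rw [hu]; group
      rw [← mul_assoc, ← mul_assoc, ← eg, eb] at h1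
      have h2 : x = (y * ev (d.take k)) * ev (d.drop k) := by rw [mul_assoc, ← ev_split, ed]
      have h3 := wd_le h2
      have h4 : wordDist (presGen R) y (y * ev (d.take k)) ≤ _ := wd_le rfl
      have h5 := wd_tri y (y * ev (d.take k)) x
      simp at h3 h4
      rw [hd, wd_comm]
      refine le_trans (hz (y * ev (d.take k)) l hl ?_) ?_
      · rw [wd_comm x, wd_comm _ y, wd_comm x y]; omega
      · rw [wd_comm]; exact wd_le h1
  have := C.bd (N := N) hsc hK ?_ ?_ ?_
  · rw [hg, hb, hd, ha, wd_comm _ y, wd_comm y x] at this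
    omega
  · intro k l _ hkl hl u hu
    have h1 : γ (i + l) = γ (i + k) * ev u := by rw [ag l hl, ag k oo, hu, mul_assoc]
    have h2 := wd_le h1
    have h3 := hγ _ (inI k oo) _ (inI l oo)
    rw [abs_of_nonneg oo] at h3
    omega
  · intro k hk
    exact ⟨i + k, inI k oo, by rw [ag k hk]; group⟩
  · intro k l z hkl hz hN
    have hl : ((g.drop k).take l).length = l := by simp; omega
    have := hB (i + k) _ z (inI k oo) (by grind)
      (ag.sub hkl) hz oo
    grind
lemma proj (hsc : SmallCancellation R (1 / 6)) (hI : I.OrdConnected) (hγ : DGeodesicOn (presGen R) I γ)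
    {K N : ℕ} (hK : 12 ≤ K) (hB : Big R γ I K N) {x y : Gp R} {i j : ℤ} (hi : i ∈ I) (hj : j ∈ I)
    (hx : ∀ l ∈ I, wordDist (presGen R) x (γ i) ≤ wordDist (presGen R) x (γ l)) (hy : ∀ l ∈ I, wordDist (presGen R) y (γ j) ≤ wordDist (presGen R) y (γ l))
    (hd : 2 * wordDist (presGen R) x y ≤ wordDist (presGen R) x (γ i)) :
    K * (j - i).natAbs ≤ 1152 * wordDist (presGen R) x (γ i) + K * CN N := by
  have h1 := hy i hi
  have h2 := wd_tri y x (γ i)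
  have h3 := wd_comm y x
  have hn : (j - i).natAbs ≤ wordDist (presGen R) x (γ i) + wordDist (presGen R) y (γ j) + wordDist (presGen R) x y := by
    have h4 := hγ i hi j hj
    rw [Int.abs_eq_natAbs] at h4
    have h5 := wd_tri (γ i) x (γ j)
    have h6 := wd_tri x y (γ j)
    have h7 := wd_comm x (γ i)
    omega
  have hz : ∀ z, ∀ l ∈ I, wordDist (presGen R) x z + wordDist (presGen R) z y = wordDist (presGen R) x y → wordDist (presGen R) x y ≤ wordDist (presGen R) z (γ l) := fun z l hl h => by
    have := wd_tri x z (γ l)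
    grind
  rcases le_total i j with h | h
  · obtain ⟨m, rfl⟩ := Int.le.dest h
    have := projA hsc hI hγ hK hB hi hj hx hy hz
    grind
  · obtain ⟨m, rfl⟩ := Int.le.dest h
    have := projA hsc hI hγ hK hB hj hi hy hx (fun z l hl h => by
      rw [wd_comm y x]
      exact hz z l hl (by rw [wd_comm x z, wd_comm z y, add_comm, h, wd_comm]))
    grind
end P8
end MorseLTG
open Metric Set Filter
namespace MorseLTG
noncomputable section P9
local notation "oo" => (by omega)
open scoped Classical
variable {S : Type*} {R : Set (Word S)} {γ : ℤ → Gp R} {I : Set ℤ}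
local notation "ev" => evalWord (presGen R)
lemma path_len {q : ℤ → Gp R} {a b : ℤ} (hp : DIsPath (presGen R) (Icc a b) q) (m : ℤ) : ∀ c : ℕ,
    a ≤ m → m + c ≤ b → wordDist (presGen R) (q m) (q (m + c)) ≤ c := by
  intro c
  induction c with
  | zero => intro _ _; simp [wd_self]
  | succ c ih =>
    intro h1 h2
    push_cast at h2
    have h3 := ih h1 oo
    have h4 := hp (m + c) ⟨by omega, by omega⟩ ⟨by omega, by omega⟩
    have h5 := wd_tri (q m) (q (m + c)) (q (m + c + 1))
    grind
def D0 (k N : ℕ) : ℕ := 6918 * k * CN N + 2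
def Fk (k N : ℕ) : ℕ := D0 k N + (2 * (k * (2 * D0 k N + 1)) + 2 * (k * k) + D0 k N)
lemma Big.mono {J : Set ℤ} {K N : ℕ} (h : Big R γ I K N) (hJ : J ⊆ I) : Big R γ J K N :=
  fun i x z hi hj => h i x z (hJ hi) (hJ hj)
lemma exc (hsc : SmallCancellation R (1 / 6)) {s t : ℤ} (hst : s ≤ t)
    (hγ : DGeodesicOn (presGen R) (Icc s t) γ) {k N : ℕ} (hk : 1 ≤ k) (hB : Big R γ (Icc s t) (6918 * k) N)
    {q : ℤ → Gp R} {a b : ℤ} (hp : DIsPath (presGen R) (Icc a b) q)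
    (hq : ∀ m ∈ Icc a b, ∀ n ∈ Icc a b, (n - m).natAbs ≤ k * wordDist (presGen R) (q m) (q n) + k * k)
    (qa : q a = γ s) (qb : q b = γ t) {n : ℤ} (hn : n ∈ Icc a b) :
    ∃ l ∈ Icc s t, wordDist (presGen R) (q n) (γ l) ≤ Fk k N := by
  have hmin : ∀ n : ℤ, ∃ l ∈ Icc s t, ∀ l' ∈ Icc s t,
      wordDist (presGen R) (q n) (γ l) ≤ wordDist (presGen R) (q n) (γ l') := fun n =>
    Set.exists_min_image (Icc s t) (fun l => wordDist (presGen R) (q n) (γ l)) (Set.finite_Icc s t)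
      ⟨s, le_rfl, hst⟩
  choose π hπ hπm using hmin
  obtain ⟨e, he⟩ : ∃ e : ℤ → ℕ, ∀ n, e n = wordDist (presGen R) (q n) (γ (π n)) := ⟨_, fun _ => rfl⟩
  have lip : ∀ m n, e m ≤ e n + wordDist (presGen R) (q m) (q n) := fun m n => by
    rw [he, he]
    have := hπm m (π n) (hπ n)
    have := wd_tri (q m) (q n) (γ (π n))
    omega
  have ea : e a = 0 := by
    have := hπm a s ⟨le_rfl, hst⟩
    rw [qa, wd_self] at this
    grind
  have eb : e b = 0 := by
    have := hπm b t ⟨hst, le_rfl⟩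
    rw [qb, wd_self] at this
    grind
  refine ⟨π n, hπ n, ?_⟩
  rw [← he]
  obtain ⟨D, hD⟩ : ∃ D, D = D0 k N := ⟨_, rfl⟩
  unfold Fk
  rw [← hD]
  obtain ⟨ha, hb⟩ := hn
  rcases le_or_gt (e n) D with h | h
  · omega
  have exb : ∃ c : ℕ, n + c ≤ b ∧ e (n + c) ≤ D :=
    ⟨(b - n).toNat, by omega, by grind⟩
  have exa : ∃ c : ℕ, a ≤ n - c ∧ e (n - c) ≤ D :=
    ⟨(n - a).toNat, by omega, by rw [show n - ((n - a).toNat : ℤ) = a by omega, ea]; omega⟩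
  obtain ⟨hb1, hb2⟩ := Nat.find_spec exb
  obtain ⟨ha1, ha2⟩ := Nat.find_spec exa
  have hbm := fun c => Nat.find_min (m := c) exb
  have ham := fun c => Nat.find_min (m := c) exa
  generalize Nat.find exb = cb at *
  generalize Nat.find exa = ca at *
  have ca1 : 1 ≤ ca := by
    grind
  have far : ∀ m : ℤ, n - ca < m → m < n + cb → D < e m := fun m h1 h2 => by
    by_contra hc
    rcases le_total n m with h3 | h3
    · refine hbm (m - n).toNat oo ⟨by omega, ?_⟩
      rw [show n + ((m - n).toNat : ℤ) = m by omega]; omega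
    · refine ham (n - m).toNat oo ⟨by omega, ?_⟩
      rw [show n - ((n - m).toNat : ℤ) = m by omega]; omega
  have hKC : 6918 * k * CN N + 2 ≤ D := by rw [hD]; rfl
  have claim : ∀ c : ℕ, ∀ m : ℤ, m + c = n + cb → n - ca < m →
      6918 * k * (π (n + cb) - π m).natAbs ≤ 3459 * c + 2305 * D := by
    intro c
    induction c using Nat.strong_induction_on with
    | _ c ih =>
    intro m hm hm'
    rcases Nat.eq_zero_or_pos c with h0 | h0
    · grind
    have hf := far m hm' oo
    have pj : ∀ d : ℕ, d ≤ c → 2 * d ≤ e m →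
        6918 * k * (π (m + d) - π m).natAbs ≤ 1152 * e m + 6918 * k * CN N := fun d hd h2 => by
      have h3 := path_len hp m d oo oo
      have := proj hsc Set.ordConnected_Icc hγ oo hB (hπ m) (hπ (m + d)) (hπm m) (hπm (m + d))
        (by grind)
      grind
    rcases le_or_gt (2 * c) (e m) with h1 | h1
    · have h2 := pj c le_rfl h1
      have h3 := lip m (m + c)
      have h4 := path_len hp m c oo oo
      grind
    · obtain ⟨h, hh⟩ : ∃ h, h = e m / 2 := ⟨_, rfl⟩
      have h2 := pj h oo oo
      have h3 := ih (c - h) oo (m + h) oo oo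
      have h4 : (π (n + cb) - π m).natAbs ≤ (π (n + cb) - π (m + h)).natAbs + (π (m + h) - π m).natAbs := by omega
      have h5 := Nat.mul_le_mul_left (6918 * k) h4
      rw [mul_add] at h5
      omega
  obtain ⟨a1, hA⟩ : ∃ a1, a1 = n - ca + 1 := ⟨_, rfl⟩
  have c1 := claim (cb + ca - 1) a1 oo oo
  have e1 : e a1 ≤ D + 1 := by
    have h1 := lip a1 (n - ca)
    have h2 := path_len hp (n - ca) 1 ha1 oo
    rw [wd_comm] at h2
    grind
  have q1 := hq a1 ⟨by omega, by omega⟩ (n + cb) ⟨by omega, by omega⟩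
  have d1 : wordDist (presGen R) (q a1) (q (n + cb)) ≤ 2 * D + 1 + (π (n + cb) - π a1).natAbs := by
    have h1 := wd_tri (q a1) (γ (π a1)) (q (n + cb))
    have h2 := wd_tri (γ (π a1)) (γ (π (n + cb))) (q (n + cb))
    have h3 := wd_comm (q (n + cb)) (γ (π (n + cb)))
    have h4 := hγ _ (hπ a1) _ (hπ (n + cb))
    rw [Int.abs_eq_natAbs] at h4
    rw [he] at e1 hb2
    omega
  have d2 := Nat.mul_le_mul_left k d1
  have h1 := lip n (n + cb)
  have h2 := path_len hp n cb oo oo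
  generalize (π (n + cb) - π a1).natAbs = p at *
  rw [mul_add] at d2
  have h3 : 6918 * k * p = 6918 * (k * p) := by ring
  omega
lemma gauge (F : ℕ → ℕ) : ∃ M : ℝ → ℝ, IsMorseGauge M ∧ ∀ t : ℝ, 1 ≤ t → (F ⌈t⌉₊ : ℝ) ≤ M t := by
  set H : ℝ → ℝ := fun s => ∑ j ∈ Finset.range (⌊s⌋₊ + 1), (F j : ℝ) with hH
  have mono : Monotone H := fun s t h => by
    refine Finset.sum_le_sum_of_subset_of_nonneg ?_ fun _ _ _ => by positivity
    have := Nat.floor_le_floor h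
    grind
  have nn : ∀ s, 0 ≤ H s := fun s => Finset.sum_nonneg fun _ _ => by positivity
  have ii : ∀ a b, IntervalIntegrable H MeasureTheory.volume a b := fun a b => mono.intervalIntegrable
  refine ⟨fun t => ∫ s in (0 : ℝ)..(t + 2), H s, ⟨?_, ?_, ?_⟩, ?_⟩
  · intro s hs t ht h
    simp only [Set.mem_Ici] at hs ht
    exact intervalIntegral.integral_mono_interval le_rfl (by linarith) (by linarith)
      (Filter.Eventually.of_forall nn) (ii _ _)
  · have := intervalIntegral.continuous_primitive ii 0
    exact (this.comp (continuous_id.add continuous_const)).continuousOn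
  · intro t ht
    exact intervalIntegral.integral_nonneg (by linarith) fun s _ => nn s
  · intro t ht
    have h1 : (F ⌈t⌉₊ : ℝ) ≤ H (t + 1) := by
      refine Finset.single_le_sum (f := fun j => (F j : ℝ)) (fun _ _ => by positivity) ?_
      have := Nat.ceil_le_floor_add_one t
      rw [Finset.mem_range, Nat.floor_add_one (by linarith)]
      omega
    have h2 : ∫ s in (t + 1)..(t + 2), H (t + 1) ≤ ∫ s in (t + 1)..(t + 2), H s :=
      intervalIntegral.integral_mono_on (by linarith) (by simp) (ii _ _) fun s hs => mono hs.1
    have h3 : ∫ s in (t + 1)..(t + 2), H s ≤ ∫ s in (0 : ℝ)..(t + 2), H s :=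
      intervalIntegral.integral_mono_interval (by linarith) (by linarith) le_rfl
        (Filter.Eventually.of_forall nn) (ii _ _)
    rw [intervalIntegral.integral_const, show t + 2 - (t + 1) = 1 by ring, one_smul] at h2
    grind
lemma morseB (hsc : SmallCancellation R (1 / 6)) (Nf : ℕ → ℕ) : ∃ M, IsMorseGauge M ∧
    ∀ I : Set ℤ, I.OrdConnected → ∀ γ : ℤ → Gp R, DGeodesicOn (presGen R) I γ →
      (∀ K, Big R γ I K (Nf K)) → DMorseOn (presGen R) M I γ := by
  obtain ⟨M, hM, hF⟩ := gauge fun k => Fk k (Nf (6918 * k))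
  refine ⟨M, hM, fun I hI γ hγ hB Q hQ s hs t ht hst q a b hab hq qa qb n hn => ?_⟩
  have sub : Icc s t ⊆ I := hI.out hs ht
  have hk : 1 ≤ ⌈Q⌉₊ := Nat.one_le_ceil_iff.2 (by linarith)
  have hc := Nat.le_ceil Q
  obtain ⟨l, hl, h⟩ := exc hsc hst (fun m hm n hn => hγ m (sub hm) n (sub hn)) hk
    ((hB (6918 * ⌈Q⌉₊)).mono sub) hq.1 (fun m hm n hn => by
      have h1 := (hq.2 m hm n hn).1
      have h2 : (((n - m).natAbs : ℕ) : ℝ) = |(n : ℝ) - m| := by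
        simp_all
      have h3 : |(n : ℝ) - m| ≤ Q * wordDist (presGen R) (q m) (q n) + Q * Q := by
        rw [sub_le_iff_le_add, div_le_iff₀ (by linarith)] at h1
        linarith
      have h4 : (((n - m).natAbs : ℕ) : ℝ) ≤ ((⌈Q⌉₊ * wordDist (presGen R) (q m) (q n) + ⌈Q⌉₊ * ⌈Q⌉₊ : ℕ) : ℝ) := by
        rw [h2]
        push_cast
        refine h3.trans ?_
        gcongr
      exact_mod_cast h4) qa qb hn
  exact ⟨l, hl, le_trans (by exact_mod_cast h) (hF Q hQ)⟩
lemma wd_cx (hsc : SmallCancellation R (1 / 6)) {a b : Word S} (hab : a ++ b ∈ symmClosure R) (g : Gp R) :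
    min a.length b.length ≤ wordDist (presGen R) g (g * ev a) := by
  obtain ⟨s, hs, e⟩ := wd_ex g (g * ev a)
  rw [← hs]
  exact cx hsc hab (mul_left_cancel e)
lemma morseA (hsc : SmallCancellation R (1 / 6)) {M : ℝ → ℝ} {i : ℤ} {x y : Word S} (ha : Along R γ i x)
    (hγ : DGeodesicOn (presGen R) (Icc i (i + x.length)) γ)
    (hM : DMorseOn (presGen R) M (Icc i (i + x.length)) γ) (hr : x ++ y ∈ symmClosure R) {k : ℕ} (hk : 1 ≤ k)
    (hxk : x.length + y.length ≤ k * x.length) : (x.length + y.length : ℝ) ≤ 4 * M k + 2 := by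
  set v := wordInv y with hv
  have vl : v.length = y.length := by simp [hv]
  have ex : γ (i + x.length) = γ i * ev v := by
    rw [ha _ le_rfl, List.take_length, hv, evalWord_inv, mul_right_inj]
    have := eval_sc hr
    rw [evalWord_append] at this
    exact eq_inv_of_mul_eq_one_left this
  have hxy : x.length ≤ y.length := by
    have h1 := hγ i ⟨le_rfl, by omega⟩ (i + x.length) ⟨by omega, le_rfl⟩
    have h2 := wd_le ex
    grind
  have hvr : v ++ wordInv x ∈ symmClosure R := by
    have := sc_inv hr
    simp_all
  set q : ℤ → Gp R := fun m => γ i * ev (v.take m.toNat) with hq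
  have key : ∀ m l : ℕ, m ≤ l → l ≤ y.length →
      min (l - m) x.length ≤ wordDist (presGen R) (q m) (q l) ∧ wordDist (presGen R) (q m) (q l) ≤ l - m := by
    intro m l hml hl
    obtain ⟨v1, v2, v3, e, l1, l2, t1, t2⟩ := split3 v hml oo
    have hql : q l = q m * ev v2 := by
      simp only [hq, Int.toNat_natCast]
      rw [t1, t2, evalWord_append, mul_assoc]
    rw [hql]
    constructor
    · have h1 : v2 ++ (v3 ++ wordInv x ++ v1) ∈ symmClosure R := by
        rw [e] at hvr
        have : v1 ++ (v2 ++ (v3 ++ wordInv x)) ∈ symmClosure R := by grind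
        have := sc_comm this
        grind
      have h2 := wd_cx hsc h1 (q m)
      simp at h2
      omega
    · exact (wd_le rfl).trans l2.le
  have hqg : DQGeoOn (presGen R) k (Icc 0 (y.length : ℤ)) q := by
    constructor
    · rintro n ⟨h1, -⟩ ⟨-, h2⟩
      have := (key n.toNat (n.toNat + 1) oo oo).2
      push_cast at this
      rw [Int.toNat_of_nonneg h1] at this
      omega
    · have main : ∀ m l : ℕ, m ≤ l → l ≤ y.length →
          |((l : ℤ) : ℝ) - ((m : ℤ) : ℝ)| / (k : ℝ) - k ≤ (wordDist (presGen R) (q m) (q l) : ℝ) ∧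
          (wordDist (presGen R) (q m) (q l) : ℝ) ≤ (k : ℝ) * |((l : ℤ) : ℝ) - ((m : ℤ) : ℝ)| + k := by
        intro m l hml hl
        obtain ⟨h1, h2⟩ := key m l hml hl
        obtain ⟨c, rfl⟩ := Nat.exists_eq_add_of_le hml
        have h3 : |(((m + c : ℕ) : ℤ) : ℝ) - ((m : ℤ) : ℝ)| = c := by push_cast; simp
        rw [h3]
        generalize wordDist (presGen R) (q m) (q (m + c : ℕ)) = d at *
        have hk' : (1 : ℝ) ≤ k := by exact_mod_cast hk
        constructor
        · have h4 : c ≤ k * d := by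
            rcases le_or_gt c x.length with h | h
            · have : c ≤ d := by omega
              nlinarith
            · have : x.length ≤ d := by omega
              nlinarith
          have h5 : (c : ℝ) ≤ k * d := by exact_mod_cast h4
          have h6 : (c : ℝ) / k ≤ d := by rw [div_le_iff₀ (by linarith)]; linarith
          linarith
        · have h4 : (d : ℝ) ≤ c := by exact_mod_cast (by omega : d ≤ c)
          have : (0 : ℝ) ≤ c := by positivity
          nlinarith
      rintro m ⟨hm, hm'⟩ n ⟨hn, hn'⟩
      obtain ⟨m, rfl⟩ := Int.eq_ofNat_of_zero_le hm
      obtain ⟨n, rfl⟩ := Int.eq_ofNat_of_zero_le hn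
      rcases le_total m n with h | h
      · grind
      · rw [abs_sub_comm, wd_comm]
        grind
  obtain ⟨l, ⟨hl1, hl2⟩, hl⟩ := hM k (by exact_mod_cast hk) i ⟨le_rfl, by omega⟩ (i + x.length) ⟨by omega, le_rfl⟩
    oo q 0 y.length oo hqg (by simp [hq, ev_nil])
    (by simp only [hq, Int.toNat_natCast]; rw [ex, ← vl, List.take_length]) ((y.length / 2 : ℕ) : ℤ)
    ⟨by omega, by omega⟩
  have low : y.length / 2 ≤ wordDist (presGen R) (q ((y.length / 2 : ℕ) : ℤ)) (γ l) := by
    obtain ⟨m, hm⟩ := Int.le.dest hl1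
    have hmx : m ≤ x.length := by omega
    have hgl : γ l = γ i * ev (x.take m) := by rw [← hm]; exact ha m hmx
    obtain ⟨m0, h0⟩ : ∃ m0, m0 = y.length / 2 := ⟨_, rfl⟩
    rw [← h0]
    have hy : y = y.take (y.length - m0) ++ y.drop (y.length - m0) := (List.take_append_drop _ _).symm
    generalize e1 : y.take (y.length - m0) = y1 at hy
    generalize e2 : y.drop (y.length - m0) = y2 at hy
    have l1 : y1.length = y.length - m0 := by rw [← e1]; simp
    have l2 : y2.length = m0 := by rw [← e2]; simp; omega
    have hvt : v.take m0 = wordInv y2 := by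
      rw [hv, hy, wordInv_append, List.take_append_of_le_length (by simp [l2]), List.take_of_length_le (by simp [l2])]
    have l3 : (x.take m).length = m := by simp [hmx]
    have l4 : (x.drop m).length = x.length - m := by simp
    have hrr : (y2 ++ x.take m) ++ (x.drop m ++ y1) ∈ symmClosure R := by
      have : (x ++ y1) ++ y2 ∈ symmClosure R := by grind
      have := sc_comm this
      rwa [List.append_assoc, ← List.append_assoc (x.take m), List.take_append_drop]
    have := wd_cx hsc hrr (q (m0 : ℤ))
    have e3 : q (m0 : ℤ) * ev (y2 ++ x.take m) = γ l := by
      rw [hgl]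
      simp only [hq, Int.toNat_natCast]
      rw [hvt, evalWord_inv, evalWord_append]; group
    rw [e3] at this
    simp only [List.length_append, l1, l2, l3, l4] at this
    omega
  have h5 : x.length + y.length ≤ 4 * wordDist (presGen R) (q ((y.length / 2 : ℕ) : ℤ)) (γ l) + 2 := by omega
  have h6 : (x.length + y.length : ℝ) ≤ 4 * wordDist (presGen R) (q ((y.length / 2 : ℕ) : ℤ)) (γ l) + 2 := by
    exact_mod_cast h5
  linarith
end P9
end MorseLTG
open Metric Set Filter
namespace MorseLTG
noncomputable section P10
local notation "oo" => (by omega)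
open scoped Classical
variable {S : Type*} {R : Set (Word S)}
variable (R) in
def Occ (M : ℝ → ℝ) (L : ℕ) (x y : Word S) : Prop := x ++ y ∈ symmClosure R ∧
  ∃ (I : Set ℤ) (γ : ℤ → Gp R) (i : ℤ), I.OrdConnected ∧ DGeodesicOn (presGen R) I γ ∧
    DLocMorseOn (presGen R) M L I γ ∧ i ∈ I ∧ i + (x.length : ℤ) ∈ I ∧ Along R γ i x
lemma Occ.sub {M : ℝ → ℝ} {L : ℕ} {x y p u v z : Word S} (h : Occ R M L x y) (hx : x = u ++ p ++ v)
    (hz : p ++ z ∈ symmClosure R) : Occ R M L p z := by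
  obtain ⟨-, I, γ, i, hI, hγ, hM, hi, hj, ha⟩ := h
  have hl : x.length = u.length + p.length + v.length := by simp [hx]; omega
  refine ⟨hz, I, γ, i + u.length, hI, hγ, hM, hI.out hi hj ⟨by omega, by omega⟩,
    hI.out hi hj ⟨by omega, by omega⟩, ?_⟩
  have := ha.sub (j := u.length) (m := p.length) oo
  grind
lemma Occ.bd (hsc : SmallCancellation R (1 / 6)) {M : ℝ → ℝ} {L : ℕ} {x y : Word S} (h : Occ R M L x y)
    (hL : x.length ≤ L) {k : ℕ} (hk : 1 ≤ k) (hxk : x.length + y.length ≤ k * x.length) :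
    x.length + y.length ≤ ⌈4 * M k + 2⌉₊ := by
  obtain ⟨hr, I, γ, i, hI, hγ, hM, hi, hj, ha⟩ := h
  have sub := hI.out hi hj
  have := morseA hsc ha (fun m hm n hn => hγ m (sub hm) n (sub hn))
    (hM i hi _ hj oo (by simp_all)) hr hk hxk
  have h2 := this.trans (Nat.le_ceil _)
  exact_mod_cast h2
lemma exOcc (hsc : SmallCancellation R (1 / 6)) {M : ℝ → ℝ}
    (h : ¬ ∃ (L : ℝ) (M' : ℝ → ℝ), 0 < L ∧ IsMorseGauge M' ∧
      ∀ I : Set ℤ, I.OrdConnected → ∀ p : ℤ → Gp R, DGeodesicOn (presGen R) I p →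
        DLocMorseOn (presGen R) M L I p → DMorseOn (presGen R) M' I p) {L : ℕ} (hL : 0 < L) :
    ∃ k : ℕ, ∀ N : ℕ, ∃ x y, Occ R M L x y ∧ N ≤ x.length + y.length ∧ x.length + y.length ≤ k * x.length := by
  by_contra hc
  push Not at hc
  choose Nf hNf using hc
  obtain ⟨M', hM', hB⟩ := morseB hsc Nf
  refine h ⟨L, M', by exact_mod_cast hL, hM', fun I hI γ hγ hl => hB I hI γ hγ fun K i x z hi hj ha hz hN => ?_⟩
  exact (hNf K x z ⟨hz, I, γ, i, hI, hγ, hl, hi, hj, ha⟩ hN).le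
lemma stage (hsc : SmallCancellation R (1 / 6)) {M : ℝ → ℝ}
    (h : ∀ L : ℕ, 0 < L → ∃ k : ℕ, ∀ N : ℕ, ∃ x y, Occ R M L x y ∧ N ≤ x.length + y.length ∧
      x.length + y.length ≤ k * x.length) (ns : ℕ → ℕ) (k : ℕ) :
    ∃ (i : ℕ) (x y : Word S), k ≤ i ∧ 0 < i ∧ x ++ y ∈ symmClosure R ∧ ns i ≤ x.length + y.length ∧
      x.length + y.length ≤ i * x.length ∧
      ∀ r ∈ symmClosure R, ∀ p : Word S, p ≠ [] → p <:+: x → p <:+: r → 6 * p.length < r.length ∧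
        ∀ k', 1 ≤ k' → k' ≤ k → ⌈4 * M k' + 2⌉₊ < r.length → k' * p.length < r.length := by
  set κ := 2 * (k + 6) with hκ
  set L := ns κ + κ with hL
  obtain ⟨i, x0, y0, hi, hO, hn, hx, hgi, hgL, hmin⟩ : ∃ (i : ℕ) (x y : Word S), κ ≤ i ∧ Occ R M L x y ∧
      ns i ≤ x.length + y.length ∧ x.length + y.length ≤ i * x.length ∧ i < x.length + y.length ∧
      L < x.length + y.length ∧ ∀ x' y', Occ R M L x' y' → L < x'.length + y'.length →
        x'.length + y'.length ≤ κ * x'.length → x.length + y.length ≤ x'.length + y'.length := by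
    by_cases hc : ∃ n, ∃ x y, Occ R M L x y ∧ L < n ∧ n ≤ κ * x.length ∧ n = x.length + y.length
    · obtain ⟨x, y, hO, h1, h2, h3⟩ := Nat.find_spec hc
      refine ⟨κ, x, y, le_rfl, hO, by omega, by omega, by omega, by omega, fun x' y' hO' h4 h5 => ?_⟩
      rw [← h3]
      exact Nat.find_min' hc ⟨x', y', hO', h4, h5, rfl⟩
    · obtain ⟨k2, h2⟩ := h L oo
      obtain ⟨x, y, hO, h3, h4⟩ := h2 (ns (max k2 κ) + max k2 κ + 1 + L)
      refine ⟨max k2 κ, x, y, le_max_right _ _, hO, by omega, h4.trans (Nat.mul_le_mul_right _ (le_max_left _ _)),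
        by omega, by omega, fun x' y' hO' h5 h6 => ?_⟩
      exact (hc ⟨_, x', y', hO', h5, h6, rfl⟩).elim
  obtain ⟨n, hnn⟩ : ∃ n, n = x0.length + y0.length := ⟨_, rfl⟩
  obtain ⟨c, hc1, hc2⟩ : ∃ c, n ≤ i * c ∧ i * c < n + i := by
    refine ⟨(n + i - 1) / i, ?_, ?_⟩
    · have := Nat.lt_mul_div_succ (n + i - 1) (show 0 < i by omega)
      grind
    · have := Nat.mul_div_le (n + i - 1) i
      omega
  have hcx : c ≤ x0.length := by
    by_contra hcc
    have h1 : i * (x0.length + 1) ≤ i * c := Nat.mul_le_mul_left _ oo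
    grind
  have hxx : x0 = x0.take c ++ x0.drop c := (List.take_append_drop _ _).symm
  generalize e1 : x0.take c = x at hxx
  generalize e2 : x0.drop c = x1 at hxx
  have hxl : x.length = c := by grind
  have hx0 : x0.length = x.length + x1.length := by grind
  have hkx : (k + 6) * x.length < n := by
    have : κ * c ≤ i * c := Nat.mul_le_mul_right _ hi
    grind
  have hr : x ++ (x1 ++ y0) ∈ symmClosure R := by
    have := hO.1
    grind
  have hlen : x.length + (x1 ++ y0).length = n := by simp; omega
  refine ⟨i, x, x1 ++ y0, by omega, by omega, hr, by omega, by grind, ?_⟩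
  rintro r hrR p hp ⟨u, v, hpx⟩ ⟨u', v', hpr⟩
  have hz : p ++ (v' ++ u') ∈ symmClosure R := by
    rw [← hpr, List.append_assoc] at hrR
    have := sc_comm hrR
    grind
  have hrl : r.length = p.length + (v' ++ u').length := by grind
  have hpl : p.length ≤ x.length := by grind
  have hO' : Occ R M L p (v' ++ u') := hO.sub (u := u) (v := v ++ x1) (by grind) hz
  have hk1 : ∀ k', k' ≤ k + 6 → k' * p.length < n := fun k' h =>
    lt_of_le_of_lt (Nat.mul_le_mul h hpl) hkx
  constructor
  · have hr2 : p ++ (v ++ (x1 ++ y0) ++ u) ∈ symmClosure R := by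
      rw [← hpx] at hr
      have : u ++ (p ++ (v ++ (x1 ++ y0))) ∈ symmClosure R := by grind
      have := sc_comm this
      grind
    by_cases heq : p ++ (v' ++ u') = p ++ (v ++ (x1 ++ y0) ++ u)
    · have h1 := congrArg List.length heq
      have h2 : (u ++ p ++ v).length = x.length := by grind
      simp at h1 h2 hlen hrl
      have := hk1 6 oo
      omega
    · have := hsc.2 r hrR p ⟨hp, _, hz, _, hr2, heq, ⟨_, rfl⟩, ⟨_, rfl⟩⟩ ⟨u', v', hpr⟩
      have h2 : (6 : ℝ) * p.length < r.length := by linarith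
      exact_mod_cast h2
  · intro k' h1 h2 hB
    by_contra hcon
    rcases le_or_gt r.length L with h3 | h3
    · have := hO'.bd hsc oo h1 oo
      omega
    · have h4 := hmin p _ hO' oo (by
        have : k' * p.length ≤ κ * p.length := Nat.mul_le_mul_right _ oo
        omega)
      have := hk1 k' oo
      omega
theorem main (hsc : SmallCancellation R (1 / 6)) (hnot : ¬ CayGeodesicMLTG (presGen R)) : IPSC R := by
  unfold CayGeodesicMLTG at hnot
  simp only [not_forall] at hnot
  obtain ⟨M, hM, hno⟩ := hnot
  intro ns hns
  have hex := fun L (hL : 0 < L) => exOcc (L := L) hsc hno hL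
  choose ii x y hki hi0 hr hn hx hT using stage hsc hex ns
  obtain ⟨t, ht⟩ : ∃ t : ℕ → ℕ, ∀ k, t k = ⌈4 * M k + 2⌉₊ + 1 + ∑ j ∈ Finset.range k, k * (x j).length + 1 :=
    ⟨_, fun _ => rfl⟩
  obtain ⟨g, hg⟩ : ∃ g : ℕ → ℕ, ∀ n, g n = Nat.findGreatest (fun k => t k ≤ n) n := ⟨_, fun _ => rfl⟩
  have gmono : Monotone g := fun m n h => by
    rw [hg, hg]
    exact Nat.findGreatest_mono (fun k hk => le_trans hk h) h
  refine ⟨fun n => ((max 6 (g n) : ℕ) : ℝ), ⟨?_, ?_, ?_⟩, ?_⟩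
  · intro m n h
    have := gmono h
    simp only [Nat.cast_le]
    omega
  · intro n
    show (6:ℝ) ≤ ((max 6 (g n) : ℕ) : ℝ)
    exact_mod_cast le_max_left 6 (g n)
  · refine tendsto_natCast_atTop_atTop.comp (tendsto_atTop_atTop.2 fun c => ⟨max c (t c), fun n h => ?_⟩)
    refine le_trans ?_ (le_max_right _ _)
    rw [hg]
    exact Nat.le_findGreatest oo oo
  · intro K
    refine ⟨ii K, hki K, x K ++ y K, hr K, x K, y K, rfl, ?_, ?_, ?_⟩
    · rw [List.length_append]; exact_mod_cast hn K
    · rw [div_le_iff₀ (by exact_mod_cast hi0 K), List.length_append, mul_comm]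
      exact_mod_cast hx K
    · intro r hrR p hp hpx hpr
      obtain ⟨h6, hk⟩ := hT K r hrR p hp hpx hpr
      have key : (max 6 (g r.length)) * p.length < r.length := by
        rcases le_or_gt (g r.length) 6 with h | h
        · rwa [max_eq_left h]
        rw [max_eq_right h.le]
        have hspec : t (g r.length) ≤ r.length := by
          have := Nat.findGreatest_of_ne_zero (P := fun k => t k ≤ r.length) (hg r.length).symm oo
          omega
        rw [ht] at hspec
        rcases le_or_gt (g r.length) K with h1 | h1
        · grind
        · have h2 : g r.length * (x K).length ≤ ∑ j ∈ Finset.range (g r.length), g r.length * (x j).length :=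
            Finset.single_le_sum (f := fun j => g r.length * (x j).length) (fun _ _ => Nat.zero_le _)
              (Finset.mem_range.2 h1)
          have h3 : g r.length * p.length ≤ g r.length * (x K).length := Nat.mul_le_mul_left _ hpx.length_le
          omega
      rw [lt_div_iff₀ (by positivity), mul_comm]
      show ((max 6 (g r.length) : ℕ) : ℝ) * (p.length:ℝ) < (r.length:ℝ)
      exact_mod_cast key
end P10
end MorseLTG
open MorseLTG in
/-- a `C'(1/6)` group whose Cayley graph does not satisfy the
geodesic MLTG property satisfies the IPSC condition. -/
theorem stmt4 {S : Type*} [Fintype S] (R : Set (Word S))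
    (hsc : SmallCancellation R (1 / 6))
    (hnot : ¬ CayGeodesicMLTG (presGen R)) :
    IPSC R := by
  exact MorseLTG.main hsc hnot
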